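/- Let p ≥ 1 and let S₀ be a real symmetric 2p×2p matrix with ordered spectrum σ = (σ₁ ≥ σ₂ ≥ … ≥ σ_{2p}). Then the image of the frequency map of S₀ equals 𝒫₁: a decreasing p-tuple (ν₁ ≥ … ≥ ν_p) is the ordered spectrum of a sum a + b of real symmetric p×p matrices a, b with ordered spectra (σ₁, σ₃, …, σ_{2p−1}) and (σ₂, σ₄, …, σ_{2p}) respectively, if and only if there exists a hermitian structure J on ℝ^{2p} (JᵀJ = I, J² = −I) such that the ordered spectrum of S₀ + J⁻¹S₀J is the doubled list (ν₁, ν₁, …, ν_p, ν_p). -/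

import Mathlib

open Matrix

set_option linter.unusedSectionVars false

namespace FrequencyMap

open Module

section Degree

variable {K E s : Type*} [Field K] [AddCommGroup E] [Module K E] [FiniteDimensional K E] [Fintype s]

/-- The degree of a subspace `V` with respect to a weighted family of subspaces. -/
noncomputable def degree (U : s → Submodule K E) (c : s → ℝ) (c₀ : ℝ) (V : Submodule K E) : ℝ :=
  ∑ i, c i * (finrank K ↥(V ⊓ U i) : ℝ) + c₀ * (finrank K V : ℝ)

theorem degree_add_le (U : s → Submodule K E) {c : s → ℝ} (hc : ∀ i, 0 ≤ c i) (c₀ : ℝ)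
    (V W : Submodule K E) :
    degree U c c₀ V + degree U c c₀ W ≤ degree U c c₀ (V ⊔ W) + degree U c c₀ (V ⊓ W) := by
  have h0 : (finrank K ↥(V ⊔ W) : ℝ) + finrank K ↥(V ⊓ W) = finrank K V + finrank K W := by
    exact_mod_cast Submodule.finrank_sup_add_finrank_inf_eq V W
  have h1 : ∀ i, (finrank K ↥(V ⊓ U i) : ℝ) + finrank K ↥(W ⊓ U i) ≤
      finrank K ↥((V ⊔ W) ⊓ U i) + finrank K ↥((V ⊓ W) ⊓ U i) := by
    intro i
    have e := Submodule.finrank_sup_add_finrank_inf_eq (V ⊓ U i) (W ⊓ U i)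
    have l : finrank K ↥((V ⊓ U i) ⊔ (W ⊓ U i)) ≤ finrank K ↥((V ⊔ W) ⊓ U i) :=
      Submodule.finrank_mono (le_inf (sup_le_sup inf_le_left inf_le_left)
        (sup_le inf_le_right inf_le_right))
    have e2 : (V ⊓ U i) ⊓ (W ⊓ U i) = (V ⊓ W) ⊓ U i := by
      rw [inf_inf_inf_comm, inf_idem]
    rw [e2] at e
    exact_mod_cast (by omega : finrank K ↥(V ⊓ U i) + finrank K ↥(W ⊓ U i) ≤
      finrank K ↥((V ⊔ W) ⊓ U i) + finrank K ↥((V ⊓ W) ⊓ U i))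
  have h2 : ∑ i, c i * ((finrank K ↥(V ⊓ U i) : ℝ) + finrank K ↥(W ⊓ U i)) ≤
      ∑ i, c i * ((finrank K ↥((V ⊔ W) ⊓ U i) : ℝ) + finrank K ↥((V ⊓ W) ⊓ U i)) :=
    Finset.sum_le_sum fun i _ => mul_le_mul_of_nonneg_left (h1 i) (hc i)
  simp only [mul_add, Finset.sum_add_distrib] at h2
  have h3 := congrArg (c₀ * ·) h0
  simp only [mul_add] at h3
  unfold degree
  linarith

theorem finite_range_degree (U : s → Submodule K E) (c : s → ℝ) (c₀ : ℝ) :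
    (Set.range (degree U c c₀)).Finite := by
  let N := finrank K E + 1
  let g : ((s → Fin N) × Fin N) → ℝ := fun x => ∑ i, c i * (x.1 i : ℝ) + c₀ * (x.2 : ℝ)
  refine (Set.finite_range g).subset ?_
  rintro _ ⟨V, rfl⟩
  refine ⟨⟨fun i => ⟨finrank K ↥(V ⊓ U i), Nat.lt_succ_of_le (Submodule.finrank_le _)⟩,
    ⟨finrank K V, Nat.lt_succ_of_le (Submodule.finrank_le _)⟩⟩, rfl⟩

/-- Among the members of a sublattice of subspaces, the degree has a least maximizer. -/
theorem exists_least_maximizer (U : s → Submodule K E) {c : s → ℝ} (hc : ∀ i, 0 ≤ c i) (c₀ : ℝ)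
    (P : Submodule K E → Prop) (hne : ∃ V, P V) (hinf : ∀ V W, P V → P W → P (V ⊓ W))
    (hsup : ∀ V W, P V → P W → P (V ⊔ W)) :
    ∃ V, P V ∧ (∀ W, P W → degree U c c₀ W ≤ degree U c c₀ V) ∧
      ∀ W, P W → degree U c c₀ V ≤ degree U c c₀ W → V ≤ W := by
  classical
  obtain ⟨m, ⟨V₁, hV₁, rfl⟩, hm⟩ := Set.exists_max_image (degree U c c₀ '' {V | P V}) id
    ((finite_range_degree U c c₀).subset (Set.image_subset_range _ _))
    (by obtain ⟨V, hV⟩ := hne; exact ⟨_, V, hV, rfl⟩)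
  have hm' : ∀ W, P W → degree U c c₀ W ≤ degree U c c₀ V₁ := fun W hW => hm _ ⟨W, hW, rfl⟩
  have hex : ∃ n, ∃ V, P V ∧ degree U c c₀ V = degree U c c₀ V₁ ∧ finrank K V = n :=
    ⟨_, V₁, hV₁, rfl, rfl⟩
  obtain ⟨V, hPV, hV, hVn⟩ := Nat.find_spec hex
  refine ⟨V, hPV, fun W hW => hV ▸ hm' W hW, fun W hW hVW => ?_⟩
  have h1 := degree_add_le U hc c₀ V W
  have h2 := hm' _ (hsup V W hPV hW)
  have h3 := hm' _ (hinf V W hPV hW)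
  have h4 : degree U c c₀ (V ⊓ W) = degree U c c₀ V₁ := by linarith
  have h5 := Nat.find_min' hex ⟨V ⊓ W, hinf V W hPV hW, h4, rfl⟩
  have h6 : V ⊓ W = V := Submodule.eq_of_le_of_finrank_le inf_le_left (hVn ▸ h5)
  exact inf_eq_left.mp h6

theorem finrank_inf_add_le_of_map_le {V U : Submodule K E} {φ : E →ₗ[K] E}
    (h : (V ⊓ U).map φ ≤ U ⊔ V) :
    finrank K ↥(V ⊓ U) + finrank K ↥(V ⊓ U) ≤
      finrank K ↥((V ⊓ V.comap φ) ⊓ U) + finrank K ↥((V ⊔ V.map φ) ⊓ U) := by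
  set M := V ⊔ V.map φ
  let ψ : ↥(V ⊓ U) →ₗ[K] E ⧸ V := V.mkQ ∘ₗ φ ∘ₗ (V ⊓ U).subtype
  have hker : finrank K (LinearMap.ker ψ) = finrank K ↥((V ⊓ V.comap φ) ⊓ U) := by
    have : (LinearMap.ker ψ).map (V ⊓ U).subtype = (V ⊓ V.comap φ) ⊓ U := by
      ext x
      simp only [Submodule.mem_map, LinearMap.mem_ker, ψ, LinearMap.comp_apply,
        Submodule.mkQ_apply, Submodule.Quotient.mk_eq_zero, Submodule.subtype_apply,
        Submodule.mem_inf, Submodule.mem_comap]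
      constructor
      · rintro ⟨y, hy, rfl⟩
        exact ⟨⟨y.2.1, hy⟩, y.2.2⟩
      · rintro ⟨⟨h1, h2⟩, h3⟩
        exact ⟨⟨x, h1, h3⟩, h2, rfl⟩
    rw [← this]
    exact (LinearEquiv.finrank_eq (Submodule.equivMapOfInjective _ (Submodule.subtype_injective _)
      (LinearMap.ker ψ)))
  have hrange : LinearMap.range ψ ≤ (M ⊓ U).map V.mkQ := by
    rintro _ ⟨y, rfl⟩
    have hy : φ y ∈ U ⊔ V := h ⟨y, y.2, rfl⟩
    obtain ⟨a, ha, b, hb, hab⟩ := Submodule.mem_sup.mp hy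
    refine ⟨a, ⟨?_, ha⟩, ?_⟩
    · have : a = φ y - b := by rw [← hab]; abel
      rw [this]
      exact M.sub_mem ((le_sup_right : V.map φ ≤ M) ⟨y, y.2.1, rfl⟩) ((le_sup_left : V ≤ M) hb)
    · simp only [ψ, LinearMap.comp_apply, Submodule.mkQ_apply, Submodule.subtype_apply]
      rw [Submodule.Quotient.eq, ← hab]
      simpa using hb
  have hMU : finrank K ↥((M ⊓ U).map V.mkQ) + finrank K ↥(V ⊓ U) = finrank K ↥(M ⊓ U) := by
    let θ : ↥(M ⊓ U) →ₗ[K] E ⧸ V := V.mkQ ∘ₗ (M ⊓ U).subtype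
    have h1 := LinearMap.finrank_range_add_finrank_ker θ
    have h2 : LinearMap.range θ = (M ⊓ U).map V.mkQ := by
      rw [LinearMap.range_comp, Submodule.range_subtype]
    have h3 : (LinearMap.ker θ).map (M ⊓ U).subtype = V ⊓ U := by
      ext x
      simp only [Submodule.mem_map, LinearMap.mem_ker, θ, LinearMap.comp_apply,
        Submodule.mkQ_apply, Submodule.Quotient.mk_eq_zero, Submodule.subtype_apply,
        Submodule.mem_inf]
      constructor
      · rintro ⟨y, hy, rfl⟩
        exact ⟨hy, y.2.2⟩
      · rintro ⟨h1, h2⟩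
        exact ⟨⟨x, (le_sup_left : V ≤ M) h1, h2⟩, h1, rfl⟩
    have h4 : finrank K (LinearMap.ker θ) = finrank K ↥(V ⊓ U) := by
      rw [← h3]
      exact LinearEquiv.finrank_eq (Submodule.equivMapOfInjective _
        (Submodule.subtype_injective _) (LinearMap.ker θ))
    rw [h2, h4] at h1
    exact h1
  have h1 := LinearMap.finrank_range_add_finrank_ker ψ
  have h2 := Submodule.finrank_mono hrange
  omega

theorem finrank_add_eq_of_map (V : Submodule K E) (φ : E →ₗ[K] E) :
    finrank K V + finrank K V = finrank K ↥(V ⊓ V.comap φ) + finrank K ↥(V ⊔ V.map φ) := by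
  let ψ : V →ₗ[K] E ⧸ V := V.mkQ ∘ₗ φ ∘ₗ V.subtype
  have hker : finrank K (LinearMap.ker ψ) = finrank K ↥(V ⊓ V.comap φ) := by
    have : (LinearMap.ker ψ).map V.subtype = V ⊓ V.comap φ := by
      ext x
      simp only [Submodule.mem_map, LinearMap.mem_ker, ψ, LinearMap.comp_apply,
        Submodule.mkQ_apply, Submodule.Quotient.mk_eq_zero, Submodule.subtype_apply,
        Submodule.mem_inf, Submodule.mem_comap]
      constructor
      · rintro ⟨y, hy, rfl⟩
        exact ⟨y.2, hy⟩
      · rintro ⟨h1, h2⟩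
        exact ⟨⟨x, h1⟩, h2, rfl⟩
    rw [← this]
    exact (LinearEquiv.finrank_eq (Submodule.equivMapOfInjective _ (Submodule.subtype_injective _)
      (LinearMap.ker ψ)))
  have hrange : LinearMap.range ψ = (V.map φ).map V.mkQ := by
    simp only [ψ, LinearMap.range_comp, Submodule.range_subtype]
  have h1 := LinearMap.finrank_range_add_finrank_ker ψ
  have h2 := LinearMap.finrank_range_add_finrank_ker (V.mkQ ∘ₗ (V.map φ).subtype)
  have h3 : finrank K (LinearMap.ker (V.mkQ ∘ₗ (V.map φ).subtype)) =
      finrank K ↥(V ⊓ V.map φ) := by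
    have : (LinearMap.ker (V.mkQ ∘ₗ (V.map φ).subtype)).map (V.map φ).subtype = V ⊓ V.map φ := by
      ext x
      simp only [Submodule.mem_map (f := (V.map φ).subtype), LinearMap.mem_ker,
        LinearMap.comp_apply, Submodule.mkQ_apply, Submodule.Quotient.mk_eq_zero,
        Submodule.subtype_apply, Submodule.mem_inf]
      constructor
      · rintro ⟨y, hy, rfl⟩
        exact ⟨hy, y.2⟩
      · rintro ⟨h1, h2⟩
        exact ⟨⟨x, h2⟩, h1, rfl⟩
    rw [← this]
    exact (LinearEquiv.finrank_eq (Submodule.equivMapOfInjective _ (Submodule.subtype_injective _)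
      _))
  rw [LinearMap.range_comp, Submodule.range_subtype] at h2
  have h4 := Submodule.finrank_sup_add_finrank_inf_eq V (V.map φ)
  rw [hrange, hker] at h1
  rw [h3] at h2
  omega

/-- A least maximizer of the degree is stable under the endomorphisms compatible with the
family of subspaces. -/
theorem map_le_of_least_maximizer {U : s → Submodule K E} {c : s → ℝ} (hc : ∀ i, 0 ≤ c i)
    {c₀ : ℝ} {P : Submodule K E → Prop} {V : Submodule K E}
    (hmax : ∀ W, P W → degree U c c₀ W ≤ degree U c c₀ V)
    (hleast : ∀ W, P W → degree U c c₀ V ≤ degree U c c₀ W → V ≤ W)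
    {φ : E →ₗ[K] E} (hφ : ∀ i, (V ⊓ U i).map φ ≤ U i ⊔ V)
    (h₁ : P (V ⊓ V.comap φ)) (h₂ : P (V ⊔ V.map φ)) : V.map φ ≤ V := by
  have hd : degree U c c₀ V + degree U c c₀ V ≤
      degree U c c₀ (V ⊓ V.comap φ) + degree U c c₀ (V ⊔ V.map φ) := by
    have h0 : (finrank K V : ℝ) + finrank K V =
        finrank K ↥(V ⊓ V.comap φ) + finrank K ↥(V ⊔ V.map φ) := by
      exact_mod_cast finrank_add_eq_of_map V φ
    have h2 : ∑ i, c i * ((finrank K ↥(V ⊓ U i) : ℝ) + finrank K ↥(V ⊓ U i)) ≤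
        ∑ i, c i * ((finrank K ↥((V ⊓ V.comap φ) ⊓ U i) : ℝ) +
          finrank K ↥((V ⊔ V.map φ) ⊓ U i)) :=
      Finset.sum_le_sum fun i _ => mul_le_mul_of_nonneg_left
        (by exact_mod_cast finrank_inf_add_le_of_map_le (hφ i)) (hc i)
    simp only [mul_add, Finset.sum_add_distrib] at h2
    have h3 := congrArg (c₀ * ·) h0
    simp only [mul_add] at h3
    unfold degree
    linarith
  have h3 := hmax _ h₂
  have h4 := hleast _ h₁ (by linarith)
  rw [Submodule.map_le_iff_le_comap]
  exact h4.trans inf_le_right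

end Degree

section Steps

variable {K ι : Type*} [Field K] [Fintype ι] [DecidableEq ι]

/-- The coordinate subspace of vectors supported on `T`. -/
def coordSub (K : Type*) [Field K] (T : Finset ι) : Submodule K (ι → K) where
  carrier := {v | ∀ r, r ∉ T → v r = 0}
  add_mem' := fun ha hb r hr => by simp [ha r hr, hb r hr]
  zero_mem' := fun _ _ => rfl
  smul_mem' := fun c v hv r hr => by simp [hv r hr]

theorem finrank_coordSub (T : Finset ι) : finrank K (coordSub K T) = T.card := by
  let e : coordSub K T ≃ₗ[K] (T → K) :=
    { toFun := fun v i => v.1 i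
      map_add' := fun _ _ => rfl
      map_smul' := fun _ _ => rfl
      invFun := fun f => ⟨fun r => if h : r ∈ T then f ⟨r, h⟩ else 0, fun r hr => by simp [hr]⟩
      left_inv := fun v => by
        ext r
        by_cases h : r ∈ T
        · simp [h]
        · simp [h, v.2 r h]
      right_inv := fun f => by
        ext r
        simp }
  rw [e.finrank_eq, finrank_fintype_fun_eq_card, Fintype.card_coe]

/-- The span of the columns of `G` indexed by `T`. -/
def stp (G : Matrix ι ι K) (T : Finset ι) : Submodule K (ι → K) :=
  (coordSub K T).map G.mulVecLin

variable {G : Matrix ι ι K}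

theorem mem_stp (hG : IsUnit G.det) {T : Finset ι} {v : ι → K} :
    v ∈ stp G T ↔ ∀ r, r ∉ T → (G⁻¹ *ᵥ v) r = 0 := by
  constructor
  · rintro ⟨x, hx, rfl⟩ r hr
    simpa [Matrix.mulVec_mulVec, Matrix.nonsing_inv_mul _ hG] using hx r hr
  · intro h
    exact ⟨G⁻¹ *ᵥ v, h, by simp [Matrix.mulVec_mulVec, Matrix.mul_nonsing_inv _ hG]⟩

theorem mulVec_injective_of_isUnit_det (hG : IsUnit G.det) :
    Function.Injective G.mulVecLin := by
  intro x y h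
  have h2 := congrArg (G⁻¹ *ᵥ ·) h
  simpa [Matrix.mulVec_mulVec, Matrix.nonsing_inv_mul _ hG] using h2

theorem finrank_stp (hG : IsUnit G.det) (T : Finset ι) : finrank K (stp G T) = T.card := by
  rw [← finrank_coordSub (K := K) T]
  exact (LinearEquiv.finrank_eq (Submodule.equivMapOfInjective _
    (mulVec_injective_of_isUnit_det hG) (coordSub K T))).symm

theorem stp_inf (hG : IsUnit G.det) (T T' : Finset ι) :
    stp G T ⊓ stp G T' = stp G (T ∩ T') := by
  ext v
  simp only [Submodule.mem_inf, mem_stp hG, Finset.mem_inter]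
  constructor
  · rintro ⟨h1, h2⟩ r hr
    by_cases h : r ∈ T
    · exact h2 r fun h' => hr ⟨h, h'⟩
    · exact h1 r h
  · exact fun h => ⟨fun r hr => h r fun h' => hr h'.1, fun r hr => h r fun h' => hr h'.2⟩

theorem stp_union (G : Matrix ι ι K) (T T' : Finset ι) :
    stp G (T ∪ T') = stp G T ⊔ stp G T' := by
  have : coordSub K (T ∪ T') = coordSub K T ⊔ coordSub K T' := by
    apply le_antisymm
    · intro v hv
      refine Submodule.mem_sup.mpr ⟨fun r => if r ∈ T then v r else 0, fun r hr => by simp [hr],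
        fun r => if r ∈ T then 0 else v r, fun r hr => ?_, ?_⟩
      · by_cases h : r ∈ T
        · simp [h]
        · simpa [h] using hv r (by simp [h, hr])
      · ext r
        by_cases h : r ∈ T <;> simp [h]
    · refine sup_le ?_ ?_ <;> intro v hv r hr <;> rw [Finset.mem_union, not_or] at hr
      · exact hv r hr.1
      · exact hv r hr.2
  rw [stp, this, Submodule.map_sup, stp, stp]

theorem stp_map (M G : Matrix ι ι K) (T : Finset ι) :
    (stp G T).map M.mulVecLin = stp (M * G) T := by
  rw [stp, stp, Matrix.mulVecLin_mul, Submodule.map_comp]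

/-- A matrix preserving a coordinate subspace. -/
theorem coordSub_map_le {B : Matrix ι ι K} {T : Finset ι}
    (hB : ∀ r, r ∉ T → ∀ i ∈ T, B r i = 0) : (coordSub K T).map B.mulVecLin ≤ coordSub K T := by
  rintro _ ⟨v, hv, rfl⟩ r hr
  rw [Matrix.mulVecLin_apply, Matrix.mulVec, dotProduct]
  refine Finset.sum_eq_zero fun i _ => ?_
  by_cases h : i ∈ T
  · rw [hB r hr i h, zero_mul]
  · rw [hv i h, mul_zero]

theorem stp_mul {B : Matrix ι ι K} (hB : IsUnit B.det) {T : Finset ι}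
    (h : ∀ r, r ∉ T → ∀ i ∈ T, B r i = 0) (A : Matrix ι ι K) : stp (A * B) T = stp A T := by
  have h1 : (coordSub K T).map B.mulVecLin = coordSub K T := by
    refine Submodule.eq_of_le_of_finrank_le (coordSub_map_le h) (le_of_eq ?_)
    exact (finrank_coordSub T).trans (finrank_stp hB T).symm
  rw [stp, Matrix.mulVecLin_mul, Submodule.map_comp, h1, stp]

/-- The column `i` of `G` lies in the step of `T` when `i ∈ T`. -/
theorem col_mem_stp (G : Matrix ι ι K) {T : Finset ι} {i : ι} (h : i ∈ T) :
    (fun r => G r i) ∈ stp G T := by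
  refine ⟨Pi.single i 1, fun r hr => ?_, ?_⟩
  · rw [Pi.single_apply, if_neg]
    rintro rfl
    exact hr h
  · ext r
    simp

/-- Every subspace has a basis adapted to a given flag. -/
theorem exists_adapted {n : ℕ} (V : Submodule K (Fin n → K)) :
    ∃ (B : Matrix (Fin n) (Fin n) K) (I : Finset (Fin n)), B.det = 1 ∧
      (∀ r i, i < r → B r i = 0) ∧ V = stp B I := by
  classical
  let Q : Fin n → (Fin n → K) → Prop := fun i v => v ∈ V ∧ v i = 1 ∧ ∀ r, i < r → v r = 0
  let b : Fin n → (Fin n → K) := fun i => if h : ∃ v, Q i v then h.choose else Pi.single i 1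
  let I : Finset (Fin n) := Finset.univ.filter fun i => ∃ v, Q i v
  have hbI : ∀ i ∈ I, Q i (b i) := by
    intro i hi
    have h : ∃ v, Q i v := (Finset.mem_filter.mp hi).2
    simp only [b, dif_pos h]
    exact h.choose_spec
  have hb : ∀ i, b i i = 1 ∧ ∀ r, i < r → b i r = 0 := by
    intro i
    by_cases h : ∃ v, Q i v
    · exact (hbI i (by simpa [I] using h)).2
    · simp only [b, dif_neg h]
      exact ⟨by simp, fun r hr => by simp [hr.ne']⟩
  let B : Matrix (Fin n) (Fin n) K := Matrix.of fun r i => b i r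
  have htri : ∀ r i, i < r → B r i = 0 := fun r i h => (hb i).2 r h
  have hdet : B.det = 1 := by
    rw [Matrix.det_of_isUpperTriangular (fun r i h => htri r i h)]
    exact Finset.prod_eq_one fun i _ => (hb i).1
  refine ⟨B, I, hdet, htri, le_antisymm ?_ ?_⟩
  · have key : ∀ m : ℕ, ∀ v ∈ V, (∀ r : Fin n, m ≤ r → v r = 0) → v ∈ stp B I := by
      intro m
      induction m with
      | zero =>
        intro v _ h
        have : v = 0 := funext fun r => h r (Nat.zero_le _)
        rw [this]
        exact Submodule.zero_mem _
      | succ m ih =>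
        intro v hv h
        by_cases hm : ∃ r : Fin n, (r : ℕ) = m ∧ v r ≠ 0
        · obtain ⟨i, hi, hne⟩ := hm
          have hiI : i ∈ I := by
            refine Finset.mem_filter.mpr ⟨Finset.mem_univ _, (v i)⁻¹ • v, V.smul_mem _ hv,
              by simp [hne], fun r hr => ?_⟩
            rw [Pi.smul_apply, h r (by have : (i : ℕ) < r := hr; omega), smul_zero]
          have h1 : v - v i • b i ∈ stp B I := by
            refine ih _ (V.sub_mem hv (V.smul_mem _ (hbI i hiI).1)) fun r hr => ?_
            rcases Nat.lt_or_ge m r with h2 | h2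
            · have h3 : i < r := by rw [Fin.lt_def]; omega
              simp [h r h2, (hb i).2 r h3]
            · have h3 : r = i := Fin.ext (by omega)
              subst h3
              simp [(hb r).1]
          have h2 : b i ∈ stp B I := col_mem_stp B hiI
          have := (stp B I).add_mem h1 ((stp B I).smul_mem (v i) h2)
          simpa using this
        · push Not at hm
          refine ih v hv fun r hr => ?_
          rcases Nat.lt_or_ge m r with h2 | h2
          · exact h r h2
          · exact hm r (by omega)
    exact fun v hv => key n v hv fun r hr => absurd r.2 (by omega)
  · rintro _ ⟨x, hx, rfl⟩
    rw [Matrix.mulVecLin_apply, Matrix.mulVec_eq_sum]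
    refine Submodule.sum_mem _ fun i _ => ?_
    by_cases h : i ∈ I
    · rw [op_smul_eq_smul]
      exact V.smul_mem _ (hbI i h).1
    · rw [hx i h]
      simp

end Steps

section FlagDegree

variable {K ι κ : Type*} [Field K] [Fintype ι] [DecidableEq ι] [Fintype κ]

/-- The indices of level at most `j`. -/
def lower (pos : ι → ℕ) (j : ℕ) : Finset ι := Finset.univ.filter fun i => pos i ≤ j

theorem mem_lower {pos : ι → ℕ} {j : ℕ} {i : ι} : i ∈ lower pos j ↔ pos i ≤ j := by
  simp [lower]

/-- The degree of a subspace with respect to a family of weighted flags; the flag `f` is spanned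
by the columns of `A f`, ordered by `pos f`, and carries the weights `w f`. -/
noncomputable def flagDegree (pos : κ → ι → ℕ) (w : κ → ℕ → ℝ) (N : ℕ) (A : κ → Matrix ι ι K)
    (V : Submodule K (ι → K)) : ℝ :=
  degree (fun s : κ × Fin N => stp (A s.1) (lower (pos s.1) s.2))
    (fun s => w s.1 s.2 - w s.1 (s.2 + 1)) (∑ f, w f N) V

theorem sum_weight_drop (w : ℕ → ℝ) (m N : ℕ) (h : m ≤ N) :
    ∑ j ∈ Finset.range N, (if m ≤ j then w j - w (j + 1) else 0) = w m - w N := by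
  induction N, h using Nat.le_induction with
  | base =>
    rw [sub_self]
    exact Finset.sum_eq_zero fun j hj => if_neg (by simpa using hj)
  | succ N hN ih =>
    rw [Finset.sum_range_succ, ih, if_pos hN]
    ring

theorem sum_drop_mul_card (pos : ι → ℕ) (w : ℕ → ℝ) {N : ℕ} (hpos : ∀ i, pos i < N)
    (I : Finset ι) :
    ∑ j : Fin N, (w j - w (j + 1)) * ((I.filter fun i => pos i ≤ j).card : ℝ) + w N * I.card =
      ∑ i ∈ I, w (pos i) := by
  have h1 : ∀ j : Fin N, (w j - w (j + 1)) * ((I.filter fun i => pos i ≤ j).card : ℝ) =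
      ∑ i ∈ I, if pos i ≤ j then w j - w (j + 1) else 0 := by
    intro j
    rw [← Finset.sum_filter, Finset.sum_const, nsmul_eq_mul, mul_comm]
  have h2 : ∀ i ∈ I, ∑ j : Fin N, (if pos i ≤ j then w j - w (j + 1) else 0) =
      w (pos i) - w N := by
    intro i _
    rw [← sum_weight_drop w (pos i) N (hpos i).le, Finset.sum_range]
  simp only [h1]
  rw [Finset.sum_comm, Finset.sum_congr rfl h2, Finset.sum_sub_distrib, Finset.sum_const,
    nsmul_eq_mul]
  ring

theorem flagDegree_eq_sum {pos : κ → ι → ℕ} (w : κ → ℕ → ℝ) {N : ℕ}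
    (hpos : ∀ f i, pos f i < N) {A C : κ → Matrix ι ι K} (hC : ∀ f, IsUnit (C f).det)
    (hAC : ∀ f j, stp (A f) (lower (pos f) j) = stp (C f) (lower (pos f) j))
    {V : Submodule K (ι → K)} {I : κ → Finset ι} (hV : ∀ f, V = stp (C f) (I f)) :
    flagDegree pos w N A V = ∑ f, ∑ i ∈ I f, w f (pos f i) := by
  have hfin : ∀ f, finrank K V = (I f).card := fun f => by
    rw [hV f, finrank_stp (hC f)]
  have hinter : ∀ f j, finrank K ↥(V ⊓ stp (A f) (lower (pos f) j)) =
      ((I f).filter fun i => pos f i ≤ j).card := by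
    intro f j
    rw [hAC, hV f, stp_inf (hC f), finrank_stp (hC f)]
    congr 1
    ext i
    simp [mem_lower]
  rw [flagDegree, degree, Fintype.sum_prod_type, Finset.sum_mul, ← Finset.sum_add_distrib]
  refine Finset.sum_congr rfl fun f _ => ?_
  rw [← sum_drop_mul_card (pos f) (w f) (hpos f) (I f), hfin f]
  simp only [hinter]

end FlagDegree

section Derivations

open scoped IntermediateField.algebraAdjoinAdjoin in
theorem exists_additive_leibniz {τ : Type*} {v : τ → ℝ} (hv : IsTranscendenceBasis ℚ v)
    (y : τ → ℝ) : ∃ D : ℝ →+ ℝ, (∀ a b, D (a * b) = D a * b + a * D b) ∧ ∀ i, D (v i) = y i := by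
  have key : ∀ {R A C : Type} [CommRing R] [CommRing A] [CommRing C] [Algebra R A]
      [Algebra.FormallySmooth R A] (f : R →+* C) (g : C →+* A), g.comp f = algebraMap R A →
      Function.Surjective g → IsNilpotent (RingHom.ker g) →
      ∃ h : A →+* C, (∀ a, g (h a) = a) ∧ ∀ r, h (algebraMap R A r) = f r := by
    intro R A C _ _ _ _ _ f g hfg hsurj hnil
    let _ : Algebra R C := f.toAlgebra
    let g' : C →ₐ[R] A := { g with commutes' := fun r => RingHom.congr_fun hfg r }
    let h := Algebra.FormallySmooth.liftOfSurjective (AlgHom.id R A) g' hsurj hnil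
    exact ⟨h, fun a => Algebra.FormallySmooth.liftOfSurjective_apply (AlgHom.id R A) g' hsurj
      hnil a, fun r => h.commutes r⟩
  let R := Algebra.adjoin ℚ (Set.range v)
  let F := IntermediateField.adjoin ℚ (Set.range v)
  have h1 : Algebra.FormallySmooth R F := .of_isLocalization (nonZeroDivisors _)
  have h2 : Algebra.IsAlgebraic F ℝ := hv.isAlgebraic_field
  have h3 : Algebra.FormallyEtale F ℝ := Algebra.FormallyEtale.of_isSeparable _ _
  have h4 : Algebra.FormallySmooth R ℝ := .comp R F ℝ
  let f : R →+* TrivSqZeroExt ℝ ℝ :=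
    ((MvPolynomial.aeval fun i => TrivSqZeroExt.inl (v i) + TrivSqZeroExt.inr (y i) :
      MvPolynomial τ ℚ →ₐ[ℚ] TrivSqZeroExt ℝ ℝ) : MvPolynomial τ ℚ →+* TrivSqZeroExt ℝ ℝ).comp
      (hv.1.aevalEquiv.symm : R →+* MvPolynomial τ ℚ)
  let g : TrivSqZeroExt ℝ ℝ →+* ℝ := (TrivSqZeroExt.fstHom ℝ ℝ ℝ : TrivSqZeroExt ℝ ℝ →+* ℝ)
  have hfg : g.comp f = algebraMap R ℝ := by
    have h5 : (g.comp f).comp (hv.1.aevalEquiv : MvPolynomial τ ℚ →+* R) =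
        (algebraMap R ℝ).comp (hv.1.aevalEquiv : MvPolynomial τ ℚ →+* R) := by
      apply MvPolynomial.ringHom_ext
      · intro r
        simp [f, g]
      · intro i
        simp [f, g]
    ext r
    obtain ⟨x, rfl⟩ := hv.1.aevalEquiv.surjective r
    exact RingHom.congr_fun h5 x
  obtain ⟨h, hg, hf⟩ := key f g hfg (fun a => ⟨TrivSqZeroExt.inl a, rfl⟩)
    ⟨2, by
      rw [pow_two, Ideal.zero_eq_bot, eq_bot_iff, Ideal.mul_le]
      intro a ha b hb
      have ha' : a.fst = 0 := ha
      have hb' : b.fst = 0 := hb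
      rw [Ideal.mem_bot]
      ext <;> simp [ha', hb']⟩
  have hfst : ∀ a, (h a).fst = a := hg
  refine ⟨{ toFun := fun a => (h a).snd, map_zero' := by simp, map_add' := fun a b => by simp },
    fun a b => ?_, fun i => ?_⟩
  · simp only [AddMonoidHom.coe_mk, ZeroHom.coe_mk, map_mul, TrivSqZeroExt.snd_mul, hfst]
    simp [mul_comm, add_comm]
  · have h6 : hv.1.aevalEquiv (MvPolynomial.X i) = (⟨v i, Algebra.subset_adjoin ⟨i, rfl⟩⟩ : R) := by
      apply Subtype.ext
      simp
    have h7 := hf ⟨v i, Algebra.subset_adjoin ⟨i, rfl⟩⟩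
    have h8 : f ⟨v i, Algebra.subset_adjoin ⟨i, rfl⟩⟩ =
        TrivSqZeroExt.inl (v i) + TrivSqZeroExt.inr (y i) := by
      rw [← h6]
      simp [f]
    have h9 : h (v i) = _ := h7.trans h8
    simp [h9]

/-- There are algebraically independent reals on which derivations take arbitrary values. -/
theorem exists_generic_reals (τ : Type) [Finite τ] : ∃ x : τ → ℝ, AlgebraicIndependent ℚ x ∧
    ∀ y : τ → ℝ, ∃ D : ℝ →+ ℝ, (∀ a b, D (a * b) = D a * b + a * D b) ∧ ∀ i, D (x i) = y i := by
  obtain ⟨B, v, hv⟩ := exists_isTranscendenceBasis' ℚ ℝ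
  have hB : Infinite B := by
    by_contra hfin
    rw [not_infinite_iff_finite] at hfin
    let R := Algebra.adjoin ℚ (Set.range v)
    have h0 : Algebra.IsAlgebraic R ℝ := hv.isAlgebraic
    have h2 : Cardinal.mk R ≤ Cardinal.aleph0 := by
      rw [← Cardinal.mk_congr hv.1.aevalEquiv.toEquiv]
      refine MvPolynomial.cardinalMk_le_max_lift.trans ?_
      simp
    have h3 : Cardinal.mk ℝ ≤ Cardinal.aleph0 :=
      (Algebra.IsAlgebraic.cardinalMk_le_max R ℝ).trans (max_le h2 le_rfl)
    rw [Cardinal.mk_real] at h3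
    exact absurd h3 (not_le.mpr Cardinal.aleph0_lt_continuum)
  obtain ⟨e⟩ : Nonempty (τ ↪ B) := by
    have := Fintype.ofFinite τ
    exact ⟨(Fintype.equivFin τ).toEmbedding.trans
      ((Fin.valEmbedding).trans (Infinite.natEmbedding B))⟩
  refine ⟨v ∘ e, hv.1.comp e e.injective, fun y => ?_⟩
  obtain ⟨D, hD, hDv⟩ := exists_additive_leibniz hv (Function.extend e y 0)
  exact ⟨D, hD, fun i => by simp [hDv, e.injective.extend_apply]⟩

end Derivations

section Generic

/-- Generic matrices, whose entrywise derivatives can be prescribed. -/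
theorem exists_generic_matrices (m n : ℕ) : ∃ A : Fin m → Matrix (Fin n) (Fin n) ℝ,
    (∀ f, IsUnit (A f).det) ∧ ∀ N : Fin m → Matrix (Fin n) (Fin n) ℝ, ∃ D : ℝ →+ ℝ,
      (∀ a b, D (a * b) = D a * b + a * D b) ∧ ∀ f, (A f).map D = N f * A f := by
  obtain ⟨x, hx, hD⟩ := exists_generic_reals (Fin m × Fin n × Fin n)
  refine ⟨fun f => Matrix.of fun r i => x (f, r, i), fun f => ?_, fun N => ?_⟩
  · rw [isUnit_iff_ne_zero]
    have h1 : AlgebraicIndependent ℚ (fun rc : Fin n × Fin n => x (f, rc)) :=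
      hx.comp _ (Prod.mk_right_injective f)
    have h2 : (Matrix.of fun r i => x (f, r, i)) = (Matrix.mvPolynomialX (Fin n) (Fin n) ℚ).map
        (MvPolynomial.aeval fun rc : Fin n × Fin n => x (f, rc)) := by
      ext r i
      simp [Matrix.mvPolynomialX]
    change (Matrix.of fun r i => x (f, r, i)).det ≠ 0
    rw [h2]
    have h3 := (AlgHom.map_det (MvPolynomial.aeval fun rc : Fin n × Fin n => x (f, rc))
      (Matrix.mvPolynomialX (Fin n) (Fin n) ℚ)).symm
    rw [AlgHom.mapMatrix_apply] at h3
    rw [h3]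
    exact fun h => Matrix.det_mvPolynomialX_ne_zero (Fin n) ℚ
      ((injective_iff_map_eq_zero _).mp h1 _ h)
  · obtain ⟨D, hD1, hD2⟩ := hD fun t =>
      (N t.1 * (Matrix.of fun r i => x (t.1, r, i))) t.2.1 t.2.2
    refine ⟨D, hD1, fun f => ?_⟩
    ext r i
    simp [hD2]

theorem map_mulVec_of_leibniz {n : ℕ} {D : ℝ →+ ℝ} (hD : ∀ a b, D (a * b) = D a * b + a * D b)
    (A : Matrix (Fin n) (Fin n) ℝ) (b : Fin n → ℝ) :
    (fun r => D ((A *ᵥ b) r)) = A.map D *ᵥ b + A *ᵥ (fun i => D (b i)) := by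
  ext r
  simp [Matrix.mulVec, dotProduct, hD, Finset.sum_add_distrib]

theorem exists_matrix_approx_leibniz {n : ℕ} {D : ℝ →+ ℝ}
    (hD : ∀ a b, D (a * b) = D a * b + a * D b) (V : Submodule ℝ (Fin n → ℝ)) :
    ∃ Φ : Matrix (Fin n) (Fin n) ℝ, ∀ v ∈ V, (fun r => D (v r)) - Φ *ᵥ v ∈ V := by
  let b := Module.finBasis ℝ V
  obtain ⟨φ, hφ⟩ := LinearMap.exists_extend
    (b.constr ℝ fun j => (fun r => D ((b j : Fin n → ℝ) r) : Fin n → ℝ))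
  refine ⟨LinearMap.toMatrix' φ, fun v hv => ?_⟩
  have h1 : ∀ j, φ (b j) = fun r => D ((b j : Fin n → ℝ) r) := by
    intro j
    have := LinearMap.congr_fun hφ (b j)
    simpa using this
  have h2 : v = ∑ j, b.repr ⟨v, hv⟩ j • (b j : Fin n → ℝ) := by
    have h := congrArg Subtype.val (b.sum_repr ⟨v, hv⟩)
    rw [Submodule.coe_sum] at h
    exact h.symm
  obtain ⟨c, hc⟩ : ∃ c : Fin (finrank ℝ V) → ℝ, ∀ j, b.repr ⟨v, hv⟩ j = c j := ⟨_, fun _ => rfl⟩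
  simp only [hc] at h2
  have h3 : (fun r => D (v r)) - LinearMap.toMatrix' φ *ᵥ v =
      ∑ j, D (c j) • (b j : Fin n → ℝ) := by
    rw [← Matrix.toLin'_apply, Matrix.toLin'_toMatrix', h2]
    ext r
    simp [h1, hD, Finset.sum_add_distrib, Finset.sum_apply]
  rw [h3]
  exact Submodule.sum_mem _ fun j _ => V.smul_mem _ (b j).2

/-- The subspace of matrices preserving `V`. -/
def stabilizer {n : ℕ} (V : Submodule ℝ (Fin n → ℝ)) : Submodule ℝ (Matrix (Fin n) (Fin n) ℝ) where
  carrier := {Φ | ∀ v ∈ V, Φ *ᵥ v ∈ V}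
  add_mem' := fun ha hb v hv => by
    rw [Matrix.add_mulVec]
    exact V.add_mem (ha v hv) (hb v hv)
  zero_mem' := fun v _ => by simp
  smul_mem' := fun c Φ h v hv => by
    rw [Matrix.smul_mulVec]
    exact V.smul_mem _ (h v hv)

/-- The inversions of a set of indices: the pairs `(r, i)` with `r` outside of `I`, `i` in `I` and
`r` after `i`. -/
def invSet {ι : Type*} [Fintype ι] [DecidableEq ι] (R : ι → ι → Prop) [DecidableRel R]
    (pos : ι → ℕ) (I : Finset ι) : Finset (ι × ι) :=
  Finset.univ.filter fun x => x.2 ∈ I ∧ x.1 ∉ I ∧ pos x.2 < pos x.1 ∧ R x.1 x.2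

theorem mem_invSet {ι : Type*} [Fintype ι] [DecidableEq ι] {R : ι → ι → Prop} [DecidableRel R]
    {pos : ι → ℕ} {I : Finset ι} {x : ι × ι} :
    x ∈ invSet R pos I ↔ x.2 ∈ I ∧ x.1 ∉ I ∧ pos x.2 < pos x.1 ∧ R x.1 x.2 := by
  simp [invSet]

/-- The inversions of a subset of `Fin n`. -/
abbrev inv {n : ℕ} (I : Finset (Fin n)) : Finset (Fin n × Fin n) :=
  invSet (fun _ _ => True) (fun i : Fin n => (i : ℕ)) I

theorem finrank_stabilizer_add_le {m n : ℕ} {A : Fin m → Matrix (Fin n) (Fin n) ℝ}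
    (hA : ∀ f, IsUnit (A f).det)
    (hgen : ∀ N : Fin m → Matrix (Fin n) (Fin n) ℝ, ∃ D : ℝ →+ ℝ,
      (∀ a b, D (a * b) = D a * b + a * D b) ∧ ∀ f, (A f).map D = N f * A f)
    {V : Submodule ℝ (Fin n → ℝ)} {B : Fin m → Matrix (Fin n) (Fin n) ℝ}
    {I : Fin m → Finset (Fin n)} (hB : ∀ f, (B f).det = 1)
    (htri : ∀ f r i, i < r → B f r i = 0) (hV : ∀ f, V = stp (A f * B f) (I f)) :
    finrank ℝ (stabilizer V) + ∑ f, (inv (I f)).card ≤ n * n := by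
  have hC : ∀ f, IsUnit (A f * B f).det := fun f => by
    rw [Matrix.det_mul, hB, mul_one]
    exact hA f
  let T : Matrix (Fin n) (Fin n) ℝ →ₗ[ℝ] (Σ f, inv (I f)) → ℝ :=
    { toFun := fun Φ x => ((A x.1 * B x.1)⁻¹ * Φ * (A x.1 * B x.1)) x.2.1.1 x.2.1.2
      map_add' := fun Φ Ψ => by
        ext x
        simp only [Matrix.mul_add, Matrix.add_mul, Matrix.add_apply, Pi.add_apply]
      map_smul' := fun c Φ => by
        ext x
        simp only [Matrix.mul_smul, Matrix.smul_mul, Matrix.smul_apply, Pi.smul_apply,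
          RingHom.id_apply] }
  have hker : stabilizer V ≤ LinearMap.ker T := by
    intro Φ hΦ
    rw [LinearMap.mem_ker]
    ext ⟨f, ⟨⟨r, i⟩, hx⟩⟩
    obtain ⟨hi, hr, -, -⟩ := mem_invSet.mp hx
    have h1 : (fun j => (A f * B f) j i) ∈ V := by
      rw [hV f]
      exact col_mem_stp _ hi
    have h2 := hΦ _ h1
    rw [hV f, mem_stp (hC f)] at h2
    have h3 := h2 r hr
    rw [Matrix.mulVec_mulVec] at h3
    exact h3
  have hsurj : Function.Surjective T := by
    intro y
    let M : Fin m → Matrix (Fin n) (Fin n) ℝ := fun f => Matrix.of fun r i =>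
      if h : (r, i) ∈ inv (I f) then y ⟨f, ⟨(r, i), h⟩⟩ else 0
    obtain ⟨D, hD, hN⟩ := hgen fun f => (A f * B f) * M f * (A f * B f)⁻¹
    obtain ⟨Φ, hΦ⟩ := exists_matrix_approx_leibniz hD V
    refine ⟨Φ, ?_⟩
    ext ⟨f, ⟨⟨r, i⟩, hx⟩⟩
    obtain ⟨hi, hr, hlt, -⟩ := mem_invSet.mp hx
    set C := A f * B f with hCdef
    let N := C * M f * C⁻¹
    let v : Fin n → ℝ := fun j => C j i
    have hv : v ∈ V := by
      rw [hV f]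
      exact col_mem_stp _ hi
    have hvb : v = A f *ᵥ (fun j => B f j i) := rfl
    have h1 := hΦ v hv
    have h2 : (fun r => D (v r)) = N *ᵥ v + A f *ᵥ (fun j => D (B f j i)) := by
      rw [hvb, map_mulVec_of_leibniz hD, hN, Matrix.mulVec_mulVec]
    have h3 : A f *ᵥ (fun j => D (B f j i)) ∈ stp C (lower (fun i : Fin n => (i : ℕ)) i) := by
      rw [hCdef, stp_mul (by rw [hB]; exact isUnit_one)]
      · refine ⟨fun j => D (B f j i), fun s hs => ?_, rfl⟩
        rw [mem_lower, not_le] at hs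
        simp only [htri f s i hs, map_zero]
      · intro s hs t ht
        rw [mem_lower] at ht hs
        exact htri f s t (by rw [Fin.lt_def]; omega)
    have h4 : (Φ - N) *ᵥ v ∈ stp C (lower (fun i : Fin n => (i : ℕ)) i ∪ I f) := by
      rw [stp_union, ← hV f]
      have h5 : (Φ - N) *ᵥ v = A f *ᵥ (fun j => D (B f j i)) -
          ((fun r => D (v r)) - Φ *ᵥ v) := by
        rw [h2, Matrix.sub_mulVec]
        abel
      rw [h5]
      exact Submodule.sub_mem _ (Submodule.mem_sup_left h3) (Submodule.mem_sup_right h1)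
    rw [mem_stp (hC f)] at h4
    have h6 := h4 r (by
      rw [Finset.mem_union, mem_lower, not_or]
      exact ⟨not_le.mpr hlt, hr⟩)
    have h7 : (C⁻¹ * (Φ - N) * C) r i = 0 := by
      rw [Matrix.mulVec_mulVec] at h6
      exact h6
    have h8 : C⁻¹ * N * C = M f := by
      have h9 : C⁻¹ * C = 1 := Matrix.nonsing_inv_mul _ (hC f)
      rw [show C⁻¹ * N * C = (C⁻¹ * C) * M f * (C⁻¹ * C) by simp only [N, Matrix.mul_assoc], h9,
        Matrix.one_mul, Matrix.mul_one]
    rw [Matrix.mul_sub, Matrix.sub_mul, h8, Matrix.sub_apply, sub_eq_zero] at h7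
    change (C⁻¹ * Φ * C) r i = _
    rw [h7]
    simp only [M, Matrix.of_apply, dif_pos hx]
  have h1 := LinearMap.finrank_range_add_finrank_ker T
  rw [LinearMap.range_eq_top.mpr hsurj, finrank_top, finrank_fintype_fun_eq_card,
    Fintype.card_sigma] at h1
  simp only [Fintype.card_coe, Module.finrank_matrix, Module.finrank_self, Fintype.card_fin,
    mul_one] at h1
  have h2 := Submodule.finrank_mono hker
  omega

end Generic

section Doubling

variable {n : ℕ}

/-- The positions of the two flags on the doubled space. -/
def posY (n : ℕ) : Bool → Fin n ⊕ Fin n → ℕ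
  | false => Sum.elim (fun i => i) (fun i => i)
  | true => Sum.elim (fun i => 2 * i) (fun i => 2 * i + 1)

theorem posY_lt (f : Bool) (i : Fin n ⊕ Fin n) : posY n f i < 2 * n := by
  cases f <;> rcases i with i | i <;> have := i.2 <;> simp [posY] <;> omega

/-- The pairs of indices which are relevant for the two flags on the doubled space. -/
def relY (n : ℕ) (f : Bool) (x y : Fin n ⊕ Fin n) : Prop := f = true ∨ x.isLeft = y.isLeft

instance (n : ℕ) (f : Bool) : DecidableRel (relY n f) := fun x y =>
  inferInstanceAs (Decidable (f = true ∨ x.isLeft = y.isLeft))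

/-- The projection to the first summand of the doubled space. -/
def leftProj (K : Type*) [Field K] (n : ℕ) : Matrix (Fin n ⊕ Fin n) (Fin n ⊕ Fin n) K :=
  fromBlocks 1 0 0 0

/-- The set of indices of the doubled flags. -/
def doubleSet (I : Fin 3 → Finset (Fin n)) : Bool → Finset (Fin n ⊕ Fin n)
  | false => (I 2).disjSum (I 2)
  | true => (I 0).disjSum (I 1)

theorem card_invSet_eq {ι : Type*} [Fintype ι] [DecidableEq ι] (R : ι → ι → Prop) [DecidableRel R]
    (pos : ι → ℕ) (I : Finset ι) :
    ((invSet R pos I).card : ℤ) = ∑ r, ∑ i, (if i ∈ I then (1 : ℤ) else 0) *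
      (1 - if r ∈ I then 1 else 0) * (if pos i < pos r ∧ R r i then 1 else 0) := by
  rw [invSet, Finset.card_filter, Nat.cast_sum, Fintype.sum_prod_type]
  refine Finset.sum_congr rfl fun r _ => Finset.sum_congr rfl fun i _ => ?_
  by_cases h1 : i ∈ I <;> by_cases h2 : r ∈ I <;> simp [h1, h2]

theorem card_invSet_double_false (I : Fin 3 → Finset (Fin n)) :
    (invSet (relY n false) (posY n false) (doubleSet I false)).card = 2 * (inv (I 2)).card := by
  zify
  rw [card_invSet_eq, card_invSet_eq]
  simp [posY, relY, doubleSet]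
  ring

theorem sum_lt_mul (δ : Fin n → ℤ) (h : ∑ i, δ i = 0) :
    2 * ∑ r, ∑ i, δ r * δ i * (if i < r then 1 else 0) + ∑ i, δ i * δ i = 0 := by
  have h1 : ∑ r, ∑ i, δ r * δ i * (if i < r then 1 else 0) =
      ∑ r, ∑ i, δ r * δ i * (if r < i then 1 else 0) := by
    rw [Finset.sum_comm]
    simp only [mul_comm]
  have h2 : ∑ i, δ i * δ i = ∑ r, ∑ i, δ r * δ i * (if i = r then 1 else 0) := by
    simp
  have h3 : ∑ r, ∑ i, δ r * δ i = 0 := by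
    rw [← Finset.sum_mul_sum, h, zero_mul]
  rw [two_mul]
  nth_rewrite 2 [h1]
  rw [h2]
  refine Eq.trans ?_ h3
  rw [← Finset.sum_add_distrib, ← Finset.sum_add_distrib]
  refine Finset.sum_congr rfl fun r _ => ?_
  rw [← Finset.sum_add_distrib, ← Finset.sum_add_distrib]
  refine Finset.sum_congr rfl fun i _ => ?_
  rcases lt_trichotomy r i with h | h | h
  · simp [h, h.not_gt, h.ne']
  · simp [h]
  · simp [h, h.not_gt, h.ne]

theorem card_invSet_double_true (I : Fin 3 → Finset (Fin n)) (h : (I 0).card = (I 1).card) :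
    (invSet (relY n true) (posY n true) (doubleSet I true)).card =
      2 * (inv (I 0)).card + 2 * (inv (I 1)).card := by
  zify
  rw [card_invSet_eq, card_invSet_eq, card_invSet_eq]
  have e1 : ∀ i r : Fin n, (2 * (i : ℕ) < 2 * r) = (i < r) := fun i r => by
    rw [eq_iff_iff, Fin.lt_def]; omega
  have e2 : ∀ i r : Fin n, (2 * (i : ℕ) < 2 * r + 1) = (i ≤ r) := fun i r => by
    rw [eq_iff_iff, Fin.le_def]; omega
  have e3 : ∀ i r : Fin n, (2 * (i : ℕ) + 1 < 2 * r) = (i < r) := fun i r => by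
    rw [eq_iff_iff, Fin.lt_def]; omega
  have e4 : ∀ i r : Fin n, (2 * (i : ℕ) + 1 < 2 * r + 1) = (i < r) := fun i r => by
    rw [eq_iff_iff, Fin.lt_def]; omega
  have e5 : ∀ i r : Fin n, ((if i ≤ r then 1 else 0 : ℤ)) =
      (if i < r then 1 else 0) + (if i = r then 1 else 0) := fun i r => by
    rcases lt_trichotomy i r with h | h | h
    · simp [h, h.le, h.ne]
    · simp [h]
    · simp [h.not_ge, h.not_gt, h.ne']
  simp only [posY, relY, doubleSet, Fintype.sum_sum_type, Sum.elim_inl, Sum.elim_inr,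
    Finset.inl_mem_disjSum, Finset.inr_mem_disjSum, true_or, and_true, e1, e2, e3, e4, e5,
    Fin.val_fin_lt]
  set a : Fin n → ℤ := fun i => if i ∈ I 0 then 1 else 0 with ha
  set b : Fin n → ℤ := fun i => if i ∈ I 1 then 1 else 0 with hb
  have ha' : ∀ i, (if i ∈ I 0 then 1 else 0 : ℤ) = a i := fun _ => rfl
  have hb' : ∀ i, (if i ∈ I 1 then 1 else 0 : ℤ) = b i := fun _ => rfl
  simp only [ha', hb']
  have haa : ∀ i, a i * a i = a i := fun i => by by_cases h : i ∈ I 0 <;> simp [ha, h]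
  have hbb : ∀ i, b i * b i = b i := fun i => by by_cases h : i ∈ I 1 <;> simp [hb, h]
  have hs : ∑ i, a i = ∑ i, b i := by
    simp only [ha, hb, Finset.sum_ite_mem, Finset.univ_inter, Finset.sum_const, h]
  have key := sum_lt_mul (fun i => a i - b i) (by simp [hs])
  have hdiag : ∑ r, ∑ i, a i * (1 - b r) * (if i = r then 1 else 0 : ℤ) =
      ∑ i, (a i - a i * b i) := by
    refine Finset.sum_congr rfl fun r _ => ?_
    simp [mul_sub]
  have hsq : ∑ i, (a i - b i) * (a i - b i) = 2 * ∑ i, (a i - a i * b i) := by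
    have : ∀ i, (a i - b i) * (a i - b i) = 2 * (a i - a i * b i) + (b i - a i) := fun i => by
      linear_combination haa i + hbb i
    simp only [this]
    rw [Finset.sum_add_distrib, ← Finset.mul_sum, Finset.sum_sub_distrib b a, hs]
    ring
  rw [hsq, ← mul_add, mul_eq_zero] at key
  have key := key.resolve_left two_ne_zero
  simp only [mul_add, Finset.sum_add_distrib]
  rw [hdiag]
  have hpt : ∑ r, ∑ i, b i * (1 - a r) * (if i < r then 1 else 0 : ℤ) +
      ∑ r, ∑ i, a i * (1 - b r) * (if i < r then 1 else 0 : ℤ) =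
      ∑ r, ∑ i, a i * (1 - a r) * (if i < r then 1 else 0 : ℤ) +
      ∑ r, ∑ i, b i * (1 - b r) * (if i < r then 1 else 0 : ℤ) +
      ∑ r, ∑ i, (a r - b r) * (a i - b i) * (if i < r then 1 else 0 : ℤ) := by
    simp only [← Finset.sum_add_distrib]
    refine Finset.sum_congr rfl fun r _ => Finset.sum_congr rfl fun i _ => ?_
    ring
  linarith

end Doubling

section Block

variable {K : Type*} [Field K] {n : ℕ}

/-- Block diagonal matrices. -/
def IsBlock (M : Matrix (Fin n ⊕ Fin n) (Fin n ⊕ Fin n) K) : Prop :=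
  Commute M (leftProj K n)

theorem isBlock_fromBlocks (A B : Matrix (Fin n) (Fin n) K) : IsBlock (fromBlocks A 0 0 B) := by
  simp [IsBlock, leftProj, Commute, SemiconjBy, fromBlocks_multiply]

theorem IsBlock.eq_fromBlocks {M : Matrix (Fin n ⊕ Fin n) (Fin n ⊕ Fin n) K} (h : IsBlock M) :
    M = fromBlocks M.toBlocks₁₁ 0 0 M.toBlocks₂₂ := by
  have h1 : M * leftProj K n = leftProj K n * M := h
  rw [← fromBlocks_toBlocks M, leftProj, fromBlocks_multiply, fromBlocks_multiply,
    fromBlocks_inj] at h1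
  simp only [Matrix.mul_one, Matrix.mul_zero, Matrix.one_mul, Matrix.zero_mul, add_zero] at h1
  conv_lhs => rw [← fromBlocks_toBlocks M]
  rw [h1.2.2.1, ← h1.2.1]

theorem IsBlock.apply_eq_zero {M : Matrix (Fin n ⊕ Fin n) (Fin n ⊕ Fin n) K} (h : IsBlock M)
    {x y : Fin n ⊕ Fin n} (hxy : x.isLeft ≠ y.isLeft) : M x y = 0 := by
  rw [h.eq_fromBlocks]
  rcases x with x | x <;> rcases y with y | y <;> simp at hxy ⊢

theorem isBlock_of_apply_eq_zero {M : Matrix (Fin n ⊕ Fin n) (Fin n ⊕ Fin n) K}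
    (h : ∀ x y, x.isLeft ≠ y.isLeft → M x y = 0) : IsBlock M := by
  have : M = fromBlocks M.toBlocks₁₁ 0 0 M.toBlocks₂₂ := by
    ext x y
    rcases x with x | x <;> rcases y with y | y
    · rfl
    · exact h _ _ (by simp)
    · exact h _ _ (by simp)
    · rfl
  rw [this]
  exact isBlock_fromBlocks _ _

theorem IsBlock.mul {M N : Matrix (Fin n ⊕ Fin n) (Fin n ⊕ Fin n) K} (hM : IsBlock M)
    (hN : IsBlock N) : IsBlock (M * N) :=
  Commute.mul_left hM hN

theorem IsBlock.inv {M : Matrix (Fin n ⊕ Fin n) (Fin n ⊕ Fin n) K} (hM : IsBlock M)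
    (hdet : IsUnit M.det) : IsBlock M⁻¹ := by
  have h1 : M * leftProj K n = leftProj K n * M := hM
  have h2 : M⁻¹ * M = 1 := Matrix.nonsing_inv_mul _ hdet
  have h3 : M * M⁻¹ = 1 := Matrix.mul_nonsing_inv _ hdet
  calc M⁻¹ * leftProj K n = M⁻¹ * (leftProj K n * M) * M⁻¹ := by
        rw [Matrix.mul_assoc, Matrix.mul_assoc, h3, Matrix.mul_one]
    _ = leftProj K n * M⁻¹ := by
        rw [← h1, ← Matrix.mul_assoc, h2, Matrix.one_mul]

/-- Subspaces of the doubled space which are direct sums of subspaces of the summands. -/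
def IsGraded (W : Submodule K (Fin n ⊕ Fin n → K)) : Prop :=
  ∀ v ∈ W, leftProj K n *ᵥ v ∈ W

theorem isGraded_inf {V W : Submodule K (Fin n ⊕ Fin n → K)} (hV : IsGraded V)
    (hW : IsGraded W) : IsGraded (V ⊓ W) :=
  fun v hv => ⟨hV v hv.1, hW v hv.2⟩

theorem isGraded_sup {V W : Submodule K (Fin n ⊕ Fin n → K)} (hV : IsGraded V)
    (hW : IsGraded W) : IsGraded (V ⊔ W) := by
  intro v hv
  obtain ⟨a, ha, b, hb, rfl⟩ := Submodule.mem_sup.mp hv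
  rw [Matrix.mulVec_add]
  exact Submodule.add_mem_sup (hV a ha) (hW b hb)

theorem isGraded_map {W : Submodule K (Fin n ⊕ Fin n → K)} (hW : IsGraded W)
    {U : Matrix (Fin n ⊕ Fin n) (Fin n ⊕ Fin n) K} (hU : IsBlock U) :
    IsGraded (W.map U.mulVecLin) := by
  rintro _ ⟨v, hv, rfl⟩
  refine ⟨leftProj K n *ᵥ v, hW v hv, ?_⟩
  have h1 : U * leftProj K n = leftProj K n * U := hU
  simp [Matrix.mulVec_mulVec, h1]

theorem isGraded_comap {W : Submodule K (Fin n ⊕ Fin n → K)} (hW : IsGraded W)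
    {U : Matrix (Fin n ⊕ Fin n) (Fin n ⊕ Fin n) K} (hU : IsBlock U) :
    IsGraded (W.comap U.mulVecLin) := by
  intro v hv
  have h1 : U * leftProj K n = leftProj K n * U := hU
  rw [Submodule.mem_comap, Matrix.mulVecLin_apply, Matrix.mulVec_mulVec, h1,
    ← Matrix.mulVec_mulVec]
  exact hW _ hv

/-- The direct sum of two copies of a subspace. -/
def dbl (V : Submodule K (Fin n → K)) : Submodule K (Fin n ⊕ Fin n → K) :=
  V.comap (LinearMap.funLeft K K Sum.inl) ⊓ V.comap (LinearMap.funLeft K K Sum.inr)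

theorem mem_dbl {V : Submodule K (Fin n → K)} {v : Fin n ⊕ Fin n → K} :
    v ∈ dbl V ↔ v ∘ Sum.inl ∈ V ∧ v ∘ Sum.inr ∈ V := Iff.rfl

theorem leftProj_mulVec (v : Fin n ⊕ Fin n → K) :
    leftProj K n *ᵥ v = Sum.elim (v ∘ Sum.inl) 0 := by
  rw [leftProj, Matrix.fromBlocks_mulVec]
  simp

theorem isGraded_dbl (V : Submodule K (Fin n → K)) : IsGraded (dbl V) := by
  intro v hv
  rw [mem_dbl] at hv ⊢
  rw [leftProj_mulVec]
  exact ⟨by simpa using hv.1, by simp⟩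

/-- The interchange of the two summands. -/
def swapMat (K : Type*) [Field K] (n : ℕ) : Matrix (Fin n ⊕ Fin n) (Fin n ⊕ Fin n) K :=
  fromBlocks 0 1 1 0

theorem swapMat_mul_self : swapMat K n * swapMat K n = 1 := by
  simp [swapMat, fromBlocks_multiply]

theorem swapMat_mulVec (v : Fin n ⊕ Fin n → K) :
    swapMat K n *ᵥ v = Sum.elim (v ∘ Sum.inr) (v ∘ Sum.inl) := by
  rw [swapMat, Matrix.fromBlocks_mulVec]
  simp

theorem exists_eq_dbl {W : Submodule K (Fin n ⊕ Fin n → K)} (hW : IsGraded W)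
    (hs : W.map (swapMat K n).mulVecLin = W) : ∃ V, W = dbl V := by
  let j : (Fin n → K) →ₗ[K] (Fin n ⊕ Fin n → K) :=
    { toFun := fun v => Sum.elim v 0
      map_add' := fun a b => by ext (i | i) <;> simp
      map_smul' := fun a b => by ext (i | i) <;> simp }
  have hsw : ∀ v ∈ W, swapMat K n *ᵥ v ∈ W := fun v hv => hs ▸ ⟨v, hv, rfl⟩
  refine ⟨W.comap j, ?_⟩
  ext v
  rw [mem_dbl]
  change v ∈ W ↔ Sum.elim (v ∘ Sum.inl) 0 ∈ W ∧ Sum.elim (v ∘ Sum.inr) 0 ∈ W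
  constructor
  · intro hv
    refine ⟨leftProj_mulVec v ▸ hW v hv, ?_⟩
    have := hW _ (hsw v hv)
    rw [leftProj_mulVec, swapMat_mulVec] at this
    simpa using this
  · rintro ⟨h1, h2⟩
    have h3 := hsw _ h2
    rw [swapMat_mulVec] at h3
    have h4 := W.add_mem h1 h3
    convert h4 using 1
    ext (i | i) <;> simp

end Block

section Double

variable {K : Type*} [Field K] {n : ℕ}

/-- The matrices of the two flags on the doubled space associated to three flags. -/
def doubleMat (A : Fin 3 → Matrix (Fin n) (Fin n) K) :
    Bool → Matrix (Fin n ⊕ Fin n) (Fin n ⊕ Fin n) K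
  | false => fromBlocks (A 2) 0 0 (A 2)
  | true => fromBlocks (A 0) (A 1) (A 0) (-A 1)

/-- The change of basis on the doubled space associated to three changes of basis. -/
def doubleBase (B : Fin 3 → Matrix (Fin n) (Fin n) K) :
    Bool → Matrix (Fin n ⊕ Fin n) (Fin n ⊕ Fin n) K
  | false => fromBlocks (B 2) 0 0 (B 2)
  | true => fromBlocks (B 0) 0 0 (B 1)

theorem doubleMat_mul (A B : Fin 3 → Matrix (Fin n) (Fin n) K) (f : Bool) :
    doubleMat (fun f => A f * B f) f = doubleMat A f * doubleBase B f := by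
  cases f <;> simp [doubleMat, doubleBase, fromBlocks_multiply]

theorem isUnit_det_doubleMat [CharZero K] {A : Fin 3 → Matrix (Fin n) (Fin n) K}
    (hA : ∀ f, IsUnit (A f).det) (f : Bool) : IsUnit (doubleMat A f).det := by
  cases f
  · simp only [doubleMat, Matrix.det_fromBlocks_zero₂₁]
    exact (hA 2).mul (hA 2)
  · have h1 : doubleMat A true = fromBlocks 1 1 1 (-1) * fromBlocks (A 0) 0 0 (A 1) := by
      simp [doubleMat, fromBlocks_multiply]
    rw [h1, Matrix.det_mul, Matrix.det_fromBlocks_zero₂₁]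
    refine IsUnit.mul ?_ ((hA 0).mul (hA 1))
    have h2 : (fromBlocks 1 1 1 (-1) : Matrix (Fin n ⊕ Fin n) (Fin n ⊕ Fin n) K) *
        fromBlocks 1 1 1 (-1) = (2 : K) • 1 := by
      rw [fromBlocks_multiply, ← fromBlocks_one, fromBlocks_smul]
      simp [two_smul]
    have h3 := congrArg Matrix.det h2
    rw [Matrix.det_mul, Matrix.det_smul, Matrix.det_one, mul_one] at h3
    refine isUnit_of_mul_isUnit_left (y := (fromBlocks 1 1 1 (-1) : Matrix (Fin n ⊕ Fin n)
      (Fin n ⊕ Fin n) K).det) ?_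
    rw [h3]
    exact (isUnit_iff_ne_zero.mpr two_ne_zero).pow _

theorem stp_doubleMat_lower (A : Fin 3 → Matrix (Fin n) (Fin n) K)
    {B : Fin 3 → Matrix (Fin n) (Fin n) K} (hB : ∀ f, (B f).det = 1)
    (htri : ∀ f r i, i < r → B f r i = 0) (f : Bool) (j : ℕ) :
    stp (doubleMat A f) (lower (posY n f) j) =
      stp (doubleMat (fun f => A f * B f) f) (lower (posY n f) j) := by
  rw [doubleMat_mul, stp_mul]
  · cases f <;> simp [doubleBase, Matrix.det_fromBlocks_zero₂₁, hB]
  · intro r hr i hi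
    rw [mem_lower] at hr hi
    cases f <;> rcases r with r | r <;> rcases i with i | i <;>
      simp only [posY, Sum.elim_inl, Sum.elim_inr] at hr hi <;>
      simp only [doubleBase, fromBlocks_apply₁₁, fromBlocks_apply₁₂, fromBlocks_apply₂₁,
        fromBlocks_apply₂₂, Matrix.zero_apply] <;>
      exact htri _ r i (by rw [Fin.lt_def]; omega)

theorem swapMat_map_stp_lower (A : Fin 3 → Matrix (Fin n) (Fin n) K) (f : Bool) (j : ℕ) :
    (stp (doubleMat A f) (lower (posY n f) j)).map (swapMat K n).mulVecLin =
      stp (doubleMat A f) (lower (posY n f) j) := by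
  rw [stp_map]
  cases f
  · have h1 : swapMat K n * doubleMat A false = doubleMat A false * swapMat K n := by
      simp [doubleMat, swapMat, fromBlocks_multiply]
    rw [h1, stp_mul]
    · refine isUnit_of_mul_isUnit_left (y := (swapMat K n).det) ?_
      rw [← Matrix.det_mul, swapMat_mul_self, Matrix.det_one]
      exact isUnit_one
    · intro r hr i hi
      rw [mem_lower] at hr hi
      rcases r with r | r <;> rcases i with i | i <;>
        simp only [posY, Sum.elim_inl, Sum.elim_inr] at hr hi <;>
        simp [swapMat, Matrix.one_apply] <;> rintro rfl <;> omega
  · have h1 : swapMat K n * doubleMat A true = doubleMat A true * fromBlocks 1 0 0 (-1) := by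
      simp [doubleMat, swapMat, fromBlocks_multiply]
    rw [h1, stp_mul]
    · rw [Matrix.det_fromBlocks_zero₂₁, Matrix.det_one, one_mul]
      refine isUnit_of_mul_isUnit_left (y := (-1 : Matrix (Fin n) (Fin n) K).det) ?_
      rw [← Matrix.det_mul]
      simp
    · intro r hr i hi
      rw [mem_lower] at hr hi
      have hne : r ≠ i := by
        rintro rfl
        exact hr hi
      rcases r with r | r <;> rcases i with i | i <;> simp at hne <;> simp [hne]

theorem finrank_dbl_eq {C : Fin 3 → Matrix (Fin n) (Fin n) K} {V : Submodule K (Fin n → K)}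
    {I : Fin 3 → Finset (Fin n)} (hC : ∀ f, IsUnit (C f).det) (hV : ∀ f, V = stp (C f) (I f)) :
    dbl V = stp (doubleMat C false) (doubleSet I false) := by
  ext v
  have h1 : (doubleMat C false)⁻¹ = fromBlocks (C 2)⁻¹ 0 0 (C 2)⁻¹ := by
    refine Matrix.inv_eq_left_inv ?_
    simp [doubleMat, fromBlocks_multiply, Matrix.nonsing_inv_mul _ (hC 2)]
  have h2 : IsUnit (doubleMat C false).det := by
    simp only [doubleMat, Matrix.det_fromBlocks_zero₂₁]
    exact (hC 2).mul (hC 2)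
  rw [mem_stp h2, mem_dbl, hV 2, mem_stp (hC 2), mem_stp (hC 2), h1, Matrix.fromBlocks_mulVec]
  simp only [Matrix.zero_mulVec, add_zero, zero_add]
  constructor
  · rintro ⟨h3, h4⟩ (r | r) hr
    · exact h3 r (by simpa [doubleSet] using hr)
    · exact h4 r (by simpa [doubleSet] using hr)
  · intro h
    exact ⟨fun r hr => h (Sum.inl r) (by simpa [doubleSet] using hr),
      fun r hr => h (Sum.inr r) (by simpa [doubleSet] using hr)⟩

theorem dbl_eq_stp [CharZero K] {C : Fin 3 → Matrix (Fin n) (Fin n) K}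
    {V : Submodule K (Fin n → K)} {I : Fin 3 → Finset (Fin n)} (hC : ∀ f, IsUnit (C f).det)
    (hV : ∀ f, V = stp (C f) (I f)) (f : Bool) :
    dbl V = stp (doubleMat C f) (doubleSet I f) := by
  cases f
  · exact finrank_dbl_eq hC hV
  · symm
    have hcard : ∀ f, (I f).card = finrank K V := fun f => by rw [hV f, finrank_stp (hC f)]
    refine Submodule.eq_of_le_of_finrank_le ?_ (le_of_eq ?_)
    · rintro _ ⟨x, hx, rfl⟩
      have h0 : C 0 *ᵥ (x ∘ Sum.inl) ∈ V := by
        rw [hV 0]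
        exact ⟨_, fun r hr => hx (Sum.inl r) (by simpa [doubleSet] using hr), rfl⟩
      have h1 : C 1 *ᵥ (x ∘ Sum.inr) ∈ V := by
        rw [hV 1]
        exact ⟨_, fun r hr => hx (Sum.inr r) (by simpa [doubleSet] using hr), rfl⟩
      rw [mem_dbl, Matrix.mulVecLin_apply, doubleMat, Matrix.fromBlocks_mulVec]
      refine ⟨V.add_mem h0 h1, ?_⟩
      have := V.sub_mem h0 h1
      simpa [Matrix.neg_mulVec, sub_eq_add_neg] using this
    · rw [finrank_dbl_eq hC hV, finrank_stp (isUnit_det_doubleMat hC false),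
        finrank_stp (isUnit_det_doubleMat hC true)]
      simp [doubleSet, Finset.card_disjSum, hcard]

/-- The weights of the three flags. -/
def wX (σ γ : ℕ → ℝ) : Fin 3 → ℕ → ℝ :=
  ![fun i => σ (2 * i), fun i => σ (2 * i + 1), γ]

/-- The weights of the two flags on the doubled space. -/
noncomputable def wY (σ γ : ℕ → ℝ) : Bool → ℕ → ℝ
  | false => fun i => γ i / 2
  | true => σ

/-- The positions of the standard flags. -/
def posX (n : ℕ) : Fin 3 → Fin n → ℕ := fun _ i => i

theorem sum_weights_double (σ γ : ℕ → ℝ) (I : Fin 3 → Finset (Fin n)) :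
    ∑ f, ∑ i ∈ doubleSet I f, wY σ γ f (posY n f i) =
      ∑ f, ∑ i ∈ I f, wX σ γ f (posX n f i) := by
  rw [Fintype.sum_bool, Fin.sum_univ_three]
  simp only [doubleSet, Finset.sum_disjSum, wY, posY, wX, posX, Sum.elim_inl, Sum.elim_inr,
    Matrix.cons_val_zero, Matrix.cons_val_one, Matrix.cons_val]
  rw [← Finset.sum_div]
  ring

theorem flagDegree_dbl [CharZero K] (σ γ : ℕ → ℝ) {A B : Fin 3 → Matrix (Fin n) (Fin n) K}
    (hA : ∀ f, IsUnit (A f).det) (hB : ∀ f, (B f).det = 1)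
    (htri : ∀ f r i, i < r → B f r i = 0) {V : Submodule K (Fin n → K)}
    {I : Fin 3 → Finset (Fin n)} (hV : ∀ f, V = stp (A f * B f) (I f)) :
    flagDegree (posY n) (wY σ γ) (2 * n) (doubleMat A) (dbl V) =
        ∑ f, ∑ i ∈ doubleSet I f, wY σ γ f (posY n f i) ∧
      flagDegree (posX n) (wX σ γ) n A V =
        ∑ f, ∑ i ∈ doubleSet I f, wY σ γ f (posY n f i) := by
  have hC : ∀ f, IsUnit (A f * B f).det := fun f => by
    rw [Matrix.det_mul, hB, mul_one]
    exact hA f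
  constructor
  · exact flagDegree_eq_sum (wY σ γ) posY_lt (isUnit_det_doubleMat hC)
      (stp_doubleMat_lower A hB htri) (dbl_eq_stp hC hV)
  · rw [sum_weights_double]
    refine flagDegree_eq_sum (wX σ γ) (fun _ i => i.2) hC (fun f j => ?_) hV
    rw [stp_mul (by rw [hB]; exact isUnit_one)]
    intro r hr i hi
    rw [mem_lower] at hr hi
    simp only [posX] at hr hi
    exact htri f r i (by rw [Fin.lt_def]; omega)

end Double

section Destabilizing

theorem exists_adapted_family {K κ : Type*} [Field K] {n : ℕ} {A : κ → Matrix (Fin n) (Fin n) K}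
    (hA : ∀ f, IsUnit (A f).det) (V : Submodule K (Fin n → K)) :
    ∃ (B : κ → Matrix (Fin n) (Fin n) K) (I : κ → Finset (Fin n)), (∀ f, (B f).det = 1) ∧
      (∀ f r i, i < r → B f r i = 0) ∧ ∀ f, V = stp (A f * B f) (I f) := by
  have h : ∀ f, ∃ (B : Matrix (Fin n) (Fin n) K) (I : Finset (Fin n)), B.det = 1 ∧
      (∀ r i, i < r → B r i = 0) ∧ V = stp (A f * B) I := by
    intro f
    obtain ⟨B, I, h1, h2, h3⟩ := exists_adapted (V.map (A f)⁻¹.mulVecLin)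
    refine ⟨B, I, h1, h2, ?_⟩
    rw [← stp_map, ← h3, ← Submodule.map_comp, ← Matrix.mulVecLin_mul,
      Matrix.mul_nonsing_inv _ (hA f), Matrix.mulVecLin_one, Submodule.map_id]
  choose B I h1 h2 h3 using h
  exact ⟨B, I, h1, h2, h3⟩

theorem map_stp_inf_le {K ι : Type*} [Field K] [Fintype ι] [DecidableEq ι] {C Φ : Matrix ι ι K}
    (hC : IsUnit C.det) {I : Finset ι} {pos : ι → ℕ}
    (h : ∀ r i, i ∈ I → r ∉ I → pos i < pos r → (C⁻¹ * Φ * C) r i = 0) (j : ℕ) :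
    (stp C I ⊓ stp C (lower pos j)).map Φ.mulVecLin ≤ stp C (lower pos j) ⊔ stp C I := by
  rw [stp_inf hC, ← stp_union]
  rintro _ ⟨_, ⟨x, hx, rfl⟩, rfl⟩
  rw [mem_stp hC]
  intro r hr
  rw [Finset.mem_union, not_or, mem_lower, not_le] at hr
  simp only [Matrix.mulVecLin_apply, Matrix.mulVec_mulVec]
  rw [← Matrix.mul_assoc, Matrix.mulVec, dotProduct]
  refine Finset.sum_eq_zero fun i _ => ?_
  by_cases hi : i ∈ I ∩ lower pos j
  · rw [Finset.mem_inter, mem_lower] at hi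
    rw [h r i hi.1 hr.2 (hi.2.trans_lt hr.1), zero_mul]
  · rw [hx i hi, mul_zero]

variable {n : ℕ}

theorem swapMat_injective (K : Type*) [Field K] :
    Function.Injective (swapMat K n).mulVecLin := by
  intro x y h
  have h2 := congrArg (swapMat K n *ᵥ ·) h
  simpa [Matrix.mulVec_mulVec, swapMat_mul_self] using h2

theorem isGraded_map_swapMat {K : Type*} [Field K] {W : Submodule K (Fin n ⊕ Fin n → K)}
    (hW : IsGraded W) : IsGraded (W.map (swapMat K n).mulVecLin) := by
  rintro _ ⟨v, hv, rfl⟩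
  refine ⟨v - leftProj K n *ᵥ v, W.sub_mem hv (hW v hv), ?_⟩
  simp only [Matrix.mulVecLin_apply, leftProj_mulVec, swapMat_mulVec]
  ext (i | i) <;> simp

theorem map_swapMat_of_least_maximizer {σ γ : ℕ → ℝ} {A : Fin 3 → Matrix (Fin n) (Fin n) ℝ}
    {W : Submodule ℝ (Fin n ⊕ Fin n → ℝ)} (hW : IsGraded W)
    (hleast : ∀ W', IsGraded W' →
      flagDegree (posY n) (wY σ γ) (2 * n) (doubleMat A) W ≤
        flagDegree (posY n) (wY σ γ) (2 * n) (doubleMat A) W' → W ≤ W') :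
    W.map (swapMat ℝ n).mulVecLin = W := by
  have hfin : finrank ℝ ↥(W.map (swapMat ℝ n).mulVecLin) = finrank ℝ W :=
    (LinearEquiv.finrank_eq (Submodule.equivMapOfInjective _ (swapMat_injective ℝ) W)).symm
  symm
  refine Submodule.eq_of_le_of_finrank_le (hleast _ (isGraded_map_swapMat hW) (le_of_eq ?_))
    hfin.le
  unfold flagDegree degree
  rw [hfin]
  congr 1
  refine Finset.sum_congr rfl fun s _ => ?_
  congr 2
  have h : W.map (swapMat ℝ n).mulVecLin ⊓ stp (doubleMat A s.1) (lower (posY n s.1) s.2) =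
      (W ⊓ stp (doubleMat A s.1) (lower (posY n s.1) s.2)).map (swapMat ℝ n).mulVecLin := by
    conv_lhs => rw [← swapMat_map_stp_lower A s.1 s.2]
    rw [← Submodule.map_inf _ (swapMat_injective ℝ)]
  exact (LinearEquiv.finrank_eq (Submodule.equivMapOfInjective _ (swapMat_injective ℝ) _)).trans
    (LinearEquiv.finrank_eq (LinearEquiv.ofEq _ _ h.symm))

/-- Conjugation of block diagonal matrices, restricted to the inversions. -/
noncomputable def invMap (C : Bool → Matrix (Fin n ⊕ Fin n) (Fin n ⊕ Fin n) ℝ)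
    (I : Bool → Finset (Fin n ⊕ Fin n)) :
    Matrix (Fin n) (Fin n) ℝ × Matrix (Fin n) (Fin n) ℝ →ₗ[ℝ]
      ((Σ f : Bool, ↥(invSet (relY n f) (posY n f) (I f))) → ℝ) where
  toFun Φ x := ((C x.1)⁻¹ * fromBlocks Φ.1 0 0 Φ.2 * C x.1) x.2.1.1 x.2.1.2
  map_add' Φ Ψ := by
    ext x
    have : (fromBlocks (Φ + Ψ).1 0 0 (Φ + Ψ).2 : Matrix (Fin n ⊕ Fin n) (Fin n ⊕ Fin n) ℝ) =
        fromBlocks Φ.1 0 0 Φ.2 + fromBlocks Ψ.1 0 0 Ψ.2 := by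
      simp [fromBlocks_add]
    simp only [this, Matrix.mul_add, Matrix.add_mul, Matrix.add_apply, Pi.add_apply]
  map_smul' c Φ := by
    ext x
    have : (fromBlocks (c • Φ).1 0 0 (c • Φ).2 : Matrix (Fin n ⊕ Fin n) (Fin n ⊕ Fin n) ℝ) =
        c • fromBlocks Φ.1 0 0 Φ.2 := by
      simp [fromBlocks_smul]
    simp only [this, Matrix.mul_smul, Matrix.smul_mul, Matrix.smul_apply, Pi.smul_apply,
      RingHom.id_apply]

theorem apply_eq_zero_of_mem_ker_invMap {C : Bool → Matrix (Fin n ⊕ Fin n) (Fin n ⊕ Fin n) ℝ}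
    {I : Bool → Finset (Fin n ⊕ Fin n)} (hC : IsUnit (C false).det) (hblock : IsBlock (C false))
    {Φ : Matrix (Fin n) (Fin n) ℝ × Matrix (Fin n) (Fin n) ℝ}
    (hΦ : invMap C I Φ = 0) (f : Bool) (r i : Fin n ⊕ Fin n) (hi : i ∈ I f) (hr : r ∉ I f)
    (hpos : posY n f i < posY n f r) :
    ((C f)⁻¹ * fromBlocks Φ.1 0 0 Φ.2 * C f) r i = 0 := by
  by_cases hrel : relY n f r i
  · exact congrFun hΦ ⟨f, ⟨(r, i), mem_invSet.mpr ⟨hi, hr, hpos, hrel⟩⟩⟩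
  · rw [relY, not_or] at hrel
    obtain rfl : f = false := by simpa using hrel.1
    exact (((hblock.inv hC).mul (isBlock_fromBlocks _ _)).mul hblock).apply_eq_zero hrel.2

theorem wY_antitone {σ γ : ℕ → ℝ} (hσ : Antitone σ) (hγ : Antitone γ) (f : Bool) :
    Antitone (wY σ γ f) := by
  cases f
  · intro a b h
    have := hγ h
    simp only [wY]
    linarith
  · exact hσ

/-- A destabilizing subspace for three generic flags yields a rigid destabilizing subspace of
the doubled space. -/
theorem exists_rigid_destabilizing {A : Fin 3 → Matrix (Fin n) (Fin n) ℝ}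
    (hA : ∀ f, IsUnit (A f).det)
    (hgen : ∀ N : Fin 3 → Matrix (Fin n) (Fin n) ℝ, ∃ D : ℝ →+ ℝ,
      (∀ a b, D (a * b) = D a * b + a * D b) ∧ ∀ f, (A f).map D = N f * A f)
    {σ γ : ℕ → ℝ} (hσ : Antitone σ) (hγ : Antitone γ) {V₀ : Submodule ℝ (Fin n → ℝ)}
    (h₀ : 0 < flagDegree (posX n) (wX σ γ) n A V₀) :
    ∃ (C : Bool → Matrix (Fin n ⊕ Fin n) (Fin n ⊕ Fin n) ℝ)
      (I : Bool → Finset (Fin n ⊕ Fin n)) (W : Submodule ℝ (Fin n ⊕ Fin n → ℝ)),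
      (∀ f, IsUnit (C f).det) ∧ IsBlock (C false) ∧ IsGraded W ∧ (∀ f, W = stp (C f) (I f)) ∧
      0 < ∑ f, ∑ i ∈ I f, wY σ γ f (posY n f i) ∧ Function.Surjective (invMap C I) := by
  obtain ⟨W, hW, hmax, hleast⟩ := exists_least_maximizer
    (fun s : Bool × Fin (2 * n) => stp (doubleMat A s.1) (lower (posY n s.1) s.2))
    (c := fun s => wY σ γ s.1 s.2 - wY σ γ s.1 (s.2 + 1))
    (fun s => sub_nonneg.mpr (wY_antitone hσ hγ s.1 (Nat.le_succ _)))
    (∑ f, wY σ γ f (2 * n)) IsGraded ⟨⊥, fun v hv => by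
      rw [(Submodule.mem_bot ℝ).mp hv, Matrix.mulVec_zero]; exact Submodule.zero_mem _⟩
    (fun _ _ => isGraded_inf) (fun _ _ => isGraded_sup)
  obtain ⟨V, rfl⟩ := exists_eq_dbl hW (map_swapMat_of_least_maximizer hW hleast)
  obtain ⟨B, I, hB, htri, hV⟩ := exists_adapted_family hA V
  obtain ⟨B₀, I₀, hB₀, htri₀, hV₀⟩ := exists_adapted_family hA V₀
  have hAB : ∀ f, IsUnit (A f * B f).det := fun f => by
    rw [Matrix.det_mul, hB, mul_one]
    exact hA f
  have hC := isUnit_det_doubleMat hAB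
  have hblock : IsBlock (doubleMat (fun f => A f * B f) false) := isBlock_fromBlocks _ _
  refine ⟨doubleMat fun f => A f * B f, doubleSet I, dbl V, hC, hblock, hW, dbl_eq_stp hAB hV,
    ?_, ?_⟩
  · have h1 := flagDegree_dbl σ γ hA hB htri hV
    have h2 := flagDegree_dbl σ γ hA hB₀ htri₀ hV₀
    rw [← h1.1]
    refine h₀.trans_le ?_
    rw [h2.2, ← h2.1]
    exact hmax _ (isGraded_dbl _)
  · have hker : LinearMap.ker (invMap (doubleMat fun f => A f * B f) (doubleSet I)) ≤
        (stabilizer V).prod (stabilizer V) := by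
      intro Φ hΦ
      have hle : (dbl V).map (fromBlocks Φ.1 0 0 Φ.2).mulVecLin ≤ dbl V := by
        refine map_le_of_least_maximizer
          (fun s : Bool × Fin (2 * n) => sub_nonneg.mpr
            (wY_antitone hσ hγ s.1 (Nat.le_succ s.2))) hmax hleast
          (fun s => ?_) (isGraded_inf hW (isGraded_comap hW (isBlock_fromBlocks _ _)))
          (isGraded_sup hW (isGraded_map hW (isBlock_fromBlocks _ _)))
        rw [stp_doubleMat_lower A hB htri, dbl_eq_stp hAB hV s.1]
        exact map_stp_inf_le (hC s.1) (fun r i hi hr hpos =>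
          apply_eq_zero_of_mem_ker_invMap (hC false) hblock hΦ s.1 r i hi hr hpos) _
      have key : ∀ v ∈ V, Φ.1 *ᵥ v ∈ V ∧ Φ.2 *ᵥ v ∈ V := by
        intro v hv
        have h1 : (Sum.elim v v : Fin n ⊕ Fin n → ℝ) ∈ dbl V := mem_dbl.mpr ⟨hv, hv⟩
        have h2 := hle ⟨_, h1, rfl⟩
        rw [mem_dbl, Matrix.mulVecLin_apply, Matrix.fromBlocks_mulVec] at h2
        simpa using h2
      exact ⟨fun v hv => (key v hv).1, fun v hv => (key v hv).2⟩
    have h1 := finrank_stabilizer_add_le hA hgen hB htri hV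
    have h2 := Submodule.finrank_mono hker
    have h3 := LinearMap.finrank_range_add_finrank_ker
      (invMap (doubleMat fun f => A f * B f) (doubleSet I))
    have h4 : finrank ℝ ((stabilizer V).prod (stabilizer V)) ≤
        finrank ℝ (stabilizer V) + finrank ℝ (stabilizer V) := by
      rw [← Module.finrank_prod]
      have : (stabilizer V).prod (stabilizer V) ≤ LinearMap.range
          ((stabilizer V).subtype.prodMap (stabilizer V).subtype) := by
        rintro ⟨a, b⟩ ⟨ha, hb⟩
        exact ⟨(⟨a, ha⟩, ⟨b, hb⟩), rfl⟩
      exact (Submodule.finrank_mono this).trans (LinearMap.finrank_range_le _)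
    have hcard : ∀ f, (I f).card = finrank ℝ V := fun f => by
      rw [hV f, finrank_stp (hAB f)]
    rw [← LinearMap.range_eq_top]
    refine Submodule.eq_top_of_finrank_eq (le_antisymm (Submodule.finrank_le _) ?_)
    rw [Module.finrank_fintype_fun_eq_card, Fintype.card_sigma]
    simp only [Fintype.card_coe]
    rw [Fintype.sum_bool, card_invSet_double_false,
      card_invSet_double_true I ((hcard 0).trans (hcard 1).symm)]
    rw [Module.finrank_prod, Module.finrank_matrix] at h3
    rw [Fin.sum_univ_three] at h1
    simp only [Fintype.card_fin, Module.finrank_self, mul_one] at h3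
    omega

end Destabilizing

section BaseChange

variable {K K' ι : Type*} [Field K] [Field K'] [Fintype ι] [DecidableEq ι]

theorem stp_le_stp_iff {G H : Matrix ι ι K} {T T' : Finset ι} (hH : IsUnit H.det) :
    stp G T ≤ stp H T' ↔ ∀ r, r ∉ T' → ∀ i ∈ T, (H⁻¹ * G) r i = 0 := by
  constructor
  · intro h r hr i hi
    exact (mem_stp hH).mp (h (col_mem_stp G hi)) r hr
  · rintro h _ ⟨x, hx, rfl⟩
    rw [mem_stp hH]
    intro r hr
    rw [Matrix.mulVecLin_apply, Matrix.mulVec_mulVec, Matrix.mulVec, dotProduct]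
    refine Finset.sum_eq_zero fun i _ => ?_
    by_cases hi : i ∈ T
    · rw [h r hr i hi, zero_mul]
    · rw [hx i hi, mul_zero]

theorem isUnit_det_map {H : Matrix ι ι K} (hH : IsUnit H.det) (φ : K →+* K') :
    IsUnit (H.map φ).det := by
  rw [← RingHom.mapMatrix_apply, ← RingHom.map_det]
  exact hH.map φ

theorem map_inv_of_isUnit_det {H : Matrix ι ι K} (hH : IsUnit H.det) (φ : K →+* K') :
    (H.map φ)⁻¹ = H⁻¹.map φ := by
  refine Matrix.inv_eq_left_inv ?_
  rw [← Matrix.map_mul, Matrix.nonsing_inv_mul _ hH, Matrix.map_one _ φ.map_zero φ.map_one]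

theorem stp_map_le {G H : Matrix ι ι K} {T T' : Finset ι} (hH : IsUnit H.det) (φ : K →+* K')
    (h : stp G T ≤ stp H T') : stp (G.map φ) T ≤ stp (H.map φ) T' := by
  rw [stp_le_stp_iff hH] at h
  rw [stp_le_stp_iff (isUnit_det_map hH φ)]
  intro r hr i hi
  rw [map_inv_of_isUnit_det hH, ← Matrix.map_mul, Matrix.map_apply, h r hr i hi, φ.map_zero]

theorem isGraded_stp_map {n : ℕ} {H : Matrix (Fin n ⊕ Fin n) (Fin n ⊕ Fin n) K}
    {T : Finset (Fin n ⊕ Fin n)} (hH : IsUnit H.det) (φ : K →+* K') (h : IsGraded (stp H T)) :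
    IsGraded (stp (H.map φ) T) := by
  have h1 : stp (leftProj K n * H) T ≤ stp H T := by
    rw [← stp_map]
    rintro _ ⟨v, hv, rfl⟩
    exact h v hv
  have h2 := stp_map_le hH φ h1
  have h3 : (leftProj K n * H).map φ = leftProj K' n * H.map φ := by
    rw [Matrix.map_mul]
    congr 1
    simp [leftProj, fromBlocks_map]
  rw [h3, ← stp_map] at h2
  exact fun v hv => h2 ⟨v, hv, rfl⟩

end BaseChange

section Mask

variable {R ι : Type*} [CommSemiring R]

/-- The matrix with the entries outside of a relation replaced by zero. -/
def mask (P : ι → ι → Prop) [DecidableRel P] : Matrix ι ι R →ₗ[R] Matrix ι ι R where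
  toFun M := Matrix.of fun r i => if P r i then M r i else 0
  map_add' M N := by
    ext r i
    by_cases h : P r i <;> simp [h]
  map_smul' c M := by
    ext r i
    by_cases h : P r i <;> simp [h]

theorem mask_apply (P : ι → ι → Prop) [DecidableRel P] (M : Matrix ι ι R) (r i : ι) :
    mask P M r i = if P r i then M r i else 0 := rfl

end Mask

section Deformation

variable {n : ℕ}

/-- The pairs of indices for which the corresponding elementary matrix strictly increases the
level but preserves the coordinate subspace of `I`. -/
def keepRel (I : Bool → Finset (Fin n ⊕ Fin n)) (f : Bool) (r i : Fin n ⊕ Fin n) : Prop :=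
  relY n f r i ∧ ¬ (i ∈ I f ∧ r ∉ I f) ∧ posY n f i < posY n f r

instance (I : Bool → Finset (Fin n ⊕ Fin n)) (f : Bool) : DecidableRel (keepRel I f) :=
  fun r i => inferInstanceAs
    (Decidable (relY n f r i ∧ ¬ (i ∈ I f ∧ r ∉ I f) ∧ posY n f i < posY n f r))

/-- The pairs of indices of the triangular matrices. -/
def triRel (n : ℕ) (f : Bool) (r i : Fin n ⊕ Fin n) : Prop :=
  relY n f r i ∧ posY n f r ≤ posY n f i

instance (n : ℕ) (f : Bool) : DecidableRel (triRel n f) :=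
  fun r i => inferInstanceAs (Decidable (relY n f r i ∧ posY n f r ≤ posY n f i))

/-- The pairs of indices in the off-diagonal blocks. -/
def offRel (n : ℕ) (f : Bool) (r i : Fin n ⊕ Fin n) : Prop := ¬ relY n f r i

instance (n : ℕ) (f : Bool) : DecidableRel (offRel n f) :=
  fun r i => inferInstanceAs (Decidable (¬ relY n f r i))

/-- The derivative of the deformation map. -/
def deformLin {K : Type*} [Field K] (C : Bool → Matrix (Fin n ⊕ Fin n) (Fin n ⊕ Fin n) K)
    (I : Bool → Finset (Fin n ⊕ Fin n)) :
    (Matrix (Fin n ⊕ Fin n) (Fin n ⊕ Fin n) K ×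
      (Bool → Matrix (Fin n ⊕ Fin n) (Fin n ⊕ Fin n) K)) →ₗ[K]
      (Bool → Matrix (Fin n ⊕ Fin n) (Fin n ⊕ Fin n) K) where
  toFun p f := mask (relY n false) p.1 * C f +
    C f * (mask (keepRel I f) (p.2 f) + mask (triRel n f) (p.2 f)) + mask (offRel n f) (p.2 f)
  map_add' p q := by
    ext1 f
    simp only [Prod.fst_add, Prod.snd_add, Pi.add_apply, map_add, Matrix.add_mul, Matrix.mul_add]
    abel
  map_smul' c p := by
    ext1 f
    simp only [Prod.smul_fst, Prod.smul_snd, Pi.smul_apply, map_smul, RingHom.id_apply,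
      Matrix.smul_mul, Matrix.mul_smul, Matrix.mul_add, smul_add]

theorem deformLin_surjective_real {C : Bool → Matrix (Fin n ⊕ Fin n) (Fin n ⊕ Fin n) ℝ}
    {I : Bool → Finset (Fin n ⊕ Fin n)} (hC : ∀ f, IsUnit (C f).det) (hblock : IsBlock (C false))
    (hsurj : Function.Surjective (invMap C I)) : Function.Surjective (deformLin C I) := by
  intro Y
  obtain ⟨Φ, hΦ⟩ := hsurj fun x => ((C x.1)⁻¹ * mask (relY n x.1) (Y x.1)) x.2.1.1 x.2.1.2
  have hrel : ∀ r i, relY n false r i ↔ r.isLeft = i.isLeft := fun r i => by simp [relY]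
  have hu : mask (relY n false) (fromBlocks Φ.1 0 0 Φ.2) = fromBlocks Φ.1 0 0 Φ.2 := by
    ext r i
    rw [mask_apply]
    rcases r with r | r <;> rcases i with i | i <;> simp [hrel]
  let M : Bool → Matrix (Fin n ⊕ Fin n) (Fin n ⊕ Fin n) ℝ := fun f =>
    (C f)⁻¹ * mask (relY n f) (Y f) - (C f)⁻¹ * fromBlocks Φ.1 0 0 Φ.2 * C f
  have hM1 : ∀ f r i, ¬ relY n f r i → M f r i = 0 := by
    intro f r i hri
    have hri' := hri
    rw [relY, not_or] at hri'
    obtain rfl : f = false := by simpa using hri'.1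
    have h1 : IsBlock (mask (relY n false) (Y false)) :=
      isBlock_of_apply_eq_zero fun x y hxy => by
        rw [mask_apply, if_neg]
        rwa [hrel]
    have h2 := ((hblock.inv (hC false)).mul h1).apply_eq_zero hri'.2
    have h3 := (((hblock.inv (hC false)).mul (isBlock_fromBlocks Φ.1 Φ.2)).mul
      hblock).apply_eq_zero hri'.2
    simp only [M, Matrix.sub_apply, h2, h3, sub_zero]
  have hM2 : ∀ f r i, i ∈ I f → r ∉ I f → posY n f i < posY n f r → M f r i = 0 := by
    intro f r i hi hr hpos
    by_cases hri : relY n f r i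
    · have h1 := congrFun hΦ ⟨f, ⟨(r, i), mem_invSet.mpr ⟨hi, hr, hpos, hri⟩⟩⟩
      simp only [M, Matrix.sub_apply, sub_eq_zero]
      exact h1.symm
    · exact hM1 f r i hri
  have hM3 : ∀ f, mask (keepRel I f) (M f + mask (offRel n f) (Y f)) +
      mask (triRel n f) (M f + mask (offRel n f) (Y f)) = M f := by
    intro f
    ext r i
    simp only [Matrix.add_apply, mask_apply, keepRel, triRel, offRel]
    by_cases h1 : relY n f r i
    · by_cases h2 : posY n f i < posY n f r
      · by_cases h3 : i ∈ I f ∧ r ∉ I f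
        · simp [h1, h2, h3, hM2 f r i h3.1 h3.2 h2]
        · simp [h1, h2, h3]
      · simp [h1, h2, not_lt.mp h2]
    · simp [h1, hM1 f r i h1]
  have hM4 : ∀ f, mask (offRel n f) (M f + mask (offRel n f) (Y f)) = mask (offRel n f) (Y f) := by
    intro f
    ext r i
    simp only [Matrix.add_apply, mask_apply, offRel]
    by_cases h1 : relY n f r i
    · simp [h1]
    · simp [h1, hM1 f r i h1]
  have hY : ∀ f, mask (relY n f) (Y f) + mask (offRel n f) (Y f) = Y f := by
    intro f
    ext r i
    simp only [Matrix.add_apply, mask_apply, offRel]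
    by_cases h1 : relY n f r i <;> simp [h1]
  refine ⟨(fromBlocks Φ.1 0 0 Φ.2, fun f => M f + mask (offRel n f) (Y f)), ?_⟩
  ext1 f
  change mask (relY n false) (fromBlocks Φ.1 0 0 Φ.2) * C f + C f * (_ + _) + _ = Y f
  rw [hu, hM3, hM4]
  conv_rhs => rw [← hY f]
  congr 1
  simp only [M, Matrix.mul_sub]
  rw [← Matrix.mul_assoc, Matrix.mul_assoc (C f)⁻¹, ← Matrix.mul_assoc (C f),
    Matrix.mul_nonsing_inv _ (hC f), Matrix.one_mul, Matrix.one_mul]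
  abel

theorem mask_map {K K' : Type*} [Field K] [Field K'] (φ : K →+* K')
    (P : Fin n ⊕ Fin n → Fin n ⊕ Fin n → Prop) [DecidableRel P]
    (M : Matrix (Fin n ⊕ Fin n) (Fin n ⊕ Fin n) K) :
    mask P (M.map φ) = (mask P M).map φ := by
  ext r i
  by_cases h : P r i <;> simp [mask_apply, h]

theorem deformLin_map {K K' : Type*} [Field K] [Field K'] (φ : K →+* K')
    (C : Bool → Matrix (Fin n ⊕ Fin n) (Fin n ⊕ Fin n) K)
    (I : Bool → Finset (Fin n ⊕ Fin n)) (u : Matrix (Fin n ⊕ Fin n) (Fin n ⊕ Fin n) K)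
    (N : Bool → Matrix (Fin n ⊕ Fin n) (Fin n ⊕ Fin n) K) :
    deformLin (fun f => (C f).map φ) I (u.map φ, fun f => (N f).map φ) =
      fun f => (deformLin C I (u, N) f).map φ := by
  ext1 f
  simp only [deformLin, LinearMap.coe_mk, AddHom.coe_mk, mask_map]
  rw [Matrix.map_add _ φ.map_add, Matrix.map_add _ φ.map_add, Matrix.map_mul, Matrix.map_mul,
    Matrix.map_add _ φ.map_add]

theorem deformLin_surjective {C : Bool → Matrix (Fin n ⊕ Fin n) (Fin n ⊕ Fin n) ℝ}
    {I : Bool → Finset (Fin n ⊕ Fin n)} (hC : ∀ f, IsUnit (C f).det) (hblock : IsBlock (C false))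
    (hsurj : Function.Surjective (invMap C I)) :
    Function.Surjective (deformLin (fun f => (C f).map Complex.ofRealHom) I) := by
  intro Y
  have h := deformLin_surjective_real hC hblock hsurj
  obtain ⟨⟨u₁, N₁⟩, h₁⟩ := h fun f => (Y f).map Complex.re
  obtain ⟨⟨u₂, N₂⟩, h₂⟩ := h fun f => (Y f).map Complex.im
  refine ⟨(u₁.map Complex.ofRealHom, fun f => (N₁ f).map Complex.ofRealHom) +
    Complex.I • (u₂.map Complex.ofRealHom, fun f => (N₂ f).map Complex.ofRealHom), ?_⟩
  rw [map_add, map_smul, deformLin_map, deformLin_map, h₁, h₂]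
  ext f r i
  simp only [Pi.add_apply, Pi.smul_apply, Matrix.add_apply, Matrix.smul_apply, Matrix.map_apply,
    Complex.ofRealHom_eq_coe, smul_eq_mul]
  rw [mul_comm]
  exact Complex.re_add_im _

end Deformation

section Deformation

open scoped Matrix.Norms.Operator
open Filter Topology

variable {n : ℕ}

/-- The map which deforms a pair of flags by a block diagonal automorphism and by automorphisms
preserving a coordinate subspace. -/
noncomputable def deform (C : Bool → Matrix (Fin n ⊕ Fin n) (Fin n ⊕ Fin n) ℂ)
    (I : Bool → Finset (Fin n ⊕ Fin n))
    (p : Matrix (Fin n ⊕ Fin n) (Fin n ⊕ Fin n) ℂ ×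
      (Bool → Matrix (Fin n ⊕ Fin n) (Fin n ⊕ Fin n) ℂ)) (f : Bool) :
    Matrix (Fin n ⊕ Fin n) (Fin n ⊕ Fin n) ℂ :=
  (1 + mask (relY n false) p.1) * C f * (1 + mask (keepRel I f) (p.2 f)) *
    (1 + mask (triRel n f) (p.2 f)) + mask (offRel n f) (p.2 f)

theorem hasStrictFDerivAt_deform_aux {E 𝔸 : Type*} [NormedAddCommGroup E] [NormedSpace ℂ E]
    [NormedRing 𝔸] [NormedAlgebra ℂ 𝔸] (ℓ₁ ℓ₂ ℓ₃ ℓ₄ : E →L[ℂ] 𝔸) (c : 𝔸) (ℓ : E →L[ℂ] 𝔸)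
    (h : ∀ p, ℓ p = ℓ₁ p * c + c * (ℓ₂ p + ℓ₃ p) + ℓ₄ p) :
    HasStrictFDerivAt (fun p => (1 + ℓ₁ p) * c * (1 + ℓ₂ p) * (1 + ℓ₃ p) + ℓ₄ p) ℓ 0 := by
  have h1 := (((((ℓ₁.hasStrictFDerivAt (x := 0)).const_add 1).mul'
    (hasStrictFDerivAt_const c 0)).mul' ((ℓ₂.hasStrictFDerivAt (x := 0)).const_add 1)).mul'
    ((ℓ₃.hasStrictFDerivAt (x := 0)).const_add 1)).add (ℓ₄.hasStrictFDerivAt (x := 0))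
  refine h1.congr_fderiv (ContinuousLinearMap.ext fun p => ?_)
  simp [h, mul_add]
  abel

theorem hasStrictFDerivAt_deform (C : Bool → Matrix (Fin n ⊕ Fin n) (Fin n ⊕ Fin n) ℂ)
    (I : Bool → Finset (Fin n ⊕ Fin n)) :
    HasStrictFDerivAt (deform C I) (LinearMap.toContinuousLinearMap (deformLin C I)) 0 := by
  refine hasStrictFDerivAt_pi'.mpr fun f => ?_
  let E := Matrix (Fin n ⊕ Fin n) (Fin n ⊕ Fin n) ℂ ×
      (Bool → Matrix (Fin n ⊕ Fin n) (Fin n ⊕ Fin n) ℂ)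
  let e₂ : E →ₗ[ℂ] Matrix (Fin n ⊕ Fin n) (Fin n ⊕ Fin n) ℂ :=
    LinearMap.proj f ∘ₗ LinearMap.snd ℂ _ _
  exact hasStrictFDerivAt_deform_aux
    (LinearMap.toContinuousLinearMap (mask (relY n false) ∘ₗ LinearMap.fst ℂ _ _ : E →ₗ[ℂ] _))
    (LinearMap.toContinuousLinearMap (mask (keepRel I f) ∘ₗ e₂))
    (LinearMap.toContinuousLinearMap (mask (triRel n f) ∘ₗ e₂))
    (LinearMap.toContinuousLinearMap (mask (offRel n f) ∘ₗ e₂)) (C f) _ fun p => rfl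

theorem exists_deformation {C : Bool → Matrix (Fin n ⊕ Fin n) (Fin n ⊕ Fin n) ℂ}
    {I : Bool → Finset (Fin n ⊕ Fin n)} (hsurj : Function.Surjective (deformLin C I))
    (T : Bool → Matrix (Fin n ⊕ Fin n) (Fin n ⊕ Fin n) ℂ) :
    ∃ δ : ℝ, 0 < δ ∧ ∀ s : ℂ, ‖s‖ < δ → ∃ p, deform C I p = C + s • (T - C) ∧
      IsUnit (1 + mask (relY n false) p.1).det ∧
      ∀ f, IsUnit (1 + mask (keepRel I f) (p.2 f)).det ∧
        IsUnit (1 + mask (triRel n f) (p.2 f)).det := by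
  have hd := hasStrictFDerivAt_deform C I
  have hmap := hd.map_nhds_eq_of_surj (LinearMap.range_eq_top.mpr hsurj)
  have h0 : deform C I 0 = C := by
    ext1 f
    simp [deform]
  have hcont : ∀ (P : Fin n ⊕ Fin n → Fin n ⊕ Fin n → Prop) [DecidableRel P],
      ∀ᶠ M : Matrix (Fin n ⊕ Fin n) (Fin n ⊕ Fin n) ℂ in 𝓝 0, IsUnit (1 + mask P M).det := by
    intro P _
    have : Continuous fun M : Matrix (Fin n ⊕ Fin n) (Fin n ⊕ Fin n) ℂ => (1 + mask P M).det :=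
      (continuous_const.add (LinearMap.continuous_of_finiteDimensional _)).matrix_det
    have h1 := this.tendsto 0
    simp only [map_zero, add_zero, Matrix.det_one] at h1
    filter_upwards [h1.eventually_ne one_ne_zero] with M hM
    exact isUnit_iff_ne_zero.mpr hM
  have hU : ∀ᶠ p : Matrix (Fin n ⊕ Fin n) (Fin n ⊕ Fin n) ℂ ×
      (Bool → Matrix (Fin n ⊕ Fin n) (Fin n ⊕ Fin n) ℂ) in 𝓝 0,
      IsUnit (1 + mask (relY n false) p.1).det ∧
      ∀ f, IsUnit (1 + mask (keepRel I f) (p.2 f)).det ∧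
        IsUnit (1 + mask (triRel n f) (p.2 f)).det := by
    have t1 : Tendsto (fun p : Matrix (Fin n ⊕ Fin n) (Fin n ⊕ Fin n) ℂ ×
      (Bool → Matrix (Fin n ⊕ Fin n) (Fin n ⊕ Fin n) ℂ) => p.1) (𝓝 0) (𝓝 0) :=
      continuous_fst.tendsto 0
    have t2 : ∀ f, Tendsto (fun p : Matrix (Fin n ⊕ Fin n) (Fin n ⊕ Fin n) ℂ ×
      (Bool → Matrix (Fin n ⊕ Fin n) (Fin n ⊕ Fin n) ℂ) => p.2 f) (𝓝 0) (𝓝 0) := fun f =>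
      ((continuous_apply f).comp continuous_snd).tendsto 0
    refine (t1.eventually (hcont _)).and (eventually_all.mpr fun f => ?_)
    exact ((t2 f).eventually (hcont _)).and ((t2 f).eventually (hcont _))
  have himg : ∀ᶠ y in 𝓝 C, ∃ p, deform C I p = y ∧
      IsUnit (1 + mask (relY n false) p.1).det ∧
      ∀ f, IsUnit (1 + mask (keepRel I f) (p.2 f)).det ∧
        IsUnit (1 + mask (triRel n f) (p.2 f)).det := by
    rw [h0] at hmap
    have h1 : ∀ᶠ y in map (deform C I) (𝓝 0), ∃ p, deform C I p = y ∧
        IsUnit (1 + mask (relY n false) p.1).det ∧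
        ∀ f, IsUnit (1 + mask (keepRel I f) (p.2 f)).det ∧
          IsUnit (1 + mask (triRel n f) (p.2 f)).det := by
      rw [eventually_map]
      filter_upwards [hU] with p hp
      exact ⟨p, rfl, hp⟩
    have h2 : map (deform C I) (𝓝 0) = 𝓝 C := hmap
    rwa [h2] at h1
  have hline : Tendsto (fun s : ℂ => C + s • (T - C)) (𝓝 0) (𝓝 C) := by
    have : Continuous fun s : ℂ => C + s • (T - C) := by fun_prop
    simpa using this.tendsto 0
  obtain ⟨δ, hδ, h⟩ := Metric.eventually_nhds_iff.mp (hline.eventually himg)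
  exact ⟨δ, hδ, fun s hs => h (by simpa using hs)⟩

end Deformation

section Germs

open Filter

/-- The field of germs of complex sequences along a nonprincipal ultrafilter. -/
abbrev SeqGerm : Type := Germ (hyperfilter ℕ : Filter ℕ) ℂ

/-- The germ of a sequence, as a ring homomorphism. -/
noncomputable def germHom : (ℕ → ℂ) →+* SeqGerm := Germ.coeRingHom _

noncomputable instance : Algebra ℂ SeqGerm := (germHom.comp (Pi.constRingHom ℕ ℂ)).toAlgebra

theorem algebraMap_seqGerm (z : ℂ) : algebraMap ℂ SeqGerm z = germHom fun _ => z := rfl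

theorem germHom_eq_zero {s : ℕ → ℂ} : germHom s = 0 ↔ ∀ᶠ k in hyperfilter ℕ, s k = 0 := by
  rw [← map_zero germHom]
  exact Germ.coe_eq

theorem transcendental_germHom {s : ℕ → ℂ} (hs : Function.Injective s) :
    Transcendental ℂ (germHom s) := by
  rw [transcendental_iff]
  intro P hP
  have h1 : Polynomial.aeval (germHom s) P = germHom fun k => P.eval (s k) := by
    rw [Polynomial.aeval_def, Polynomial.eval₂_eq_sum_range]
    have h2 : (fun k => P.eval (s k)) =
        ∑ i ∈ Finset.range (P.natDegree + 1), (fun _ => P.coeff i) * s ^ i := by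
      ext k
      simp [Polynomial.eval_eq_sum_range]
    rw [h2, map_sum]
    exact Finset.sum_congr rfl fun i _ => by rw [map_mul, map_pow]; rfl
  rw [h1, germHom_eq_zero] at hP
  by_contra hne
  have hfin : {k | P.eval (s k) = 0}.Finite := by
    refine Set.Finite.preimage hs.injOn (s := {z | P.eval z = 0}) ?_
    exact (P.roots.toFinset.finite_toSet).subset fun z hz => by
      simpa [hne, Polynomial.IsRoot] using hz
  exact notMem_hyperfilter_of_finite hfin hP

variable {ι : Type*} [Fintype ι] [DecidableEq ι]

/-- The matrix of germs of a sequence of matrices. -/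
noncomputable def germMat (M : ℕ → Matrix ι ι ℂ) : Matrix ι ι SeqGerm :=
  Matrix.of fun r i => germHom fun k => M k r i

theorem germMat_mul (M N : ℕ → Matrix ι ι ℂ) :
    germMat (fun k => M k * N k) = germMat M * germMat N := by
  ext r i
  simp only [germMat, Matrix.of_apply, Matrix.mul_apply, ← map_mul, ← map_sum]
  congr 1
  ext k
  simp

theorem germMat_add (M N : ℕ → Matrix ι ι ℂ) :
    germMat (fun k => M k + N k) = germMat M + germMat N := by
  ext r i
  simp only [germMat, Matrix.of_apply, Matrix.add_apply, ← map_add]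
  rfl

theorem germMat_smul (s : ℕ → ℂ) (M : Matrix ι ι ℂ) :
    germMat (fun k => s k • M) = germHom s • M.map (algebraMap ℂ SeqGerm) := by
  ext r i
  simp only [germMat, Matrix.of_apply, Matrix.smul_apply, Matrix.map_apply, algebraMap_seqGerm,
    smul_eq_mul, ← map_mul]
  rfl

theorem germMat_const (M : Matrix ι ι ℂ) :
    germMat (fun _ => M) = M.map (algebraMap ℂ SeqGerm) := rfl

theorem germMat_apply_eq_zero {M : ℕ → Matrix ι ι ℂ} {r i : ι} (h : ∀ k, M k r i = 0) :
    germMat M r i = 0 := by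
  have : (fun k => M k r i) = 0 := funext h
  simp [germMat, this]

theorem isUnit_det_germMat {M : ℕ → Matrix ι ι ℂ} (h : ∀ k, IsUnit (M k).det) :
    IsUnit (germMat M).det := by
  refine Matrix.isUnit_det_of_right_inverse (B := germMat fun k => (M k)⁻¹) ?_
  rw [← germMat_mul, funext fun k => Matrix.mul_nonsing_inv _ (h k), germMat_const,
    Matrix.map_one _ (map_zero _) (map_one _)]

end Germs

theorem mask_offRel_eq_zero {n : ℕ} {C : Bool → Matrix (Fin n ⊕ Fin n) (Fin n ⊕ Fin n) ℂ}
    {I : Bool → Finset (Fin n ⊕ Fin n)} (hblock : IsBlock (C false))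
    {p : Matrix (Fin n ⊕ Fin n) (Fin n ⊕ Fin n) ℂ ×
      (Bool → Matrix (Fin n ⊕ Fin n) (Fin n ⊕ Fin n) ℂ)}
    (hp : IsBlock (deform C I p false)) (f : Bool) : mask (offRel n f) (p.2 f) = 0 := by
  ext r i
  rw [mask_apply, Matrix.zero_apply]
  split_ifs with h
  · rw [offRel, relY, not_or] at h
    obtain rfl : f = false := by simpa using h.1
    have hb : ∀ (P : Fin n ⊕ Fin n → Fin n ⊕ Fin n → Prop) [DecidableRel P]
        (_ : ∀ x y, P x y → relY n false x y) (M : Matrix (Fin n ⊕ Fin n) (Fin n ⊕ Fin n) ℂ),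
        IsBlock (1 + mask P M) := by
      intro P _ hP M
      refine isBlock_of_apply_eq_zero fun x y hxy => ?_
      have hne : x ≠ y := fun hxy' => hxy (by rw [hxy'])
      rw [Matrix.add_apply, Matrix.one_apply_ne hne, mask_apply, if_neg, add_zero]
      intro h'
      exact hxy (by simpa [relY] using hP x y h')
    have h1 := ((((hb (relY n false) (fun _ _ h => h) p.1).mul hblock).mul
      (hb (keepRel I false) (fun _ _ h => h.1) (p.2 false))).mul
      (hb (triRel n false) (fun _ _ h => h.1) (p.2 false))).apply_eq_zero h.2
    have h2 := hp.apply_eq_zero h.2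
    rw [deform, Matrix.add_apply, h1, zero_add, mask_apply, if_pos] at h2
    · exact h2
    · rw [offRel, relY, not_or]
      exact h
  · rfl

theorem exists_generic_deformation {n : ℕ} {C : Bool → Matrix (Fin n ⊕ Fin n) (Fin n ⊕ Fin n) ℝ}
    {I : Bool → Finset (Fin n ⊕ Fin n)} {W : Submodule ℝ (Fin n ⊕ Fin n → ℝ)}
    (hC : ∀ f, IsUnit (C f).det) (hblock : IsBlock (C false)) (hW : IsGraded W)
    (hWC : ∀ f, W = stp (C f) (I f)) (hsurj : Function.Surjective (invMap C I))
    (T : Bool → Matrix (Fin n ⊕ Fin n) (Fin n ⊕ Fin n) ℂ) (hT : IsBlock (T false)) :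
    ∃ (τ : SeqGerm) (D : Bool → Matrix (Fin n ⊕ Fin n) (Fin n ⊕ Fin n) ℂ)
      (G : Bool → Matrix (Fin n ⊕ Fin n) (Fin n ⊕ Fin n) SeqGerm)
      (W' : Submodule SeqGerm (Fin n ⊕ Fin n → SeqGerm)), Transcendental ℂ τ ∧ IsGraded W' ∧
      ∀ f, IsUnit (G f).det ∧ W' = stp (G f) (I f) ∧
        ∀ j, stp (G f) (lower (posY n f) j) = stp ((D f).map (algebraMap ℂ SeqGerm) +
          τ • (T f - D f).map (algebraMap ℂ SeqGerm)) (lower (posY n f) j) := by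
  let D : Bool → Matrix (Fin n ⊕ Fin n) (Fin n ⊕ Fin n) ℂ :=
    fun f => (C f).map Complex.ofRealHom
  have hD : ∀ f, IsUnit (D f).det := fun f => isUnit_det_map (hC f) _
  have hDblock : IsBlock (D false) := isBlock_of_apply_eq_zero fun x y hxy => by
    simp [D, hblock.apply_eq_zero hxy]
  obtain ⟨δ, hδ, hdef⟩ := exists_deformation (deformLin_surjective hC hblock hsurj) T
  let s : ℕ → ℂ := fun k => ((δ / (k + 2) : ℝ) : ℂ)
  have hs : ∀ k, ‖s k‖ < δ := by
    intro k
    rw [Complex.norm_real, Real.norm_of_nonneg (by positivity)]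
    exact div_lt_self hδ (by have : (0 : ℝ) ≤ k := k.cast_nonneg; linarith)
  have hsinj : Function.Injective s := by
    intro k l hkl
    have h1 : δ / ((k : ℝ) + 2) = δ / ((l : ℝ) + 2) := Complex.ofReal_injective hkl
    have h2 : (k : ℝ) = l := by
      rw [div_eq_div_iff (by positivity) (by positivity)] at h1
      have := mul_left_cancel₀ hδ.ne' h1
      linarith
    exact_mod_cast h2
  choose p hp hu hq using fun k => hdef (s k) (hs k)
  have hoff : ∀ k f, mask (offRel n f) ((p k).2 f) = 0 := fun k f =>
    mask_offRel_eq_zero (C := D) (I := I) hDblock (by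
      rw [hp k]
      refine isBlock_of_apply_eq_zero fun x y hxy => ?_
      have h1 := hblock.apply_eq_zero hxy
      have h2 := hT.apply_eq_zero hxy
      simp [h1, h2]) f
  let u : ℕ → Matrix (Fin n ⊕ Fin n) (Fin n ⊕ Fin n) ℂ :=
    fun k => 1 + mask (relY n false) (p k).1
  let q : Bool → ℕ → Matrix (Fin n ⊕ Fin n) (Fin n ⊕ Fin n) ℂ :=
    fun f k => 1 + mask (keepRel I f) ((p k).2 f)
  let b : Bool → ℕ → Matrix (Fin n ⊕ Fin n) (Fin n ⊕ Fin n) ℂ :=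
    fun f k => 1 + mask (triRel n f) ((p k).2 f)
  have hprod : ∀ k f, u k * D f * q f k * b f k = D f + s k • (T f - D f) := by
    intro k f
    have h := congrFun (hp k) f
    rw [deform, hoff, add_zero] at h
    exact h
  have hqI : ∀ f r, r ∉ I f → ∀ i ∈ I f, germMat (q f) r i = 0 := by
    intro f r hr i hi
    refine germMat_apply_eq_zero fun k => ?_
    have hne : r ≠ i := fun h => hr (h ▸ hi)
    simp only [q, Matrix.add_apply, Matrix.one_apply_ne hne, zero_add, mask_apply]
    exact if_neg fun h => h.2.1 ⟨hi, hr⟩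
  have hbI : ∀ f j r, r ∉ lower (posY n f) j → ∀ i ∈ lower (posY n f) j,
      germMat (b f) r i = 0 := by
    intro f j r hr i hi
    refine germMat_apply_eq_zero fun k => ?_
    have hne : r ≠ i := fun h => hr (h ▸ hi)
    simp only [b, Matrix.add_apply, Matrix.one_apply_ne hne, zero_add, mask_apply]
    rw [mem_lower] at hr hi
    exact if_neg fun h => hr (h.2.trans hi)
  have hublock : IsBlock (germMat u) := isBlock_of_apply_eq_zero fun x y hxy => by
    refine germMat_apply_eq_zero fun k => ?_
    have hne : x ≠ y := fun h => hxy (by rw [h])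
    simp only [u, Matrix.add_apply, Matrix.one_apply_ne hne, zero_add, mask_apply]
    exact if_neg fun h => hxy (by simpa [relY] using h)
  let E : Bool → Matrix (Fin n ⊕ Fin n) (Fin n ⊕ Fin n) SeqGerm :=
    fun f => (D f).map (algebraMap ℂ SeqGerm)
  have hE : ∀ f, IsUnit (E f).det := fun f => isUnit_det_map (hD f) _
  have hEE : ∀ f g, stp (E f) (I f) ≤ stp (E g) (I g) := fun f g =>
    stp_map_le (hD g) _ (stp_map_le (hC g) _ (by rw [← hWC, ← hWC]))
  have hgr : IsGraded (stp (E false) (I false)) :=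
    isGraded_stp_map (hD false) _ (isGraded_stp_map (hC false) _ (hWC false ▸ hW))
  refine ⟨germHom s, D, fun f => germMat u * E f * germMat (q f),
    (stp (E false) (I false)).map (germMat u).mulVecLin, transcendental_germHom hsinj,
    isGraded_map hgr hublock, fun f => ⟨?_, ?_, fun j => ?_⟩⟩
  · rw [Matrix.det_mul, Matrix.det_mul]
    exact ((isUnit_det_germMat hu).mul (hE f)).mul (isUnit_det_germMat fun k => (hq k f).1)
  · rw [stp_mul (isUnit_det_germMat fun k => (hq k f).1) (hqI f), ← stp_map,
      le_antisymm (hEE false f) (hEE f false)]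
  · rw [← stp_mul (isUnit_det_germMat fun k => (hq k f).2) (hbI f j)]
    congr 1
    have h1 := congrArg germMat (funext fun k => hprod k f)
    have h2 := germMat_add (fun _ => D f) fun k => s k • (T f - D f)
    rw [germMat_smul] at h2
    rw [h2, germMat_mul (fun k => u k * D f * q f k) (b f),
      germMat_mul (fun k => u k * D f) (q f), germMat_mul u fun _ => D f] at h1
    exact h1

section Specialization

theorem exists_valuationSubring_of_transcendental {L : Type*} [Field L] [Algebra ℂ L] {τ : L}
    (hτ : Transcendental ℂ τ) : ∃ O : ValuationSubring L, (∀ z : ℂ, algebraMap ℂ L z ∈ O) ∧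
      ∃ h : τ - 1 ∈ O, (⟨τ - 1, h⟩ : O) ∈ IsLocalRing.maximalIdeal O := by
  let P : Ideal (Polynomial ℂ) := RingHom.ker (Polynomial.evalRingHom (1 : ℂ))
  have hP : P.IsPrime := RingHom.ker_isPrime _
  have hunit : ∀ y : P.primeCompl, IsUnit ((Polynomial.aeval τ : Polynomial ℂ →ₐ[ℂ] L) y) := by
    intro y
    refine isUnit_iff_ne_zero.mpr fun h => y.2 ?_
    have : (y : Polynomial ℂ) = 0 := (transcendental_iff.mp hτ) _ h
    rw [this]
    exact P.zero_mem
  let g : Localization.AtPrime P →+* L :=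
    IsLocalization.lift (g := (Polynomial.aeval τ : Polynomial ℂ →ₐ[ℂ] L).toRingHom) hunit
  obtain ⟨O, hO, hloc⟩ := IsLocalRing.exists_factor_valuationRing g
  have hg : ∀ f : Polynomial ℂ, g (algebraMap _ _ f) = Polynomial.aeval τ f := fun f =>
    IsLocalization.lift_eq hunit f
  have hmem : ∀ f : Polynomial ℂ, Polynomial.aeval τ f ∈ O := fun f => hg f ▸ hO _
  have hX : Polynomial.aeval τ (Polynomial.X - Polynomial.C (1 : ℂ)) = τ - 1 := by simp
  have hτO : τ - 1 ∈ O := hX ▸ hmem _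
  refine ⟨O, fun z => by simpa using hmem (Polynomial.C z), hτO, ?_⟩
  rw [IsLocalRing.mem_maximalIdeal, mem_nonunits_iff]
  intro hu
  have h1 : (⟨τ - 1, hτO⟩ : O) = g.codRestrict O.toSubring hO
      (algebraMap _ _ (Polynomial.X - Polynomial.C (1 : ℂ))) := by
    refine Subtype.ext ?_
    change τ - 1 = g _
    rw [hg, hX]
  rw [h1] at hu
  have h2 := hloc.map_nonunit _ hu
  rw [IsLocalization.AtPrime.isUnit_to_map_iff _ P] at h2
  exact h2 (by simp [P, RingHom.mem_ker])

theorem exists_algHom_of_finite {O : Type*} [CommRing O] [IsLocalRing O] [Algebra ℂ O]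
    (F : Set O) (hF : F.Finite) : ∃ (A : Subalgebra ℂ O) (θ : A →ₐ[ℂ] ℂ), F ⊆ A ∧
      ∀ a : A, (a : O) ∈ IsLocalRing.maximalIdeal O → θ a = 0 := by
  let A := Algebra.adjoin ℂ F
  let I : Ideal A := (IsLocalRing.maximalIdeal O).comap A.val
  have hI : I ≠ ⊤ := (Ideal.IsPrime.comap A.val).ne_top
  obtain ⟨M, hM, hIM⟩ := I.exists_le_maximal hI
  have hft : Algebra.FiniteType ℂ A :=
    (Subalgebra.fg_iff_finiteType _).mp ⟨hF.toFinset, by simp [A]⟩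
  let _ : Field (A ⧸ M) := Ideal.Quotient.field M
  have : Algebra.FiniteType ℂ (A ⧸ M) :=
    hft.of_surjective (Ideal.Quotient.mkₐ ℂ M) (Ideal.Quotient.mkₐ_surjective ℂ M)
  have := finite_of_finite_type_of_isJacobsonRing ℂ (A ⧸ M)
  let e : ℂ ≃ₐ[ℂ] (A ⧸ M) := AlgEquiv.ofBijective (Algebra.ofId ℂ (A ⧸ M))
    (IsAlgClosed.algebraMap_bijective_of_isIntegral (k := ℂ) (K := A ⧸ M))
  refine ⟨A, e.symm.toAlgHom.comp (Ideal.Quotient.mkₐ ℂ M), Algebra.subset_adjoin, ?_⟩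
  intro a ha
  have h1 : Ideal.Quotient.mk M a = 0 := Ideal.Quotient.eq_zero_iff_mem.mpr (hIM ha)
  change e.symm (Ideal.Quotient.mk M a) = 0
  rw [h1, map_zero]

variable {ι : Type*} [Fintype ι] [DecidableEq ι]

theorem exists_adapted_valuationRing {O L : Type*} [CommRing O] [IsDomain O] [ValuationRing O]
    [Field L] [Algebra O L] [IsFractionRing O L] (X : Submodule L (ι → L)) :
    ∃ (H : Matrix ι ι O) (S : Finset ι), IsUnit H.det ∧
      X = stp (H.map (algebraMap O L)) S := by
  let ψ : (ι → O) →ₗ[O] (ι → L) := (Algebra.linearMap O L).compLeft ι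
  let N : Submodule O (ι → O) := (X.restrictScalars O).comap ψ
  have hψ : ∀ v i, ψ v i = algebraMap O L (v i) := fun v i => rfl
  have hN : ∀ v, v ∈ N ↔ ψ v ∈ X := fun v => Iff.rfl
  have hQflat : Module.Flat O ((ι → O) ⧸ N) := by
    rw [Module.Flat.flat_iff_torsion_eq_bot_of_isBezout, eq_bot_iff]
    rintro x ⟨⟨a, ha⟩, hax⟩
    obtain ⟨v, rfl⟩ := N.mkQ_surjective x
    rw [Submodule.mem_bot, Submodule.mkQ_apply, Submodule.Quotient.mk_eq_zero, hN]
    have h1 : a • v ∈ N := by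
      rw [← Submodule.Quotient.mk_eq_zero]
      exact hax
    rw [hN, map_smul] at h1
    have h2 : algebraMap O L a ≠ 0 := IsFractionRing.to_map_ne_zero_of_mem_nonZeroDivisors ha
    rw [← algebraMap_smul L a] at h1
    exact (Submodule.smul_mem_iff X h2).mp h1
  have hQfree : Module.Free O ((ι → O) ⧸ N) := Module.free_of_flat_of_isLocalRing
  have hQfp : Module.FinitePresentation O ((ι → O) ⧸ N) :=
    Module.finitePresentation_of_projective O _
  have hNfin : Module.Finite O N := by
    have h := Module.FinitePresentation.fg_ker N.mkQ N.mkQ_surjective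
    rw [Submodule.ker_mkQ] at h
    exact Module.Finite.iff_fg.mpr h
  have hNflat : Module.Flat O N := by
    rw [Module.Flat.flat_iff_torsion_eq_bot_of_isBezout]
    exact (Submodule.isTorsionFree_iff_torsion_eq_bot).mp inferInstance
  have hNfree : Module.Free O N := Module.free_of_flat_of_isLocalRing
  let bN := Module.Free.chooseBasis O N
  let b := Module.Basis.sumQuot bN (Module.Free.chooseBasis O ((ι → O) ⧸ N))
  let e := b.indexEquiv (Pi.basisFun O ι)
  let H : Matrix ι ι O := (Pi.basisFun O ι).toMatrix (b.reindex e)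
  have hH : ∀ r i, H r i = b (e.symm i) r := fun r i => by
    simp [H, Module.Basis.toMatrix_apply]
  have hdet : IsUnit H.det :=
    Matrix.isUnit_det_of_right_inverse
      (Module.Basis.toMatrix_mul_toMatrix_flip (Pi.basisFun O ι) (b.reindex e))
  let S : Finset ι := Finset.univ.filter fun i => (e.symm i).isLeft
  refine ⟨H, S, hdet, le_antisymm ?_ ?_⟩
  · intro x hx
    obtain ⟨c, hc⟩ := IsLocalization.exist_integer_multiples_of_finite (nonZeroDivisors O) x
    choose v hv using hc
    have hc0 : algebraMap O L c ≠ 0 := IsFractionRing.to_map_ne_zero_of_mem_nonZeroDivisors c.2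
    have hvx : ψ v = algebraMap O L c • x := by
      ext i
      rw [hψ, hv]
      simp [Algebra.smul_def]
    have hvN : v ∈ N := by
      rw [hN, hvx]
      exact X.smul_mem _ hx
    rw [← Submodule.smul_mem_iff _ hc0, ← hvx]
    have h1 := congrArg (fun y : N => ψ y) (bN.sum_repr ⟨v, hvN⟩)
    simp only [Submodule.coe_sum, Submodule.coe_smul, map_sum, map_smul] at h1
    rw [← h1]
    refine Submodule.sum_mem _ fun j _ => ?_
    rw [← algebraMap_smul L]
    refine Submodule.smul_mem _ _ ?_
    have h2 : ψ (bN j) = fun r => (H.map (algebraMap O L)) r (e (Sum.inl j)) := by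
      ext r
      simp [hψ, hH, b]
    rw [h2]
    exact col_mem_stp _ (by simp [S])
  · rintro _ ⟨y, hy, rfl⟩
    rw [Matrix.mulVecLin_apply, Matrix.mulVec_eq_sum]
    refine Submodule.sum_mem _ fun i _ => ?_
    by_cases hi : i ∈ S
    · rw [op_smul_eq_smul]
      refine X.smul_mem _ ?_
      obtain ⟨j, hj⟩ := Sum.isLeft_iff.mp (Finset.mem_filter.mp hi).2
      have h2 : (H.map (algebraMap O L))ᵀ i = ψ (bN j) := by
        ext r
        simp [hψ, hH, b, hj]
      rw [h2]
      exact (bN j).2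
    · rw [hy i hi]
      simp

theorem isUnit_det_map_ringHom {A B : Type*} [CommRing A] [CommRing B] {H : Matrix ι ι A}
    (hH : IsUnit H.det) (f : A →+* B) : IsUnit (H.map f).det := by
  rw [← RingHom.mapMatrix_apply, ← RingHom.map_det]
  exact hH.map f

theorem map_inv_ringHom {A B : Type*} [CommRing A] [CommRing B] {H : Matrix ι ι A}
    (hH : IsUnit H.det) (f : A →+* B) : (H.map f)⁻¹ = H⁻¹.map f := by
  refine Matrix.inv_eq_left_inv ?_
  rw [← Matrix.map_mul, Matrix.nonsing_inv_mul _ hH, Matrix.map_one _ f.map_zero f.map_one]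

theorem stp_map_le_of_injective {A K L : Type*} [CommRing A] [Field K] [Field L] {φ : A →+* L}
    (hφ : Function.Injective φ) (θ : A →+* K) {G H : Matrix ι ι A} {T T' : Finset ι}
    (hH : IsUnit H.det) (h : stp (G.map φ) T ≤ stp (H.map φ) T') :
    stp (G.map θ) T ≤ stp (H.map θ) T' := by
  rw [stp_le_stp_iff (isUnit_det_map_ringHom hH φ)] at h
  rw [stp_le_stp_iff (isUnit_det_map_ringHom hH θ)]
  intro r hr i hi
  have h1 := h r hr i hi
  rw [map_inv_ringHom hH, ← Matrix.map_mul, Matrix.map_apply, map_eq_zero_iff φ hφ] at h1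
  rw [map_inv_ringHom hH, ← Matrix.map_mul, Matrix.map_apply, h1, map_zero]

theorem exists_specialization {L κ : Type*} [Field L] [Algebra ℂ L] [Finite κ] {τ : L}
    (hτ : Transcendental ℂ τ) (X : κ → Submodule L (ι → L)) :
    ∃ Y : κ → Submodule ℂ (ι → ℂ), (∀ k, finrank ℂ (Y k) = finrank L (X k)) ∧
      (∀ k l, ∀ M : Matrix ι ι ℂ,
        (X k).map (M.map (algebraMap ℂ L)).mulVecLin ≤ X l → (Y k).map M.mulVecLin ≤ Y l) ∧
      ∀ k, ∀ (M N : Matrix ι ι ℂ) (T : Finset ι),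
        stp (M.map (algebraMap ℂ L) + τ • N.map (algebraMap ℂ L)) T ≤ X k →
          stp (M + N) T ≤ Y k := by
  obtain ⟨O, hO, hτO, hτm⟩ := exists_valuationSubring_of_transcendental hτ
  let _ : Algebra ℂ O := ((algebraMap ℂ L).codRestrict O.toSubring hO).toAlgebra
  have : IsScalarTower ℂ O L := IsScalarTower.of_algebraMap_eq fun _ => rfl
  choose H S hH hX using fun k => exists_adapted_valuationRing (O := O) (X k)
  let t : O := ⟨τ - 1, hτO⟩
  let F : Set O := Set.range (fun x : κ × ι × ι => H x.1 x.2.1 x.2.2) ∪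
    Set.range (fun x : κ × ι × ι => (H x.1)⁻¹ x.2.1 x.2.2) ∪ {t}
  have hF : F.Finite := ((Set.finite_range _).union (Set.finite_range _)).union
    (Set.finite_singleton t)
  obtain ⟨A, θ, hFA, hθ⟩ := exists_algHom_of_finite F hF
  let H' : κ → Matrix ι ι A := fun k => Matrix.of fun r i =>
    ⟨H k r i, hFA (Or.inl (Or.inl ⟨(k, r, i), rfl⟩))⟩
  let R' : κ → Matrix ι ι A := fun k => Matrix.of fun r i =>
    ⟨(H k)⁻¹ r i, hFA (Or.inl (Or.inr ⟨(k, r, i), rfl⟩))⟩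
  let t' : A := ⟨t, hFA (Or.inr rfl)⟩
  have hval : Function.Injective (A.val : A →+* O) := Subtype.val_injective
  have hH' : ∀ k, IsUnit (H' k).det := by
    intro k
    refine Matrix.isUnit_det_of_right_inverse (B := R' k) ?_
    refine Matrix.map_injective hval ?_
    beta_reduce
    rw [Matrix.map_mul, Matrix.map_one _ (map_zero _) (map_one _)]
    exact Matrix.mul_nonsing_inv _ (hH k)
  let φ : A →+* L := (algebraMap O L).comp (A.val : A →+* O)
  have hφ : Function.Injective φ := (IsFractionRing.injective O L).comp hval
  have hX' : ∀ k, X k = stp ((H' k).map φ) (S k) := hX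
  have hθt : θ t' = 0 := hθ t' hτm
  have hφt : φ t' = τ - 1 := rfl
  have hφc : ∀ M : Matrix ι ι ℂ, (M.map (algebraMap ℂ A)).map φ = M.map (algebraMap ℂ L) :=
    fun M => by
      ext r i
      rfl
  have hθc : ∀ M : Matrix ι ι ℂ, (M.map (algebraMap ℂ A)).map (θ : A →+* ℂ) = M := fun M => by
    ext r i
    simp
  refine ⟨fun k => stp ((H' k).map (θ : A →+* ℂ)) (S k), fun k => ?_, fun k l M h => ?_,
    fun k M N T h => ?_⟩
  · rw [hX', finrank_stp (isUnit_det_map_ringHom (hH' k) _),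
      finrank_stp (isUnit_det_map_ringHom (hH' k) _)]
  · rw [hX', hX', stp_map, ← hφc, ← Matrix.map_mul] at h
    have h1 := stp_map_le_of_injective hφ (θ : A →+* ℂ) (hH' l) h
    rwa [Matrix.map_mul, hθc, ← stp_map] at h1
  · let B : Matrix ι ι A := M.map (algebraMap ℂ A) + (t' + 1) • N.map (algebraMap ℂ A)
    have h1 := stp_map_le_of_injective (G := B) (T := T) hφ (θ : A →+* ℂ) (hH' k) (by
      rw [← hX']
      convert h using 2
      ext r i
      simp only [B, Matrix.map_apply, Matrix.add_apply, Matrix.smul_apply, map_add, map_mul,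
        smul_eq_mul, map_one, hφt, sub_add_cancel]
      rfl)
    convert h1 using 2
    ext r i
    simp [B, hθt]

end Specialization

theorem exists_graded_destabilizing {n : ℕ} {C : Bool → Matrix (Fin n ⊕ Fin n) (Fin n ⊕ Fin n) ℝ}
    {I : Bool → Finset (Fin n ⊕ Fin n)} {W : Submodule ℝ (Fin n ⊕ Fin n → ℝ)}
    (hC : ∀ f, IsUnit (C f).det) (hblock : IsBlock (C false)) (hW : IsGraded W)
    (hWC : ∀ f, W = stp (C f) (I f)) (hsurj : Function.Surjective (invMap C I))
    {w : Bool → ℕ → ℝ} (hw : ∀ f, Antitone (w f))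
    (hpos : 0 < ∑ f, ∑ i ∈ I f, w f (posY n f i))
    {T : Bool → Matrix (Fin n ⊕ Fin n) (Fin n ⊕ Fin n) ℂ} (hT : IsBlock (T false))
    (hTdet : ∀ f, IsUnit (T f).det) :
    ∃ V : Submodule ℂ (Fin n ⊕ Fin n → ℂ), IsGraded V ∧
      0 < flagDegree (posY n) w (2 * n) T V := by
  obtain ⟨τ, D, G, W', hτ, hgr, hG⟩ := exists_generic_deformation hC hblock hW hWC hsurj T hT
  let X : Option (Bool × (Bool × Fin (2 * n))) → Submodule SeqGerm (Fin n ⊕ Fin n → SeqGerm) :=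
    fun k => match k with
    | none => W'
    | some (true, f, j) => W' ⊓ stp (G f) (lower (posY n f) j)
    | some (false, f, j) => stp (G f) (lower (posY n f) j)
  obtain ⟨Y, hfin, hmap, hstp⟩ := exists_specialization hτ X
  have hle : ∀ k l, X k ≤ X l → Y k ≤ Y l := by
    intro k l h
    have := hmap k l 1 (by rwa [Matrix.map_one _ (map_zero _) (map_one _), Matrix.mulVecLin_one,
      Submodule.map_id])
    rwa [Matrix.mulVecLin_one, Submodule.map_id] at this
  have hY : ∀ f (j : Fin (2 * n)),
      stp (T f) (lower (posY n f) j) = Y (some (false, f, j)) := by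
    intro f j
    have h1 := hstp (some (false, f, j)) (D f) (T f - D f) (lower (posY n f) j)
      ((hG f).2.2 j).ge
    rw [add_sub_cancel] at h1
    refine Submodule.eq_of_le_of_finrank_eq h1 ?_
    rw [hfin, finrank_stp (hTdet f), finrank_stp (hG f).1]
  refine ⟨Y none, ?_, ?_⟩
  · intro v hv
    have h1 := hmap none none (leftProj ℂ n) (by
      rintro _ ⟨v, hv, rfl⟩
      have h2 : (leftProj ℂ n).map (algebraMap ℂ SeqGerm) = leftProj SeqGerm n := by
        simp [leftProj, fromBlocks_map]
      rw [h2]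
      exact hgr v hv)
    exact h1 ⟨v, hv, rfl⟩
  · have h1 : flagDegree (posY n) w (2 * n) G W' = ∑ f, ∑ i ∈ I f, w f (posY n f i) :=
      flagDegree_eq_sum w (fun f i => posY_lt f i) (fun f => (hG f).1) (fun _ _ => rfl)
        fun f => (hG f).2.1
    rw [← h1] at hpos
    refine hpos.trans_le ?_
    rw [flagDegree, flagDegree, degree, degree]
    refine add_le_add (Finset.sum_le_sum fun s _ => ?_) (le_of_eq ?_)
    · refine mul_le_mul_of_nonneg_left ?_ (sub_nonneg.mpr (hw _ (Nat.le_succ _)))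
      rw [hY]
      have h2 : Y (some (true, s.1, s.2)) ≤ Y none ⊓ Y (some (false, s.1, s.2)) :=
        le_inf (hle _ _ inf_le_left) (hle _ _ inf_le_right)
      have h3 := Submodule.finrank_mono h2
      rw [hfin] at h3
      exact_mod_cast h3
    · rw [hfin none]

section OrthProj

open scoped ComplexOrder

variable {𝕜 ι : Type*} [RCLike 𝕜] [Fintype ι] [DecidableEq ι]

/-- `P` is the matrix of the orthogonal projection onto `W`. -/
structure IsOrthProj (P : Matrix ι ι 𝕜) (W : Submodule 𝕜 (ι → 𝕜)) : Prop where
  isHermitian : P.IsHermitian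
  mulVec_mem : ∀ v, P *ᵥ v ∈ W
  mulVec_eq : ∀ v ∈ W, P *ᵥ v = v

theorem IsOrthProj.mul_eq {P Q : Matrix ι ι 𝕜} {W U : Submodule 𝕜 (ι → 𝕜)}
    (hP : IsOrthProj P W) (hQ : IsOrthProj Q U) (h : U ≤ W) : P * Q = Q := by
  refine Matrix.mulVec_injective ?_
  ext1 v
  rw [← Matrix.mulVec_mulVec]
  exact hP.mulVec_eq _ (h (hQ.mulVec_mem v))

theorem IsOrthProj.mul_eq' {P Q : Matrix ι ι 𝕜} {W U : Submodule 𝕜 (ι → 𝕜)}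
    (hP : IsOrthProj P W) (hQ : IsOrthProj Q U) (h : U ≤ W) : Q * P = Q := by
  have h1 := congrArg conjTranspose (hP.mul_eq hQ h)
  rwa [Matrix.conjTranspose_mul, hP.isHermitian.eq, hQ.isHermitian.eq] at h1

theorem IsOrthProj.mul_self {P : Matrix ι ι 𝕜} {W : Submodule 𝕜 (ι → 𝕜)}
    (hP : IsOrthProj P W) : P * P = P := hP.mul_eq hP le_rfl

theorem IsOrthProj.trace_eq {P : Matrix ι ι 𝕜} {W : Submodule 𝕜 (ι → 𝕜)}
    (hP : IsOrthProj P W) : P.trace = finrank 𝕜 W := by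
  have h : LinearMap.IsProj W (Matrix.toLin' P) :=
    ⟨fun v => by simpa using hP.mulVec_mem v, fun v hv => by simpa using hP.mulVec_eq v hv⟩
  rw [← h.trace, Matrix.trace_toLin'_eq]

theorem mulVec_injective_conjTranspose_mul_self {m : Type*} [Fintype m] [DecidableEq m]
    {B : Matrix ι m 𝕜} (hB : Function.Injective B.mulVec) : IsUnit (Bᴴ * B).det :=
  (Matrix.isUnit_iff_isUnit_det _).mp (Matrix.PosDef.conjTranspose_mul_self B hB).isUnit

/-- The orthogonal projection onto the span of the columns of a matrix. -/
noncomputable def colProj {m : Type*} [Fintype m] [DecidableEq m] (B : Matrix ι m 𝕜) :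
    Matrix ι ι 𝕜 := B * (Bᴴ * B)⁻¹ * Bᴴ

theorem isOrthProj_colProj {m : Type*} [Fintype m] [DecidableEq m] {B : Matrix ι m 𝕜}
    (hB : Function.Injective B.mulVec) : IsOrthProj (colProj B) (LinearMap.range B.mulVecLin) := by
  have hdet := mulVec_injective_conjTranspose_mul_self hB
  refine ⟨?_, fun v => ⟨((Bᴴ * B)⁻¹ * Bᴴ) *ᵥ v, ?_⟩, ?_⟩
  · rw [Matrix.IsHermitian, colProj, Matrix.conjTranspose_mul, Matrix.conjTranspose_mul,
      Matrix.conjTranspose_conjTranspose, Matrix.conjTranspose_nonsing_inv,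
      (Matrix.isHermitian_conjTranspose_mul_self B).eq, Matrix.mul_assoc]
  · rw [Matrix.mulVecLin_apply, Matrix.mulVec_mulVec, colProj, Matrix.mul_assoc]
  · rintro _ ⟨x, rfl⟩
    rw [Matrix.mulVecLin_apply, Matrix.mulVec_mulVec, colProj, Matrix.mul_assoc, Matrix.mul_assoc,
      Matrix.nonsing_inv_mul _ hdet, Matrix.mul_one]

theorem exists_basis_matrix (W : Submodule 𝕜 (ι → 𝕜)) : ∃ B : Matrix ι (Fin (finrank 𝕜 W)) 𝕜,
    Function.Injective B.mulVec ∧ LinearMap.range B.mulVecLin = W := by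
  let b := Module.finBasis 𝕜 W
  let B : Matrix ι (Fin (finrank 𝕜 W)) 𝕜 := Matrix.of fun r j => (b j : ι → 𝕜) r
  have hB : ∀ x, B *ᵥ x = ∑ j, x j • (b j : ι → 𝕜) := by
    intro x
    ext r
    simp [B, Matrix.mulVec, dotProduct, mul_comm]
  have hinj : Function.Injective B.mulVec := by
    rw [← Matrix.coe_mulVecLin]
    refine (injective_iff_map_eq_zero _).mpr fun x hx => ?_
    rw [Matrix.mulVecLin_apply, hB] at hx
    have hli := b.linearIndependent.map' W.subtype W.ker_subtype
    exact funext (Fintype.linearIndependent_iff.mp hli x hx)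
  have hrange : LinearMap.range B.mulVecLin = W := by
    refine le_antisymm ?_ fun v hv => ⟨b.repr ⟨v, hv⟩, ?_⟩
    · rintro _ ⟨x, rfl⟩
      rw [Matrix.mulVecLin_apply, hB]
      exact Submodule.sum_mem _ fun j _ => W.smul_mem _ (b j).2
    · rw [Matrix.mulVecLin_apply, hB]
      have h := congrArg W.subtype (b.sum_repr ⟨v, hv⟩)
      rw [map_sum] at h
      exact h
  exact ⟨B, hinj, hrange⟩

theorem exists_isOrthProj (W : Submodule 𝕜 (ι → 𝕜)) : ∃ P : Matrix ι ι 𝕜, IsOrthProj P W := by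
  obtain ⟨B, hinj, hrange⟩ := exists_basis_matrix W
  have h := isOrthProj_colProj hinj
  rw [hrange] at h
  exact ⟨colProj B, h⟩

theorem IsOrthProj.finrank_inf_le_re_trace {P Q : Matrix ι ι 𝕜} {W U : Submodule 𝕜 (ι → 𝕜)}
    (hP : IsOrthProj P W) (hQ : IsOrthProj Q U) :
    (finrank 𝕜 ↥(W ⊓ U) : ℝ) ≤ RCLike.re (P * Q).trace := by
  obtain ⟨R, hR⟩ := exists_isOrthProj (W ⊓ U)
  have h1 : (P - R) * (P - R) = P - R := by
    rw [Matrix.sub_mul, Matrix.mul_sub, Matrix.mul_sub, hP.mul_self, hR.mul_self,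
      hP.mul_eq hR inf_le_left, hP.mul_eq' hR inf_le_left, sub_self, sub_zero]
  have h2 : (P - R)ᴴ = P - R := by
    rw [Matrix.conjTranspose_sub, hP.isHermitian.eq, hR.isHermitian.eq]
  have h3 : ((P - R) * Q).trace = (((P - R) * Q)ᴴ * ((P - R) * Q)).trace := by
    rw [Matrix.conjTranspose_mul, h2, hQ.isHermitian.eq, Matrix.mul_assoc,
      ← Matrix.mul_assoc (P - R) (P - R) Q, h1, Matrix.trace_mul_comm Q, Matrix.mul_assoc,
      hQ.mul_self]
  have h4 : (0 : ℝ) ≤ RCLike.re ((P - R) * Q).trace := by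
    rw [h3]
    exact (RCLike.nonneg_iff.mp (Matrix.posSemidef_conjTranspose_mul_self _).trace_nonneg).1
  have h5 : (P * Q).trace = (finrank 𝕜 ↥(W ⊓ U) : 𝕜) + ((P - R) * Q).trace := by
    rw [Matrix.sub_mul, hQ.mul_eq' hR inf_le_right, Matrix.trace_sub, hR.trace_eq]
    ring
  rw [h5, map_add, RCLike.natCast_re]
  linarith

theorem isOrthProj_stp {U : Matrix ι ι 𝕜} (hU : Uᴴ * U = 1) (T : Finset ι) :
    IsOrthProj (U * diagonal (fun i => if i ∈ T then 1 else 0) * Uᴴ) (stp U T) := by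
  have hU' : U * Uᴴ = 1 := mul_eq_one_comm.mp hU
  refine ⟨?_, fun v => ?_, ?_⟩
  · rw [Matrix.IsHermitian, Matrix.conjTranspose_mul, Matrix.conjTranspose_mul,
      Matrix.conjTranspose_conjTranspose, Matrix.diagonal_conjTranspose, Matrix.mul_assoc]
    congr 3
    ext i
    by_cases h : i ∈ T <;> simp [h]
  · refine ⟨diagonal (fun i => if i ∈ T then 1 else 0) *ᵥ (Uᴴ *ᵥ v), fun i hi => ?_, ?_⟩
    · rw [Matrix.mulVec_diagonal, if_neg hi, zero_mul]
    · rw [Matrix.mulVecLin_apply, Matrix.mulVec_mulVec, Matrix.mulVec_mulVec, Matrix.mul_assoc]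
  · rintro _ ⟨x, hx, rfl⟩
    rw [Matrix.mulVecLin_apply, Matrix.mulVec_mulVec, Matrix.mul_assoc, hU, Matrix.mul_one,
      ← Matrix.mulVec_mulVec]
    congr 1
    ext i
    rw [Matrix.mulVec_diagonal]
    by_cases h : i ∈ T
    · rw [if_pos h, one_mul]
    · rw [hx i h, mul_zero]

theorem diagonal_weight_eq (pos : ι → ℕ) (w : ℕ → ℝ) {N : ℕ} (hpos : ∀ i, pos i < N) :
    diagonal (fun i => (w (pos i) : 𝕜)) =
      ∑ j : Fin N, ((w j - w (j + 1) : ℝ) : 𝕜) •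
        diagonal (fun i => if i ∈ lower pos j then (1 : 𝕜) else 0) + (w N : 𝕜) • 1 := by
  ext r i
  rw [Matrix.add_apply, Matrix.sum_apply]
  by_cases h : r = i
  · subst h
    simp only [Matrix.smul_apply, Matrix.diagonal_apply_eq, Matrix.one_apply_eq, smul_eq_mul,
      mul_one, mem_lower]
    have h1 := sum_weight_drop w (pos r) N (hpos r).le
    rw [Finset.sum_range] at h1
    have h2 : w (pos r) = ∑ j : Fin N, (w j - w (j + 1)) * (if pos r ≤ j then 1 else 0) + w N := by
      simp only [mul_ite, mul_one, mul_zero]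
      rw [h1]
      ring
    rw [h2]
    push_cast
    congr 1
    refine Finset.sum_congr rfl fun j _ => ?_
    split_ifs <;> simp
  · simp [h]

theorem sum_drop_mul_finrank_le {U : Matrix ι ι 𝕜} (hU : Uᴴ * U = 1) {P : Matrix ι ι 𝕜}
    {W : Submodule 𝕜 (ι → 𝕜)} (hP : IsOrthProj P W) (pos : ι → ℕ) {w : ℕ → ℝ} (hw : Antitone w)
    {N : ℕ} (hpos : ∀ i, pos i < N) :
    ∑ j : Fin N, (w j - w (j + 1)) * (finrank 𝕜 ↥(W ⊓ stp U (lower pos j)) : ℝ) +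
      w N * (finrank 𝕜 W : ℝ) ≤
        RCLike.re (P * (U * diagonal (fun i => (w (pos i) : 𝕜)) * Uᴴ)).trace := by
  have hU' : U * Uᴴ = 1 := mul_eq_one_comm.mp hU
  have h1 : P * (U * diagonal (fun i => (w (pos i) : 𝕜)) * Uᴴ) =
      ∑ j : Fin N, ((w j - w (j + 1) : ℝ) : 𝕜) • (P * (U *
        diagonal (fun i => if i ∈ lower pos j then (1 : 𝕜) else 0) * Uᴴ)) + (w N : 𝕜) • P := by
    rw [diagonal_weight_eq pos w hpos, Matrix.mul_add, Matrix.add_mul, Matrix.mul_add,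
      Matrix.mul_sum, Matrix.sum_mul, Matrix.mul_sum]
    simp only [Matrix.mul_smul, Matrix.smul_mul, Matrix.mul_one, hU']
  rw [h1, Matrix.trace_add, Matrix.trace_sum, map_add, map_sum]
  refine add_le_add (Finset.sum_le_sum fun j _ => ?_) (le_of_eq ?_)
  · rw [Matrix.trace_smul, smul_eq_mul, RCLike.re_ofReal_mul]
    exact mul_le_mul_of_nonneg_left (hP.finrank_inf_le_re_trace (isOrthProj_stp hU _))
      (sub_nonneg.mpr (hw (Nat.le_succ _)))
  · rw [Matrix.trace_smul, smul_eq_mul, RCLike.re_ofReal_mul, hP.trace_eq, RCLike.natCast_re]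

end OrthProj

section Diagonalization

open scoped ComplexOrder

variable {𝕜 ι : Type*} [RCLike 𝕜] [Fintype ι] [DecidableEq ι]

theorem exists_unitary_eigenvalues {A : Matrix ι ι 𝕜} (hA : A.IsHermitian) :
    ∃ U : Matrix ι ι 𝕜, Uᴴ * U = 1 ∧
      A = U * diagonal (fun i => (hA.eigenvalues i : 𝕜)) * Uᴴ := by
  refine ⟨hA.eigenvectorUnitary, ?_, ?_⟩
  · rw [← Matrix.star_eq_conjTranspose]
    exact Unitary.coe_star_mul_self _
  · conv_lhs => rw [hA.spectral_theorem, Unitary.conjStarAlgAut_apply]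
    rfl

theorem isHermitian_diagonal_ofReal (d : ι → ℝ) :
    (diagonal (fun i => (d i : 𝕜))).IsHermitian := by
  rw [Matrix.isHermitian_diagonal_iff]
  exact fun i => RCLike.conj_ofReal _

theorem exists_unitary_diagonal {A : Matrix ι ι 𝕜} (hA : A.IsHermitian) (d : ι → ℝ)
    (h : A.charpoly = ∏ i, (Polynomial.X - Polynomial.C (d i : 𝕜))) :
    ∃ U : Matrix ι ι 𝕜, Uᴴ * U = 1 ∧ A = U * diagonal (fun i => (d i : 𝕜)) * Uᴴ := by
  have hD : (diagonal (fun i => (d i : 𝕜))).IsHermitian := isHermitian_diagonal_ofReal d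
  have hAD : hA.eigenvalues = hD.eigenvalues := by
    rw [Matrix.IsHermitian.eigenvalues_eq_eigenvalues_iff, h, Matrix.charpoly_diagonal]
  obtain ⟨U, hU, hUA⟩ := exists_unitary_eigenvalues hA
  obtain ⟨V, hV, hVD⟩ := exists_unitary_eigenvalues hD
  refine ⟨U * Vᴴ, ?_, ?_⟩
  · rw [Matrix.conjTranspose_mul, Matrix.conjTranspose_conjTranspose, Matrix.mul_assoc,
      ← Matrix.mul_assoc Uᴴ, hU, Matrix.one_mul, mul_eq_one_comm.mp hV]
  · rw [hAD] at hUA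
    generalize hD.eigenvalues = e at hUA hVD
    rw [hUA, hVD, Matrix.conjTranspose_mul, Matrix.conjTranspose_conjTranspose]
    have h1 : U * Vᴴ * (V * diagonal (fun i => (e i : 𝕜)) * Vᴴ) * (V * Uᴴ) =
      U * (Vᴴ * V) * diagonal (fun i => (e i : 𝕜)) * (Vᴴ * V) * Uᴴ := by
      simp only [Matrix.mul_assoc]
    rw [h1, hV, Matrix.mul_one, Matrix.mul_one]

theorem exists_normalizing {G : Matrix ι ι 𝕜} (hG : G.PosDef) :
    ∃ C : Matrix ι ι 𝕜, Cᴴ * G * C = 1 := by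
  obtain ⟨U, hU, h⟩ := exists_unitary_eigenvalues hG.isHermitian
  have hpos := fun i => hG.eigenvalues_pos i
  generalize hG.isHermitian.eigenvalues = e at h hpos
  set D : Matrix ι ι 𝕜 := diagonal (fun i => (((Real.sqrt (e i))⁻¹ : ℝ) : 𝕜)) with hDdef
  have hD : Dᴴ = D := isHermitian_diagonal_ofReal _
  refine ⟨U * D, ?_⟩
  have h1 : D * Uᴴ * (U * diagonal (fun i => (e i : 𝕜)) * Uᴴ) * (U * D) =
      D * (Uᴴ * U) * diagonal (fun i => (e i : 𝕜)) * (Uᴴ * U) * D := by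
    simp only [Matrix.mul_assoc]
  rw [Matrix.conjTranspose_mul, hD, h, h1, hU, Matrix.mul_one, Matrix.mul_one, hDdef,
    Matrix.diagonal_mul_diagonal, Matrix.diagonal_mul_diagonal, ← Matrix.diagonal_one]
  congr 1
  ext i
  rw [← RCLike.ofReal_mul, ← RCLike.ofReal_mul, ← RCLike.ofReal_one]
  congr 1
  have h2 := Real.mul_self_sqrt (hpos i).le
  have h3 := Real.sqrt_pos.mpr (hpos i)
  nth_rw 2 [← h2]
  field_simp

theorem exists_orthonormal_matrix (W : Submodule 𝕜 (ι → 𝕜)) :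
    ∃ q : Matrix ι (Fin (finrank 𝕜 W)) 𝕜, qᴴ * q = 1 ∧ ∀ x, q *ᵥ x ∈ W := by
  obtain ⟨B, hB, hW⟩ := exists_basis_matrix W
  obtain ⟨C, hC⟩ := exists_normalizing (Matrix.PosDef.conjTranspose_mul_self B hB)
  refine ⟨B * C, ?_, fun x => ?_⟩
  · rw [Matrix.conjTranspose_mul, ← hC]
    simp only [Matrix.mul_assoc]
  · rw [← Matrix.mulVec_mulVec]
    exact hW.le ⟨C *ᵥ x, rfl⟩

end Diagonalization

section ComplexStructure

variable {n : ℕ}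

theorem exists_eigenframe {J : Matrix (Fin n ⊕ Fin n) (Fin n ⊕ Fin n) ℝ} (hJ : Jᵀ = -J)
    (hJ2 : J * J = -1) : ∃ q : Matrix (Fin n ⊕ Fin n) (Fin n) ℂ,
      qᴴ * q = 1 ∧ J.map Complex.ofReal * q = Complex.I • q := by
  set K : Matrix (Fin n ⊕ Fin n) (Fin n ⊕ Fin n) ℂ := J.map Complex.ofReal with hK
  have hKK : K * K = -1 := by
    have h := congrArg (fun M : Matrix (Fin n ⊕ Fin n) (Fin n ⊕ Fin n) ℝ =>
      M.map Complex.ofRealHom) hJ2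
    simp only [Matrix.map_mul] at h
    rw [Matrix.map_neg _ (map_neg Complex.ofRealHom),
      Matrix.map_one _ (map_zero _) (map_one _)] at h
    exact h
  have hKH : Kᴴ = -K := by
    ext i j
    have h := congrFun (congrFun hJ i) j
    rw [Matrix.transpose_apply, Matrix.neg_apply] at h
    simp [hK, h]
  have htr : K.trace = 0 := by
    have h : J.trace = 0 := by
      have h := congrArg Matrix.trace hJ
      rw [Matrix.trace_transpose, Matrix.trace_neg] at h
      linarith
    have h1 := congrArg Complex.ofReal h
    simpa [hK, Matrix.trace] using h1
  set P : Matrix (Fin n ⊕ Fin n) (Fin n ⊕ Fin n) ℂ := (1 / 2 : ℂ) • (1 - Complex.I • K) with hP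
  have hKP : K * P = Complex.I • P := by
    have h1 : Complex.I • (Complex.I • K) = -K := by
      rw [smul_smul, Complex.I_mul_I, neg_one_smul]
    rw [hP, Matrix.mul_smul, Matrix.mul_sub, Matrix.mul_smul, hKK, smul_comm Complex.I,
      smul_sub Complex.I, h1]
    congr 1
    simp [add_comm]
  have hproj : IsOrthProj P (LinearMap.range P.mulVecLin) := by
    refine ⟨?_, fun v => ⟨v, rfl⟩, ?_⟩
    · rw [Matrix.IsHermitian, hP, Matrix.conjTranspose_smul, Matrix.conjTranspose_sub,
        Matrix.conjTranspose_smul, hKH]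
      simp
    · rintro _ ⟨x, rfl⟩
      rw [Matrix.mulVecLin_apply, Matrix.mulVec_mulVec]
      congr 1
      conv_lhs => rw [hP]
      rw [Matrix.smul_mul, Matrix.sub_mul, Matrix.smul_mul, hKP, smul_smul, Complex.I_mul_I,
        Matrix.one_mul, neg_one_smul, sub_neg_eq_add, ← two_smul ℂ P, smul_smul]
      norm_num
  have hfin : finrank ℂ (LinearMap.range P.mulVecLin) = n := by
    have h := hproj.trace_eq
    rw [hP, Matrix.trace_smul, Matrix.trace_sub, Matrix.trace_smul, htr] at h
    simp only [Matrix.trace_one, Fintype.card_sum, Fintype.card_fin,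
      smul_eq_mul] at h
    push_cast at h
    have h2 : (n : ℂ) = finrank ℂ (LinearMap.range P.mulVecLin) := by rw [← h]; ring
    exact_mod_cast h2.symm
  have h := exists_orthonormal_matrix (LinearMap.range P.mulVecLin)
  rw [hfin] at h
  obtain ⟨q, hq, hmem⟩ := h
  refine ⟨q, hq, Matrix.mulVec_injective ?_⟩
  ext1 x
  obtain ⟨y, hy⟩ := hmem x
  rw [Matrix.mulVecLin_apply] at hy
  rw [← Matrix.mulVec_mulVec, Matrix.smul_mulVec, ← hy, Matrix.mulVec_mulVec, hKP,
    Matrix.smul_mulVec]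

theorem IsGraded.isBlock {W : Submodule ℂ (Fin n ⊕ Fin n → ℂ)} (hW : IsGraded W)
    {P : Matrix (Fin n ⊕ Fin n) (Fin n ⊕ Fin n) ℂ} (hP : IsOrthProj P W) : IsBlock P := by
  have h1 : P * (leftProj ℂ n * P) = leftProj ℂ n * P := by
    refine Matrix.mulVec_injective ?_
    ext1 v
    rw [← Matrix.mulVec_mulVec, ← Matrix.mulVec_mulVec]
    exact hP.mulVec_eq _ (hW _ (hP.mulVec_mem v))
  have hE : (leftProj ℂ n)ᴴ = leftProj ℂ n := by
    simp [leftProj, Matrix.fromBlocks_conjTranspose]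
  have h2 := congrArg conjTranspose h1
  rw [Matrix.conjTranspose_mul, Matrix.conjTranspose_mul, hE, hP.isHermitian.eq,
    Matrix.mul_assoc] at h2
  exact h2.symm.trans h1

theorem trace_mul_fromBlocks {P : Matrix (Fin n ⊕ Fin n) (Fin n ⊕ Fin n) ℂ} (hP : IsBlock P)
    (M : Matrix (Fin n ⊕ Fin n) (Fin n ⊕ Fin n) ℂ) :
    (P * fromBlocks M.toBlocks₁₁ 0 0 M.toBlocks₂₂).trace = (P * M).trace := by
  conv_rhs => rw [← fromBlocks_toBlocks M]
  rw [hP.eq_fromBlocks, fromBlocks_multiply, fromBlocks_multiply]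
  simp [Matrix.trace, Matrix.fromBlocks]

theorem eq_of_sq_eq_sq {R : Type*} [CommRing R] [IsDomain R] [CharZero R] {f g : Polynomial R}
    (hf : f.Monic) (hg : g.Monic) (h : f ^ 2 = g ^ 2) : f = g := by
  rcases sq_eq_sq_iff_eq_or_eq_neg.mp h with h | h
  · exact h
  · have h1 := congrArg Polynomial.leadingCoeff h
    rw [Polynomial.leadingCoeff_neg, hf.leadingCoeff, hg.leadingCoeff] at h1
    have h2 : (2 : R) = 0 := by linear_combination h1
    exact absurd h2 two_ne_zero

end ComplexStructure

section Compression

variable {n : ℕ}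

theorem charpoly_conj_of_mul_eq_one {R ι : Type*} [CommRing R] [Fintype ι] [DecidableEq ι]
    {Q Q' : Matrix ι ι R} (h : Q' * Q = 1) (M : Matrix ι ι R) :
    (Q' * M * Q).charpoly = M.charpoly := by
  rw [Matrix.mul_assoc, Matrix.charpoly_mul_comm, Matrix.mul_assoc, mul_eq_one_comm.mp h,
    Matrix.mul_one]

theorem exists_compression {S J : Matrix (Fin n ⊕ Fin n) (Fin n ⊕ Fin n) ℝ} (hS : S.IsSymm)
    (hJ : Jᵀ = -J) (hJ2 : J * J = -1) :
    ∃ M : Matrix (Fin n ⊕ Fin n) (Fin n ⊕ Fin n) ℂ, M.IsHermitian ∧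
      M.charpoly = S.charpoly.map Complex.ofRealHom ∧ M.toBlocks₂₂ = M.toBlocks₁₁ᵀ ∧
      ((2 : ℂ) • M.toBlocks₁₁).charpoly ^ 2 =
        (S - J * S * J).charpoly.map Complex.ofRealHom := by
  obtain ⟨q, hq, hJq⟩ := exists_eigenframe hJ hJ2
  set q' : Matrix (Fin n ⊕ Fin n) (Fin n) ℂ := q.map (starRingEnd ℂ) with hq'
  set S' : Matrix (Fin n ⊕ Fin n) (Fin n ⊕ Fin n) ℂ := S.map Complex.ofRealHom with hS'
  set K : Matrix (Fin n ⊕ Fin n) (Fin n ⊕ Fin n) ℂ := J.map Complex.ofRealHom with hK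
  replace hJq : K * q = Complex.I • q := hJq
  have hconj : ∀ A : Matrix (Fin n ⊕ Fin n) (Fin n ⊕ Fin n) ℝ,
      (A.map Complex.ofRealHom).map (starRingEnd ℂ) = A.map Complex.ofRealHom := by
    intro A
    ext i j
    simp
  have hJq' : K * q' = -Complex.I • q' := by
    have h := congrArg (fun A : Matrix (Fin n ⊕ Fin n) (Fin n) ℂ => A.map (starRingEnd ℂ)) hJq
    simp only [Matrix.map_mul] at h
    rw [hK, hconj] at h
    rw [hK, h]
    ext i j
    simp [hq']
  have hKH : Kᴴ = -K := by
    ext i j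
    have h := congrFun (congrFun hJ i) j
    rw [Matrix.transpose_apply, Matrix.neg_apply] at h
    simp [hK, h]
  have hSH : S'ᴴ = S' := by
    ext i j
    simp [hS', hS.apply]
  have hq'H : q'ᴴ = qᵀ := by
    ext i j
    simp [hq']
  have hqT : qᴴ = q'ᵀ := by
    ext i j
    simp [hq']
  have h11 : q'ᴴ * q' = 1 := by
    have h := congrArg Matrix.transpose hq
    rwa [Matrix.transpose_mul, hqT, Matrix.transpose_transpose, Matrix.transpose_one,
      ← hq'H] at h
  have h21 : q'ᴴ * q = 0 := by
    have h1 : q'ᴴ * K = -Complex.I • q'ᴴ := by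
      have h := congrArg conjTranspose hJq'
      rw [Matrix.conjTranspose_mul, hKH, Matrix.mul_neg, Matrix.conjTranspose_smul] at h
      rw [← neg_eq_iff_eq_neg.mpr h.symm]
      simp
    have h2 : q'ᴴ * K * q = q'ᴴ * (K * q) := Matrix.mul_assoc _ _ _
    rw [h1, hJq, Matrix.smul_mul, Matrix.mul_smul] at h2
    have h3 : (2 * Complex.I) • (q'ᴴ * q) = 0 := by
      rw [two_mul, add_smul]
      nth_rw 1 [← h2]
      simp
    exact (smul_eq_zero.mp h3).resolve_left (by simp)
  have h12 : qᴴ * q' = 0 := by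
    have h := congrArg conjTranspose h21
    rwa [Matrix.conjTranspose_mul, Matrix.conjTranspose_conjTranspose,
      Matrix.conjTranspose_zero] at h
  set Q : Matrix (Fin n ⊕ Fin n) (Fin n ⊕ Fin n) ℂ := fromCols q q' with hQ
  have hQH : Qᴴ = fromRows qᴴ q'ᴴ := by
    rw [hQ, Matrix.conjTranspose_fromCols_eq_fromRows_conjTranspose]
  have hQQ : Qᴴ * Q = 1 := by
    rw [hQH, hQ, Matrix.fromRows_mul_fromCols, hq, h11, h12, h21, Matrix.fromBlocks_one]
  set E : Matrix (Fin n ⊕ Fin n) (Fin n ⊕ Fin n) ℂ := fromBlocks 1 0 0 (-1) with hE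
  have hEH : Eᴴ = E := by
    simp [hE, Matrix.fromBlocks_conjTranspose]
  have hKQ : K * Q = Complex.I • (Q * E) := by
    rw [hQ, Matrix.mul_fromCols, hJq, hJq', hE, Matrix.fromCols_mul_fromBlocks]
    ext i (j | j) <;> simp
  have hQK : Qᴴ * K = Complex.I • (E * Qᴴ) := by
    have h := congrArg conjTranspose hKQ
    rw [Matrix.conjTranspose_mul, hKH, Matrix.mul_neg, Matrix.conjTranspose_smul,
      Matrix.conjTranspose_mul, hEH] at h
    rw [← neg_eq_iff_eq_neg.mpr h.symm]
    simp
  have hblock : Qᴴ * S' * Q = fromBlocks (qᴴ * S' * q) (qᴴ * S' * q') (q'ᴴ * S' * q)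
      (q'ᴴ * S' * q') := by
    rw [hQH, Matrix.fromRows_mul, hQ, Matrix.fromRows_mul_fromCols]
  have h22 : q'ᴴ * S' * q' = (qᴴ * S' * q)ᵀ := by
    have hST : S'ᵀ = S' := by
      ext i j
      simp [hS', hS.apply]
    rw [Matrix.transpose_mul, Matrix.transpose_mul, hqT, Matrix.transpose_transpose, hST, ← hq'H,
      Matrix.mul_assoc]
  refine ⟨Qᴴ * S' * Q, ?_, ?_, ?_, ?_⟩
  · rw [Matrix.IsHermitian, Matrix.conjTranspose_mul, Matrix.conjTranspose_mul, hSH,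
      Matrix.conjTranspose_conjTranspose, Matrix.mul_assoc]
  · rw [charpoly_conj_of_mul_eq_one hQQ, hS', Matrix.charpoly_map]
  · rw [hblock, Matrix.toBlocks_fromBlocks₂₂, Matrix.toBlocks_fromBlocks₁₁, h22]
  · have h1 : Qᴴ * (S' - K * S' * K) * Q = fromBlocks ((2 : ℂ) • (qᴴ * S' * q)) 0 0
        ((2 : ℂ) • (qᴴ * S' * q)ᵀ) := by
      have h2 : Qᴴ * (S' - K * S' * K) * Q = Qᴴ * S' * Q - (Qᴴ * K) * S' * (K * Q) := by
        simp only [Matrix.mul_sub, Matrix.sub_mul, Matrix.mul_assoc]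
      have h3 : E * Qᴴ * S' * (Q * E) = E * (Qᴴ * S' * Q) * E := by
        simp only [Matrix.mul_assoc]
      rw [h2, hKQ, hQK, Matrix.smul_mul, Matrix.smul_mul, Matrix.mul_smul, smul_smul,
        Complex.I_mul_I, neg_one_smul, sub_neg_eq_add, h3, hblock, hE, h22,
        Matrix.fromBlocks_multiply, Matrix.fromBlocks_multiply, Matrix.fromBlocks_add]
      simp [two_smul]
    rw [hblock, Matrix.toBlocks_fromBlocks₁₁, ← Matrix.charpoly_map,
      Matrix.map_sub _ (map_sub Complex.ofRealHom)]
    simp only [Matrix.map_mul]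
    rw [← hK, ← hS', ← charpoly_conj_of_mul_eq_one hQQ, h1, Matrix.charpoly_fromBlocks_zero₁₂,
      ← Matrix.transpose_smul, Matrix.charpoly_transpose, sq]

end Compression

section Semistable

variable {n : ℕ}

theorem isUnit_det_of_conjTranspose_mul_self {ι : Type*} [Fintype ι] [DecidableEq ι]
    {U : Matrix ι ι ℂ} (hU : Uᴴ * U = 1) : IsUnit U.det :=
  (Matrix.isUnit_iff_isUnit_det _).mp (IsUnit.of_mul_eq_one_right _ hU)

theorem flagDegree_le_re_trace {ι : Type*} [Fintype ι] [DecidableEq ι] {w : Bool → ℕ → ℝ}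
    (hw : ∀ f, Antitone (w f)) {pos : Bool → ι → ℕ} {N : ℕ} (hpos : ∀ f i, pos f i < N)
    {T : Bool → Matrix ι ι ℂ} (hT : ∀ f, (T f)ᴴ * T f = 1) {W : Submodule ℂ (ι → ℂ)}
    {P : Matrix ι ι ℂ} (hP : IsOrthProj P W) :
    flagDegree pos w N T W ≤
      ∑ f, RCLike.re (P * (T f * diagonal (fun i => (w f (pos f i) : ℂ)) * (T f)ᴴ)).trace := by
  rw [flagDegree, degree, Fintype.sum_prod_type, Finset.sum_mul, ← Finset.sum_add_distrib]
  exact Finset.sum_le_sum fun f _ => sum_drop_mul_finrank_le (hT f) hP (pos f) (hw f) (hpos f)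

theorem exists_semistable {S J : Matrix (Fin n ⊕ Fin n) (Fin n ⊕ Fin n) ℝ} (hS : S.IsSymm)
    (hJ : Jᵀ = -J) (hJ2 : J * J = -1) {σ γ : ℕ → ℝ} (hσ : Antitone σ) (hγ : Antitone γ)
    (hSσ : S.charpoly = ∏ i, (Polynomial.X - Polynomial.C (σ (posY n true i))))
    (hSγ : (S - J * S * J).charpoly =
      ∏ i : Fin n, (Polynomial.X - Polynomial.C (-γ i)) ^ 2) :
    ∃ T : Bool → Matrix (Fin n ⊕ Fin n) (Fin n ⊕ Fin n) ℂ, IsBlock (T false) ∧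
      (∀ f, IsUnit (T f).det) ∧
      ∀ W, IsGraded W → flagDegree (posY n) (wY σ γ) (2 * n) T W ≤ 0 := by
  obtain ⟨M, hM, hMσ, hM22, hMγ⟩ := exists_compression hS hJ hJ2
  have hM11 : M.toBlocks₁₁ᴴ = M.toBlocks₁₁ := by
    ext i j
    exact hM.apply (Sum.inl i) (Sum.inl j)
  have hmap : ∀ d : ℝ, (Polynomial.X - Polynomial.C d).map Complex.ofRealHom =
      Polynomial.X - Polynomial.C (d : ℂ) := by
    intro d
    simp
  have hγ11 : ((2 : ℂ) • M.toBlocks₁₁).charpoly =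
      ∏ i : Fin n, (Polynomial.X - Polynomial.C (((-γ i : ℝ)) : ℂ)) := by
    refine eq_of_sq_eq_sq (Matrix.charpoly_monic _)
      (Polynomial.monic_prod_of_monic _ _ fun i _ => Polynomial.monic_X_sub_C _) ?_
    rw [hMγ, hSγ, Polynomial.map_prod, ← Finset.prod_pow]
    simp only [Polynomial.map_pow, hmap]
  have hH : ((2 : ℂ) • M.toBlocks₁₁)ᴴ = (2 : ℂ) • M.toBlocks₁₁ := by
    rw [Matrix.conjTranspose_smul, hM11]
    simp
  obtain ⟨U, hU, hUM⟩ := exists_unitary_diagonal hH (fun i : Fin n => -γ i) hγ11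
  obtain ⟨T₁, hT₁, hT₁M⟩ := exists_unitary_diagonal hM (fun i => σ (posY n true i)) (by
    rw [hMσ, hSσ, Polynomial.map_prod]
    simp only [hmap]
    rfl)
  set T₀ : Matrix (Fin n ⊕ Fin n) (Fin n ⊕ Fin n) ℂ := fromBlocks U 0 0 (Uᵀᴴ) with hT₀
  have hUU : Uᵀ * Uᵀᴴ = 1 := by
    have h := congrArg Matrix.transpose hU
    rwa [Matrix.transpose_mul, Matrix.transpose_one] at h
  have hT₀U : T₀ᴴ * T₀ = 1 := by
    rw [hT₀, Matrix.fromBlocks_conjTranspose, Matrix.fromBlocks_multiply]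
    simp [hU, hUU]
  have hdiag : diagonal (fun i : Fin n => ((γ i / 2 : ℝ) : ℂ)) =
      -(1 / 2 : ℂ) • diagonal (fun i : Fin n => ((-γ i : ℝ) : ℂ)) := by
    rw [← Matrix.diagonal_smul]
    congr 1
    ext i
    simp
    ring
  have h11 : U * diagonal (fun i : Fin n => ((γ i / 2 : ℝ) : ℂ)) * Uᴴ = -M.toBlocks₁₁ := by
    have hUM' : U * diagonal (fun i : Fin n => ((-γ i : ℝ) : ℂ)) * Uᴴ = (2 : ℂ) • M.toBlocks₁₁ :=
      hUM.symm
    rw [hdiag, Matrix.mul_smul, Matrix.smul_mul, hUM', smul_smul]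
    norm_num
  have h22 : Uᵀᴴ * diagonal (fun i : Fin n => ((γ i / 2 : ℝ) : ℂ)) * Uᵀ = -M.toBlocks₂₂ := by
    have h := congrArg Matrix.transpose h11
    rw [Matrix.transpose_mul, Matrix.transpose_mul, Matrix.diagonal_transpose,
      Matrix.transpose_neg, ← hM22, ← Matrix.mul_assoc] at h
    exact h
  have hT₀M : T₀ * diagonal (fun i => (wY σ γ false (posY n false i) : ℂ)) * T₀ᴴ =
      -fromBlocks M.toBlocks₁₁ 0 0 M.toBlocks₂₂ := by
    have h : diagonal (fun i => (wY σ γ false (posY n false i) : ℂ)) =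
        fromBlocks (diagonal (fun i : Fin n => ((γ i / 2 : ℝ) : ℂ))) 0 0
          (diagonal (fun i : Fin n => ((γ i / 2 : ℝ) : ℂ))) := by
      rw [Matrix.fromBlocks_diagonal]
      congr 1
      ext (i | i) <;> rfl
    rw [h, hT₀, Matrix.fromBlocks_conjTranspose, Matrix.fromBlocks_multiply,
      Matrix.fromBlocks_multiply, Matrix.fromBlocks_neg, Matrix.conjTranspose_conjTranspose]
    simp only [Matrix.conjTranspose_zero, Matrix.mul_zero, Matrix.zero_mul, add_zero, zero_add,
      h11, h22, neg_zero]
  have hT : ∀ f : Bool, ((fun f : Bool => if f then T₁ else T₀) f)ᴴ *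
      (fun f : Bool => if f then T₁ else T₀) f = 1 := by
    rintro (_ | _)
    · exact hT₀U
    · exact hT₁
  refine ⟨fun f => if f then T₁ else T₀, isBlock_fromBlocks _ _,
    fun f => isUnit_det_of_conjTranspose_mul_self (hT f), fun W hW => ?_⟩
  obtain ⟨P, hP⟩ := exists_isOrthProj W
  refine (flagDegree_le_re_trace (wY_antitone hσ hγ) posY_lt hT hP).trans (le_of_eq ?_)
  have h1 : T₁ * diagonal (fun i => (wY σ γ true (posY n true i) : ℂ)) * T₁ᴴ = M := hT₁M.symm
  rw [Fintype.sum_bool]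
  simp only [if_true, Bool.false_eq_true, if_false]
  rw [h1, hT₀M, ← map_add, Matrix.mul_neg, Matrix.trace_neg,
    trace_mul_fromBlocks (hW.isBlock hP), add_neg_cancel, map_zero]

end Semistable

theorem exists_semistable_flags {n : ℕ} {S J : Matrix (Fin n ⊕ Fin n) (Fin n ⊕ Fin n) ℝ}
    (hS : S.IsSymm) (hJ : Jᵀ = -J) (hJ2 : J * J = -1) {σ γ : ℕ → ℝ} (hσ : Antitone σ)
    (hγ : Antitone γ)
    (hSσ : S.charpoly = ∏ i, (Polynomial.X - Polynomial.C (σ (posY n true i))))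
    (hSγ : (S - J * S * J).charpoly =
      ∏ i : Fin n, (Polynomial.X - Polynomial.C (-γ i)) ^ 2) :
    ∃ A : Fin 3 → Matrix (Fin n) (Fin n) ℝ, (∀ f, IsUnit (A f).det) ∧
      ∀ V, flagDegree (posX n) (wX σ γ) n A V ≤ 0 := by
  obtain ⟨A, hA, hgen⟩ := exists_generic_matrices 3 n
  refine ⟨A, hA, fun V => ?_⟩
  by_contra! hV
  obtain ⟨C, I, W, hC, hblock, hW, hWC, hpos, hsurj⟩ :=
    exists_rigid_destabilizing hA hgen hσ hγ hV
  obtain ⟨T, hT, hTdet, hss⟩ := exists_semistable hS hJ hJ2 hσ hγ hSσ hSγ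
  obtain ⟨V', hV', hpos'⟩ := exists_graded_destabilizing hC hblock hW hWC hsurj
    (wY_antitone hσ hγ) hpos hT hTdet
  exact hpos'.not_ge (hss V' hV')

section Determinants

open scoped ComplexOrder

variable {ι : Type*} [Fintype ι] [DecidableEq ι]

/-- Gram-Schmidt orthogonalization of an invertible matrix. -/
theorem exists_triangular_mul_orthogonal {n : ℕ} {M : Matrix (Fin n) (Fin n) ℝ}
    (hM : IsUnit M.det) : ∃ R : Matrix (Fin n) (Fin n) ℝ,
      (∀ r i, i < r → R r i = 0) ∧ IsUnit R.det ∧ (M * R)ᴴ * (M * R) = 1 := by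
  have hS : (Mᴴ * M).PosDef :=
    Matrix.PosDef.conjTranspose_mul_self M (mulVec_injective_of_isUnit_det hM)
  set L := LDL.lowerInv hS with hL
  have hLdet : IsUnit L := isUnit_of_invertible L
  have hd : (LDL.diag hS).PosDef := by
    rw [LDL.diag_eq_lowerInv_conj]
    have h := hS.conjTranspose_mul_mul_same (B := Lᴴ)
      (mulVec_injective_of_isUnit_det (by
        rw [Matrix.det_conjTranspose]
        exact ((Matrix.isUnit_iff_isUnit_det _).mp hLdet).star))
    rwa [Matrix.conjTranspose_conjTranspose] at h
  obtain ⟨x, hx⟩ : ∃ x : Fin n → ℝ, LDL.diag hS = diagonal x := ⟨_, rfl⟩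
  have hconj := LDL.diag_eq_lowerInv_conj hS
  rw [hx] at hd hconj
  have hpos : ∀ i, 0 < x i := Matrix.posDef_diagonal_iff.mp hd
  have h1 : (M * (Lᴴ * diagonal fun i => (Real.sqrt (x i))⁻¹))ᴴ *
      (M * (Lᴴ * diagonal fun i => (Real.sqrt (x i))⁻¹)) = 1 := by
    have h2 : (M * (Lᴴ * diagonal fun i => (Real.sqrt (x i))⁻¹))ᴴ *
        (M * (Lᴴ * diagonal fun i => (Real.sqrt (x i))⁻¹)) =
        diagonal (fun i => (Real.sqrt (x i))⁻¹) * (L * (Mᴴ * M) * Lᴴ) *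
          diagonal (fun i => (Real.sqrt (x i))⁻¹) := by
      rw [Matrix.conjTranspose_mul, Matrix.conjTranspose_mul, Matrix.diagonal_conjTranspose,
        Matrix.conjTranspose_conjTranspose, star_trivial]
      simp only [Matrix.mul_assoc]
    rw [h2, ← hconj, Matrix.diagonal_mul_diagonal, Matrix.diagonal_mul_diagonal,
      ← Matrix.diagonal_one]
    congr 1
    ext i
    have h3 := Real.mul_self_sqrt (hpos i).le
    have h4 := Real.sqrt_pos.mpr (hpos i)
    nth_rw 2 [← h3]
    field_simp
  refine ⟨_, fun r i h => ?_, ?_, h1⟩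
  · rw [Matrix.mul_diagonal, Matrix.conjTranspose_apply, hL, LDL.lowerInv_triangular hS h]
    simp
  · have h2 := congrArg Matrix.det h1
    rw [Matrix.det_mul, Matrix.det_mul M, Matrix.det_one, ← mul_assoc] at h2
    exact IsUnit.of_mul_eq_one_right _ h2

theorem log_det_le_trace_sub_card {X : Matrix ι ι ℝ} (hX : X.PosDef) :
    Real.log X.det ≤ X.trace - Fintype.card ι := by
  rw [hX.isHermitian.det_eq_prod_eigenvalues, hX.isHermitian.trace_eq_sum_eigenvalues]
  simp only [RCLike.ofReal_real_eq_id, id_eq]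
  rw [Real.log_prod fun i _ => (hX.eigenvalues_pos i).ne']
  have h : ∑ i, Real.log (hX.isHermitian.eigenvalues i) ≤
      ∑ i, (hX.isHermitian.eigenvalues i - 1) :=
    Finset.sum_le_sum fun i _ => Real.log_le_sub_one_of_pos (hX.eigenvalues_pos i)
  simpa using h

theorem one_le_det_one_add {Z : Matrix ι ι ℝ} (hZ : Z.PosSemidef) : 1 ≤ (1 + Z).det := by
  obtain ⟨U, hU, h⟩ := exists_unitary_eigenvalues hZ.isHermitian
  have h1 : 1 + Z = U * diagonal (fun i => 1 + hZ.isHermitian.eigenvalues i) * Uᴴ := by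
    have h2 : diagonal (fun i => 1 + hZ.isHermitian.eigenvalues i) =
        1 + diagonal hZ.isHermitian.eigenvalues := by
      rw [← Matrix.diagonal_one, Matrix.diagonal_add]
    rw [h2, Matrix.mul_add, Matrix.add_mul, Matrix.mul_one, mul_eq_one_comm.mp hU]
    congr 1
  have hdet : Uᴴ.det * U.det = 1 := by rw [← Matrix.det_mul, hU, Matrix.det_one]
  rw [h1, Matrix.det_mul, Matrix.det_mul, Matrix.det_diagonal, mul_comm, ← mul_assoc, hdet,
    one_mul]
  exact Finset.one_le_prod fun i _ => le_add_of_nonneg_right (hZ.eigenvalues_nonneg i)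

theorem det_le_det_add {Y Z : Matrix ι ι ℝ} (hY : Y.PosDef) (hZ : Z.PosSemidef) :
    Y.det ≤ (Y + Z).det := by
  obtain ⟨C, hC⟩ := exists_normalizing hY
  have h1 := congrArg Matrix.det hC
  rw [Matrix.det_mul, Matrix.det_mul, Matrix.det_one] at h1
  have h2 := one_le_det_one_add (hZ.conjTranspose_mul_mul_same C)
  have h3 : Cᴴ * (Y + Z) * C = 1 + Cᴴ * Z * C := by
    rw [Matrix.mul_add, Matrix.add_mul, hC]
  rw [← h3, Matrix.det_mul, Matrix.det_mul] at h2
  have h4 : 0 < Cᴴ.det * C.det := by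
    have h5 : (Cᴴ.det * C.det) * Y.det = 1 := by rw [← h1]; ring
    exact pos_of_mul_pos_left (by rw [h5]; exact one_pos) hY.det_pos.le
  refine le_of_mul_le_mul_left ?_ h4
  calc Cᴴ.det * C.det * Y.det = 1 := by rw [← h1]; ring
    _ ≤ _ := h2
    _ = _ := by ring

theorem sq_minor_mul_prod_le_det {m : Type*} [Fintype m] [DecidableEq m] (N : Matrix ι m ℝ)
    {e : m → ι} (he : Function.Injective e) (hdet : (N.submatrix e id).det ≠ 0) {x : ι → ℝ}
    (hx : ∀ i, 0 < x i) :
    (N.submatrix e id).det ^ 2 * ∏ a, x (e a) ≤ (Nᴴ * diagonal x * N).det := by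
  set Ne := N.submatrix e id with hNe
  have hD : (diagonal (x ∘ e)).PosDef := Matrix.posDef_diagonal_iff.mpr fun a => hx (e a)
  have hY : (Neᴴ * diagonal (x ∘ e) * Ne).PosDef :=
    hD.conjTranspose_mul_mul_same (mulVec_injective_of_isUnit_det (isUnit_iff_ne_zero.mpr hdet))
  classical
  have hZ : (Nᴴ * diagonal (fun i => if i ∈ Set.range e then 0 else x i) * N).PosSemidef := by
    refine Matrix.PosSemidef.conjTranspose_mul_mul_same (Matrix.posSemidef_diagonal_iff.mpr
      fun i => ?_) N
    split_ifs
    · exact le_rfl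
    · exact (hx i).le
  have hsum : Nᴴ * diagonal x * N = Neᴴ * diagonal (x ∘ e) * Ne +
      Nᴴ * diagonal (fun i => if i ∈ Set.range e then 0 else x i) * N := by
    ext a b
    rw [Matrix.add_apply, Matrix.mul_apply, Matrix.mul_apply, Matrix.mul_apply]
    simp only [Matrix.mul_diagonal, Matrix.conjTranspose_apply, star_trivial,
      hNe, Matrix.submatrix_apply, id_eq, Function.comp_apply]
    rw [← Finset.sum_image (s := Finset.univ) (g := e)
      (f := fun i => N i a * x i * N i b) he.injOn]
    rw [← Finset.sum_filter_add_sum_filter_not Finset.univ (fun i => i ∈ Set.range e)]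
    congr 1
    · refine Finset.sum_congr ?_ fun _ _ => rfl
      ext i
      simp
    · rw [Finset.sum_filter]
      refine Finset.sum_congr rfl fun i _ => ?_
      by_cases h : i ∈ Set.range e
      · rw [if_neg (not_not.mpr h), if_pos h, mul_zero, zero_mul]
      · rw [if_pos h, if_neg h]
  have h := det_le_det_add hY hZ
  rw [← hsum, Matrix.det_mul, Matrix.det_mul, Matrix.det_conjTranspose, star_trivial,
    Matrix.det_diagonal] at h
  refine le_trans (le_of_eq ?_) h
  simp only [Function.comp_apply]
  ring

end Determinants

section LowerBound

variable {n : ℕ}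

theorem exists_adapted_minor {d : ℕ} {N : Matrix (Fin n) (Fin d) ℝ}
    (hN : Function.Injective N.mulVec) :
    ∃ e : Fin d → Fin n, Function.Injective e ∧ (N.submatrix e id).det ≠ 0 ∧
      ∀ j : ℕ, finrank ℝ ↥(coordSub ℝ (lower (fun i : Fin n => (i : ℕ)) j) ⊓
        LinearMap.range N.mulVecLin) = (Finset.univ.filter fun a => (e a : ℕ) ≤ j).card := by
  obtain ⟨B, I, hB, htri, hI⟩ := exists_adapted (LinearMap.range N.mulVecLin)
  have hBdet : IsUnit B.det := by rw [hB]; exact isUnit_one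
  have hcard : I.card = d := by
    have h := finrank_stp hBdet I
    rw [← hI, LinearMap.finrank_range_of_inj (by rw [Matrix.coe_mulVecLin]; exact hN)] at h
    simpa using h.symm
  have hdiag : ∀ i, B i i ≠ 0 := by
    have h := Matrix.det_of_isUpperTriangular (M := B) fun r i h => htri r i h
    rw [hB] at h
    exact fun i => Finset.prod_ne_zero_iff.mp (h.symm.trans_ne one_ne_zero) i (Finset.mem_univ i)
  refine ⟨I.orderEmbOfFin hcard, (I.orderEmbOfFin hcard).injective, ?_, fun j => ?_⟩
  · intro h0
    obtain ⟨v, hv, hv0⟩ := Matrix.exists_mulVec_eq_zero_iff.mpr h0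
    have hmem : N *ᵥ v ∈ stp B I := hI ▸ ⟨v, rfl⟩
    obtain ⟨y, hy, hyN⟩ := hmem
    rw [Matrix.mulVecLin_apply] at hyN
    have hzero : ∀ i ∈ I, (N *ᵥ v) i = 0 := by
      intro i hi
      obtain ⟨a, rfl⟩ : i ∈ Set.range (I.orderEmbOfFin hcard) := by
        rw [Finset.range_orderEmbOfFin]
        exact hi
      exact congrFun hv0 a
    have hy0 : y = 0 := by
      by_contra hne
      obtain ⟨i₀, hi₀⟩ := Function.ne_iff.mp hne
      have hs : (Finset.univ.filter fun i => y i ≠ 0).Nonempty :=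
        ⟨i₀, by simpa using hi₀⟩
      set i := (Finset.univ.filter fun i => y i ≠ 0).max' hs with hi
      have hi1 : y i ≠ 0 := (Finset.mem_filter.mp (Finset.max'_mem _ hs)).2
      have hiI : i ∈ I := by
        by_contra h
        exact hi1 (hy i h)
      have h1 := hzero i hiI
      rw [← hyN, Matrix.mulVec, dotProduct, Finset.sum_eq_single i] at h1
      · exact (mul_ne_zero (hdiag i) hi1) h1
      · intro k _ hk
        rcases lt_or_gt_of_ne hk with h | h
        · rw [htri i k h, zero_mul]
        · have h2 : y k = 0 := by
            by_contra h2
            exact h.not_ge (Finset.le_max' _ k (by simpa using h2))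
          rw [h2, mul_zero]
      · simp
    rw [hy0, Matrix.mulVec_zero] at hyN
    exact hv (hN (by rw [← hyN, Matrix.mulVec_zero]))
  · have h1 : coordSub ℝ (lower (fun i : Fin n => (i : ℕ)) j) =
        stp B (lower (fun i : Fin n => (i : ℕ)) j) := by
      have h := stp_mul hBdet (T := lower (fun i : Fin n => (i : ℕ)) j) (fun r hr i hi =>
        htri r i (by rw [mem_lower] at hr hi; exact Fin.lt_def.mpr (by omega))) 1
      rw [Matrix.one_mul] at h
      rw [h, stp, Matrix.mulVecLin_one, Submodule.map_id]
    rw [h1, hI, stp_inf hBdet, finrank_stp hBdet,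
      ← Finset.card_map (I.orderEmbOfFin hcard).toEmbedding]
    congr 1
    ext i
    simp only [Finset.mem_inter, mem_lower, Finset.mem_map, Finset.mem_filter, Finset.mem_univ,
      true_and]
    constructor
    · rintro ⟨h, hi⟩
      obtain ⟨a, rfl⟩ : i ∈ Set.range (I.orderEmbOfFin hcard) := by
        rw [Finset.range_orderEmbOfFin]
        exact hi
      exact ⟨a, h, rfl⟩
    · rintro ⟨a, h, rfl⟩
      exact ⟨h, Finset.orderEmbOfFin_mem I hcard a⟩

theorem sum_drop_mul_finrank_stp {s : Type*} [Fintype s] {U : s → Submodule ℝ (Fin n → ℝ)}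
    {c : s → ℝ} {c₀ : ℝ} (hdeg : ∀ V, degree U c c₀ V ≤ 0) (htop : degree U c c₀ ⊤ = 0)
    {O : Matrix (Fin n) (Fin n) ℝ} (hO : IsUnit O.det) {d : s → ℕ} (e : ∀ k, Fin (d k) → Fin n)
    (hd : ∀ k, finrank ℝ (U k) = d k)
    (he : ∀ k, ∀ j : ℕ, finrank ℝ ↥(stp O (lower (fun i : Fin n => (i : ℕ)) j) ⊓ U k) =
      (Finset.univ.filter fun a => (e k a : ℕ) ≤ j).card) {x : ℕ → ℝ} (hx : Monotone x) :
    0 ≤ ∑ k, c k * ∑ a, x (e k a) + c₀ * ∑ i : Fin n, x i := by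
  have h1 : ∀ k, ∑ a, x (e k a) = ∑ j : Fin n, (x j - x (j + 1)) *
      (finrank ℝ ↥(stp O (lower (fun i : Fin n => (i : ℕ)) j) ⊓ U k) : ℝ) +
        x n * finrank ℝ ↥(⊤ ⊓ U k) := by
    intro k
    rw [← sum_drop_mul_card (fun a => (e k a : ℕ)) x (fun a => (e k a).2) Finset.univ, top_inf_eq,
      hd k]
    simp only [he, Finset.card_univ, Fintype.card_fin]
  have h2 : ∑ i : Fin n, x i = ∑ j : Fin n, (x j - x (j + 1)) *
      (finrank ℝ ↥(stp O (lower (fun i : Fin n => (i : ℕ)) j)) : ℝ) +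
        x n * finrank ℝ ↥(⊤ : Submodule ℝ (Fin n → ℝ)) := by
    rw [← sum_drop_mul_card (fun i : Fin n => (i : ℕ)) x (fun i => i.2) Finset.univ]
    simp only [finrank_stp hO, finrank_top, Module.finrank_fin_fun, Finset.card_univ,
      Fintype.card_fin]
    rfl
  have h3 : ∑ k, c k * ∑ a, x (e k a) + c₀ * ∑ i : Fin n, x i =
      ∑ j : Fin n, (x j - x (j + 1)) *
        degree U c c₀ (stp O (lower (fun i : Fin n => (i : ℕ)) j)) + x n * degree U c c₀ ⊤ := by
    simp only [degree, h2, h1, mul_add, Finset.mul_sum, Finset.sum_add_distrib]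
    rw [Finset.sum_comm]
    have h4 : ∀ a b c d a' b' c' d' : ℝ, a = a' → b = b' → c = c' → d = d' →
        a + b + (c + d) = a' + c' + (b' + d') := by
      rintro a b c d a' b' c' d' rfl rfl rfl rfl
      ring
    refine h4 _ _ _ _ _ _ _ _ ?_ ?_ ?_ ?_
    · exact Finset.sum_congr rfl fun j _ => Finset.sum_congr rfl fun k _ => by ring
    · exact Finset.sum_congr rfl fun k _ => by ring
    · exact Finset.sum_congr rfl fun k _ => by ring
    · ring
  rw [h3, htop, mul_zero, add_zero]
  exact Finset.sum_nonneg fun j _ => mul_nonneg_of_nonpos_of_nonpos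
    (sub_nonpos.mpr (hx (Nat.le_succ _))) (hdeg _)

end LowerBound

section Energy

open scoped ComplexOrder

variable {n : ℕ} {s : Type*} [Fintype s] {d : s → ℕ}

/-- The Kempf-Ness functional of a weighted family of subspaces, given by bases, on the space of
positive definite forms. -/
noncomputable def energy (B : ∀ k, Matrix (Fin n) (Fin (d k)) ℝ) (c : s → ℝ) (c₀ : ℝ)
    (H : Matrix (Fin n) (Fin n) ℝ) : ℝ :=
  ∑ k, c k * Real.log ((B k)ᴴ * H * B k).det + c₀ * Real.log H.det

theorem isCompact_orthogonal (n : ℕ) :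
    IsCompact {O : Matrix (Fin n) (Fin n) ℝ | Oᴴ * O = 1} := by
  have h1 : IsCompact (Set.univ.pi fun _ : Fin n => Set.univ.pi fun _ : Fin n =>
      Set.Icc (-1 : ℝ) 1) :=
    isCompact_univ_pi fun _ => isCompact_univ_pi fun _ => isCompact_Icc
  refine h1.of_isClosed_subset (isClosed_eq (by fun_prop) continuous_const) fun O hO i _ j _ => ?_
  have h2 := entry_norm_bound_of_unitary
    (U := O) (Matrix.mem_unitaryGroup_iff'.mpr hO) i j
  rw [Real.norm_eq_abs] at h2
  exact abs_le.mp h2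

theorem isUnit_det_of_orthogonal {O : Matrix (Fin n) (Fin n) ℝ} (hO : Oᴴ * O = 1) :
    IsUnit O.det :=
  (Matrix.isUnit_iff_isUnit_det _).mp (IsUnit.of_mul_eq_one_right _ hO)

theorem finrank_coordSub_inf_range {O : Matrix (Fin n) (Fin n) ℝ} (hO : Oᴴ * O = 1) {m : ℕ}
    (B : Matrix (Fin n) (Fin m) ℝ) (T : Finset (Fin n)) :
    finrank ℝ ↥(coordSub ℝ T ⊓ LinearMap.range (Oᴴ * B).mulVecLin) =
      finrank ℝ ↥(stp O T ⊓ LinearMap.range B.mulVecLin) := by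
  have hinj : Function.Injective O.mulVecLin := by
    rw [Matrix.coe_mulVecLin]
    exact mulVec_injective_of_isUnit_det (isUnit_det_of_orthogonal hO)
  have h1 : LinearMap.range B.mulVecLin =
      (LinearMap.range (Oᴴ * B).mulVecLin).map O.mulVecLin := by
    rw [← LinearMap.range_comp, ← Matrix.mulVecLin_mul, ← Matrix.mul_assoc,
      mul_eq_one_comm.mp hO, Matrix.one_mul]
  rw [h1, stp, ← Submodule.map_inf _ hinj]
  exact (LinearEquiv.finrank_eq (Submodule.equivMapOfInjective _ hinj _))

theorem exists_energy_lower_bound {B : ∀ k, Matrix (Fin n) (Fin (d k)) ℝ}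
    (hB : ∀ k, Function.Injective (B k).mulVec) {c : s → ℝ} (hc : ∀ k, 0 ≤ c k) {c₀ : ℝ}
    (hdeg : ∀ V, degree (fun k => LinearMap.range (B k).mulVecLin) c c₀ V ≤ 0)
    (htop : degree (fun k => LinearMap.range (B k).mulVecLin) c c₀ ⊤ = 0) :
    ∃ K, ∀ H : Matrix (Fin n) (Fin n) ℝ, H.PosDef → K ≤ energy B c c₀ H := by
  have key : ∃ K, ∀ O ∈ {O : Matrix (Fin n) (Fin n) ℝ | Oᴴ * O = 1}, Oᴴ * O = 1 →
      ∀ x : ℕ → ℝ, Monotone x →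
        K ≤ energy B c c₀ (O * diagonal (fun i : Fin n => Real.exp (x i)) * Oᴴ) := by
    refine (isCompact_orthogonal n).induction_on
      (p := fun S => ∃ K, ∀ O ∈ S, Oᴴ * O = 1 → ∀ x : ℕ → ℝ, Monotone x →
        K ≤ energy B c c₀ (O * diagonal (fun i : Fin n => Real.exp (x i)) * Oᴴ)) ?_ ?_ ?_ ?_
    · exact ⟨0, fun O hO => absurd hO (Set.notMem_empty O)⟩
    · rintro S T hST ⟨K, hK⟩
      exact ⟨K, fun O hO => hK O (hST hO)⟩
    · rintro S T ⟨K, hK⟩ ⟨L, hL⟩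
      refine ⟨min K L, fun O hO h x hx => ?_⟩
      rcases hO with hO | hO
      · exact (min_le_left _ _).trans (hK O hO h x hx)
      · exact (min_le_right _ _).trans (hL O hO h x hx)
    · intro O₀ hO₀
      have hO₀' : IsUnit (O₀ᴴ).det := by
        rw [Matrix.det_conjTranspose]
        exact (isUnit_det_of_orthogonal hO₀).star
      have hinj : ∀ k, Function.Injective (O₀ᴴ * B k).mulVec := by
        intro k x y h
        rw [← Matrix.mulVec_mulVec, ← Matrix.mulVec_mulVec] at h
        exact hB k (mulVec_injective_of_isUnit_det hO₀' h)
      choose e he hdet hcard using fun k => exists_adapted_minor (hinj k)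
      have hpos : ∀ k, 0 < ((O₀ᴴ * B k).submatrix (e k) id).det ^ 2 / 2 := fun k => by
        have := hdet k
        positivity
      have hev : ∀ᶠ O in nhds O₀, ∀ k, ((O₀ᴴ * B k).submatrix (e k) id).det ^ 2 / 2 <
          ((Oᴴ * B k).submatrix (e k) id).det ^ 2 := by
        rw [Filter.eventually_all]
        intro k
        have hcont : Continuous fun O : Matrix (Fin n) (Fin n) ℝ =>
            ((Oᴴ * B k).submatrix (e k) id).det ^ 2 := by
          fun_prop
        exact hcont.continuousAt.eventually_const_lt (half_lt_self (by
          have := hdet k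
          positivity))
      refine ⟨{O | ∀ k, ((O₀ᴴ * B k).submatrix (e k) id).det ^ 2 / 2 <
          ((Oᴴ * B k).submatrix (e k) id).det ^ 2}, mem_nhdsWithin_of_mem_nhds hev,
        ∑ k, c k * Real.log (((O₀ᴴ * B k).submatrix (e k) id).det ^ 2 / 2),
        fun O hO hOO x hx => ?_⟩
      have hnonneg := sum_drop_mul_finrank_stp hdeg htop (isUnit_det_of_orthogonal hO₀) e
        (fun k => by
          rw [LinearMap.finrank_range_of_inj (by rw [Matrix.coe_mulVecLin]; exact hB k)]
          simp)
        (fun k j => (finrank_coordSub_inf_range hO₀ (B k) _).symm.trans (hcard k j)) hx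
      have hlogdet : Real.log (O * diagonal (fun i : Fin n => Real.exp (x i)) * Oᴴ).det =
          ∑ i : Fin n, x i := by
        have h := congrArg Matrix.det hOO
        rw [Matrix.det_mul, Matrix.det_one] at h
        rw [Matrix.det_mul, Matrix.det_mul, mul_comm, ← mul_assoc, h, one_mul,
          Matrix.det_diagonal, Real.log_prod fun i _ => (Real.exp_pos _).ne']
        simp only [Real.log_exp]
      have hlog : ∀ k, Real.log (((O₀ᴴ * B k).submatrix (e k) id).det ^ 2 / 2) +
          ∑ a, x (e k a) ≤
          Real.log ((B k)ᴴ * (O * diagonal (fun i : Fin n => Real.exp (x i)) * Oᴴ) * B k).det := by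
        intro k
        have h1 : (B k)ᴴ * (O * diagonal (fun i : Fin n => Real.exp (x i)) * Oᴴ) * B k =
            (Oᴴ * B k)ᴴ * diagonal (fun i : Fin n => Real.exp (x i)) * (Oᴴ * B k) := by
          rw [Matrix.conjTranspose_mul, Matrix.conjTranspose_conjTranspose]
          simp only [Matrix.mul_assoc]
        have h2 : ∑ a, x (e k a) = Real.log (∏ a, Real.exp (x (e k a))) := by
          rw [Real.log_prod fun i _ => (Real.exp_pos _).ne']
          simp only [Real.log_exp]
        have h3 : 0 < ∏ a, Real.exp (x (e k a)) := Finset.prod_pos fun a _ => Real.exp_pos _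
        rw [h1, h2, ← Real.log_mul (hpos k).ne' h3.ne']
        refine Real.log_le_log (mul_pos (hpos k) h3) ?_
        have h4 : ((Oᴴ * B k).submatrix (e k) id).det ≠ 0 := fun h => by
          have h5 := (hpos k).trans (hO k)
          rw [h] at h5
          simp at h5
        exact (mul_le_mul_of_nonneg_right (hO k).le h3.le).trans
          (sq_minor_mul_prod_le_det (Oᴴ * B k) (he k) h4 (x := fun i : Fin n => Real.exp (x i))
            fun i => Real.exp_pos _)
      rw [energy, hlogdet]
      have hsum := Finset.sum_le_sum fun k (_ : k ∈ Finset.univ) =>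
        mul_le_mul_of_nonneg_left (hlog k) (hc k)
      simp only [mul_add, Finset.sum_add_distrib] at hsum
      linarith
  obtain ⟨K, hK⟩ := key
  refine ⟨K, fun H hH => ?_⟩
  set v := hH.isHermitian.eigenvalues with hv
  have hmono : Monotone (v ∘ Tuple.sort v) := Tuple.monotone_sort v
  obtain ⟨O, hO, hOH⟩ := exists_unitary_diagonal hH.isHermitian (v ∘ Tuple.sort v) (by
    rw [hH.isHermitian.charpoly_eq]
    exact (Equiv.prod_comp (Tuple.sort v) fun i => Polynomial.X - Polynomial.C ((v i : ℝ))).symm)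
  rcases Nat.eq_zero_or_pos n with rfl | hn
  · have h := hK O hO hO 0 monotone_const
    convert h using 2
    exact Subsingleton.elim _ _
  · have hlt : ∀ i : ℕ, min i (n - 1) < n := fun i => by omega
    have h := hK O hO hO (fun i => Real.log ((v ∘ Tuple.sort v) ⟨min i (n - 1), hlt i⟩))
      fun i j hij => Real.log_le_log (hH.eigenvalues_pos _)
        (hmono (Fin.mk_le_mk.mpr (min_le_min_right _ hij)))
    convert h using 2
    rw [hOH]
    congr 3
    ext i
    have h1 : (⟨min (i : ℕ) (n - 1), hlt i⟩ : Fin n) = i :=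
      Fin.ext (min_eq_left (Nat.le_sub_one_of_lt i.2))
    rw [h1]
    exact (Real.exp_log (hH.eigenvalues_pos _)).symm

end Energy

section Descent

open scoped ComplexOrder

theorem IsOrthProj.unique {𝕜 ι : Type*} [RCLike 𝕜] [Fintype ι] [DecidableEq ι]
    {P Q : Matrix ι ι 𝕜} {W : Submodule 𝕜 (ι → 𝕜)}
    (hP : IsOrthProj P W) (hQ : IsOrthProj Q W) : P = Q :=
  (hQ.mul_eq hP le_rfl).symm.trans (hP.mul_eq' hQ le_rfl)

theorem isOrthProj_mul_conjTranspose {𝕜 ι m : Type*} [RCLike 𝕜] [Fintype ι] [DecidableEq ι]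
    [Fintype m] [DecidableEq m] {Q : Matrix ι m 𝕜} (hQ : Qᴴ * Q = 1) :
    IsOrthProj (Q * Qᴴ) (LinearMap.range Q.mulVecLin) := by
  refine ⟨Matrix.isHermitian_mul_conjTranspose_self Q, fun v => ⟨Qᴴ *ᵥ v, ?_⟩, ?_⟩
  · rw [Matrix.mulVecLin_apply, Matrix.mulVec_mulVec]
  · rintro _ ⟨v, rfl⟩
    rw [Matrix.mulVecLin_apply, Matrix.mulVec_mulVec, Matrix.mul_assoc, hQ, Matrix.mul_one]

theorem IsOrthProj.diag_conj_mem_Icc {ι : Type*} [Fintype ι] [DecidableEq ι] {P : Matrix ι ι ℝ}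
    {W : Submodule ℝ (ι → ℝ)} (hP : IsOrthProj P W) {O : Matrix ι ι ℝ} (hO : Oᴴ * O = 1) (i : ι) :
    (Oᴴ * P * O) i i ∈ Set.Icc (0 : ℝ) 1 := by
  set R := Oᴴ * P * O with hR
  have h1 : Rᴴ = R := by
    rw [hR, Matrix.conjTranspose_mul, Matrix.conjTranspose_mul, Matrix.conjTranspose_conjTranspose,
      hP.isHermitian.eq, Matrix.mul_assoc]
  have h2 : R * R = R := by
    rw [hR, show Oᴴ * P * O * (Oᴴ * P * O) = Oᴴ * P * (O * Oᴴ) * (P * O) by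
      simp only [Matrix.mul_assoc], mul_eq_one_comm.mp hO, Matrix.mul_one, Matrix.mul_assoc,
      ← Matrix.mul_assoc P, hP.mul_self, Matrix.mul_assoc]
  have h3 : R i i = ∑ j, R i j * R i j := by
    conv_lhs => rw [← h2, Matrix.mul_apply]
    refine Finset.sum_congr rfl fun j _ => ?_
    have h := congrFun (congrFun h1 i) j
    rw [Matrix.conjTranspose_apply, star_trivial] at h
    rw [h]
  have h4 : R i i * R i i ≤ R i i := by
    conv_rhs => rw [h3]
    exact Finset.single_le_sum (f := fun j => R i j * R i j) (fun j _ => mul_self_nonneg _)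
      (Finset.mem_univ i)
  have h5 : 0 ≤ R i i := h3 ▸ Finset.sum_nonneg fun j _ => mul_self_nonneg _
  exact ⟨h5, by nlinarith⟩

/-- Compression of a positive definite form `C` to the image of `B`, compared with the
standard form. -/
theorem log_det_compression_le {ι m : Type*} [Fintype ι] [DecidableEq ι]
    [Fintype m] [DecidableEq m] {B : Matrix ι m ℝ} (hB : Function.Injective B.mulVec)
    {P : Matrix ι ι ℝ} (hP : IsOrthProj P (LinearMap.range B.mulVecLin))
    {C : Matrix ι ι ℝ} (hC : C.PosDef) :
    Real.log (Bᴴ * C * B).det ≤ Real.log (Bᴴ * B).det + (P * (C - 1)).trace := by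
  obtain ⟨M, hM⟩ := exists_normalizing (Matrix.PosDef.conjTranspose_mul_self B hB)
  have hMM : M * (Mᴴ * (Bᴴ * B)) = 1 := mul_eq_one_comm.mp hM
  have hQ : (B * M)ᴴ * (B * M) = 1 := by
    rw [← hM, Matrix.conjTranspose_mul]
    simp only [Matrix.mul_assoc]
  have hrange : LinearMap.range (B * M).mulVecLin = LinearMap.range B.mulVecLin := by
    refine le_antisymm ?_ ?_
    · rw [Matrix.mulVecLin_mul]
      exact LinearMap.range_comp_le_range _ _
    · have h : B = B * M * (Mᴴ * (Bᴴ * B)) := by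
        rw [Matrix.mul_assoc, hMM, Matrix.mul_one]
      conv_lhs => rw [h, Matrix.mulVecLin_mul]
      exact LinearMap.range_comp_le_range _ _
  have hPQ : P = (B * M) * (B * M)ᴴ :=
    hP.unique (hrange ▸ isOrthProj_mul_conjTranspose hQ)
  have hMinj : Function.Injective M.mulVec := mulVec_injective_of_isUnit_det
    ((Matrix.isUnit_iff_isUnit_det _).mp (IsUnit.of_mul_eq_one _ hMM))
  have hinj : Function.Injective (B * M).mulVec := by
    intro x y h
    rw [← Matrix.mulVec_mulVec, ← Matrix.mulVec_mulVec] at h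
    exact hMinj (hB h)
  have hXpos : ((B * M)ᴴ * C * (B * M)).PosDef := hC.conjTranspose_mul_mul_same hinj
  have h1 := log_det_le_trace_sub_card hXpos
  have h2 : ((B * M)ᴴ * C * (B * M)).trace - Fintype.card m = (P * (C - 1)).trace := by
    rw [Matrix.mul_sub, Matrix.trace_sub, Matrix.mul_one, hPQ, Matrix.trace_mul_comm (B * M),
      hQ, Matrix.trace_one, Matrix.mul_assoc, Matrix.mul_assoc (B * M), Matrix.trace_mul_comm,
      Matrix.mul_assoc, Matrix.mul_assoc, Matrix.trace_mul_comm]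
    simp only [Matrix.mul_assoc]
  have h3 : (B * M)ᴴ * C * (B * M) = Mᴴ * (Bᴴ * C * B) * M := by
    rw [Matrix.conjTranspose_mul]
    simp only [Matrix.mul_assoc]
  have hd1 : (Bᴴ * B).det ≠ 0 := (Matrix.PosDef.conjTranspose_mul_self B hB).det_pos.ne'
  have hd2 : (Bᴴ * C * B).det ≠ 0 := (hC.conjTranspose_mul_mul_same hB).det_pos.ne'
  have h4 : ((B * M)ᴴ * C * (B * M)).det = (Bᴴ * C * B).det / (Bᴴ * B).det := by
    have h := congrArg Matrix.det hM
    rw [Matrix.det_mul, Matrix.det_mul, Matrix.det_one] at h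
    rw [h3, Matrix.det_mul, Matrix.det_mul, eq_div_iff hd1]
    linear_combination (Bᴴ * C * B).det * h
  rw [h4, Real.log_div hd2 hd1, h2] at h1
  linarith

theorem exp_neg_sub_one_le {t x : ℝ} (h : |2 * t * x| ≤ 1) :
    Real.exp (-(2 * t * x)) - 1 ≤ -(2 * t * x) + 4 * t ^ 2 * x ^ 2 := by
  have h1 := (abs_le.mp (Real.abs_exp_sub_one_sub_id_le (x := -(2 * t * x)) (by rwa [abs_neg]))).2
  nlinarith

variable {n : ℕ} {s : Type*} [Fintype s] {d : s → ℕ}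

theorem exists_energy_decrease {B : ∀ k, Matrix (Fin n) (Fin (d k)) ℝ}
    (hB : ∀ k, Function.Injective (B k).mulVec) {c : s → ℝ} (hc : ∀ k, 0 ≤ c k) {c₀ : ℝ}
    (htop : degree (fun k => LinearMap.range (B k).mulVecLin) c c₀ ⊤ = 0)
    {t : ℝ} (ht : t = (4 * (∑ k, c k + |c₀| + 1))⁻¹)
    {g : Matrix (Fin n) (Fin n) ℝ} (hg : IsUnit g.det) {P : s → Matrix (Fin n) (Fin n) ℝ}
    (hP : ∀ k, IsOrthProj (P k) ((LinearMap.range (B k).mulVecLin).map g.mulVecLin))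
    {G : Matrix (Fin n) (Fin n) ℝ} (hG : G = ∑ k, c k • P k + c₀ • 1) :
    ∃ g' : Matrix (Fin n) (Fin n) ℝ, IsUnit g'.det ∧
      energy B c c₀ (g'ᴴ * g') ≤ energy B c c₀ (gᴴ * g) - t * (G * G).trace := by
  have hM0 : 0 ≤ ∑ k, c k := Finset.sum_nonneg fun k _ => hc k
  have hden : 0 < ∑ k, c k + |c₀| + 1 := by positivity
  have ht0 : 0 < t := by
    rw [ht]
    positivity
  have ht1 : t * (4 * (∑ k, c k + |c₀| + 1)) = 1 := by
    rw [ht]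
    exact inv_mul_cancel₀ (by positivity)
  have hginj := mulVec_injective_of_isUnit_det hg
  have hGh : G.IsHermitian := by
    rw [hG]
    refine Matrix.IsHermitian.add ?_ ?_
    · rw [Matrix.IsHermitian, Matrix.conjTranspose_sum]
      refine Finset.sum_congr rfl fun k _ => ?_
      rw [Matrix.conjTranspose_smul, (hP k).isHermitian.eq, star_trivial]
    · rw [Matrix.IsHermitian, Matrix.conjTranspose_smul, Matrix.conjTranspose_one, star_trivial]
  have htrG : G.trace = 0 := by
    rw [← htop, hG, Matrix.trace_add, Matrix.trace_sum, degree, Matrix.trace_smul,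
      Matrix.trace_one, finrank_top]
    congr 1
    · refine Finset.sum_congr rfl fun k _ => ?_
      rw [Matrix.trace_smul, (hP k).trace_eq, top_inf_eq, smul_eq_mul,
        ← (Submodule.equivMapOfInjective _ hginj _).finrank_eq]
    · simp
  obtain ⟨O, hO, hGO⟩ := exists_unitary_eigenvalues hGh
  simp only [RCLike.ofReal_real_eq_id, id_eq] at hGO
  set l := hGh.eigenvalues with hl
  have hO' : O * Oᴴ = 1 := mul_eq_one_comm.mp hO
  have hOGO : Oᴴ * G * O = diagonal l := by
    rw [hGO, show Oᴴ * (O * diagonal l * Oᴴ) * O = Oᴴ * O * diagonal l * (Oᴴ * O) by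
      simp only [Matrix.mul_assoc], hO, Matrix.one_mul, Matrix.mul_one]
  have hconj : ∀ x : Fin n → ℝ, (O * diagonal x * Oᴴ).trace = ∑ i, x i := by
    intro x
    rw [Matrix.trace_mul_comm, ← Matrix.mul_assoc, hO, Matrix.one_mul, Matrix.trace_diagonal]
  have hsum : ∑ i, l i = 0 := by rw [← hconj l, ← hGO, htrG]
  have hdiag : ∀ i, l i - c₀ = ∑ k, c k * (Oᴴ * P k * O) i i := by
    intro i
    have h := congrFun (congrFun hOGO i) i
    rw [hG, Matrix.mul_add, Matrix.add_mul, Matrix.mul_sum, Matrix.sum_mul, Matrix.add_apply,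
      Matrix.sum_apply, Matrix.mul_smul, Matrix.mul_one, Matrix.smul_mul, hO,
      Matrix.diagonal_apply_eq, Matrix.smul_apply, Matrix.one_apply_eq, smul_eq_mul, mul_one] at h
    rw [← h, add_sub_cancel_right]
    refine Finset.sum_congr rfl fun k _ => ?_
    rw [Matrix.mul_smul, Matrix.smul_mul, Matrix.smul_apply, smul_eq_mul]
  have hl0 : ∀ i, 0 ≤ l i - c₀ := fun i => by
    rw [hdiag i]
    exact Finset.sum_nonneg fun k _ => mul_nonneg (hc k) ((hP k).diag_conj_mem_Icc hO i).1
  have hl1 : ∀ i, l i - c₀ ≤ ∑ k, c k := fun i => by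
    rw [hdiag i]
    exact Finset.sum_le_sum fun k _ =>
      mul_le_of_le_one_right (hc k) ((hP k).diag_conj_mem_Icc hO i).2
  have hlabs : ∀ i, |l i| ≤ ∑ k, c k + |c₀| := fun i => by
    rw [abs_le]
    have h2 := abs_le.mp (le_refl |c₀|)
    exact ⟨by linarith [hl0 i, h2.1], by linarith [hl1 i, h2.2]⟩
  set E := diagonal (fun i => Real.exp (-(t * l i))) * Oᴴ with hE
  set C := O * diagonal (fun i => Real.exp (-(2 * t * l i))) * Oᴴ with hC
  have hEE : Eᴴ * E = C := by
    rw [hE, hC, Matrix.conjTranspose_mul, Matrix.conjTranspose_conjTranspose,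
      Matrix.diagonal_conjTranspose, star_trivial, Matrix.mul_assoc,
      ← Matrix.mul_assoc (diagonal _), Matrix.diagonal_mul_diagonal, Matrix.mul_assoc]
    congr 3
    ext i
    rw [← Real.exp_add]
    congr 1
    ring
  have hEdet : IsUnit E.det := by
    rw [hE, Matrix.det_mul, Matrix.det_diagonal, Matrix.det_conjTranspose]
    refine IsUnit.mul ?_ (isUnit_det_of_orthogonal hO).star
    exact (Finset.prod_pos fun i _ => Real.exp_pos _).ne'.isUnit
  have hCpos : C.PosDef := by
    rw [← hEE]
    exact Matrix.PosDef.conjTranspose_mul_self E (mulVec_injective_of_isUnit_det hEdet)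
  have hCdet : C.det = 1 := by
    have h := congrArg Matrix.det hO
    rw [Matrix.det_mul, Matrix.det_one] at h
    rw [hC, Matrix.det_mul, Matrix.det_mul, mul_comm, ← mul_assoc, h, one_mul,
      Matrix.det_diagonal, ← Real.exp_sum, Finset.sum_neg_distrib, ← Finset.mul_sum, hsum]
    simp
  refine ⟨E * g, ?_, ?_⟩
  · rw [Matrix.det_mul]
    exact hEdet.mul hg
  have hgE : (E * g)ᴴ * (E * g) = gᴴ * C * g := by
    rw [Matrix.conjTranspose_mul, ← hEE]
    simp only [Matrix.mul_assoc]
  have hstep : ∀ k, Real.log ((B k)ᴴ * (gᴴ * C * g) * B k).det ≤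
      Real.log ((B k)ᴴ * (gᴴ * g) * B k).det + (P k * (C - 1)).trace := by
    intro k
    have hinj : Function.Injective (g * B k).mulVec := by
      intro x y h
      rw [← Matrix.mulVec_mulVec, ← Matrix.mulVec_mulVec] at h
      exact hB k (hginj h)
    have h := log_det_compression_le hinj (P := P k) (by
      rw [Matrix.mulVecLin_mul, LinearMap.range_comp]
      exact hP k) hCpos
    rw [Matrix.conjTranspose_mul] at h
    simpa only [Matrix.mul_assoc] using h
  have hdet2 : (gᴴ * C * g).det = (gᴴ * g).det := by
    rw [Matrix.det_mul (gᴴ * C), Matrix.det_mul gᴴ C, Matrix.det_mul gᴴ g, hCdet, mul_one]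
  have hsum2 : ∑ k, c k * (P k * (C - 1)).trace =
      ∑ i, (l i - c₀) * (Real.exp (-(2 * t * l i)) - 1) := by
    have h1 : ∑ k, c k * (P k * (C - 1)).trace = ((G - c₀ • 1) * (C - 1)).trace := by
      rw [hG, add_sub_cancel_right, Matrix.sum_mul, Matrix.trace_sum]
      refine Finset.sum_congr rfl fun k _ => ?_
      rw [Matrix.smul_mul, Matrix.trace_smul, smul_eq_mul]
    have h2 : G - c₀ • 1 = O * diagonal (fun i => l i - c₀) * Oᴴ := by
      rw [← Matrix.diagonal_sub, Matrix.mul_sub, Matrix.sub_mul, ← hGO,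
        ← Matrix.smul_one_eq_diagonal, Matrix.mul_smul, Matrix.mul_one, Matrix.smul_mul, hO']
    have h3 : C - 1 = O * diagonal (fun i => Real.exp (-(2 * t * l i)) - 1) * Oᴴ := by
      rw [← Matrix.diagonal_sub, Matrix.mul_sub, Matrix.sub_mul, Matrix.diagonal_one,
        Matrix.mul_one, hO', hC]
    rw [h1, h2, h3, show O * diagonal (fun i => l i - c₀) * Oᴴ *
        (O * diagonal (fun i => Real.exp (-(2 * t * l i)) - 1) * Oᴴ) =
        O * (diagonal (fun i => l i - c₀) * (Oᴴ * O) *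
          diagonal (fun i => Real.exp (-(2 * t * l i)) - 1)) * Oᴴ by
        simp only [Matrix.mul_assoc], hO, Matrix.mul_one, Matrix.diagonal_mul_diagonal, hconj]
  have htrGG : (G * G).trace = ∑ i, l i ^ 2 := by
    rw [hGO, show O * diagonal l * Oᴴ * (O * diagonal l * Oᴴ) =
      O * (diagonal l * (Oᴴ * O) * diagonal l) * Oᴴ by simp only [Matrix.mul_assoc], hO,
      Matrix.mul_one, Matrix.diagonal_mul_diagonal, hconj]
    simp only [sq]
  have hterm : ∀ i, (l i - c₀) * (Real.exp (-(2 * t * l i)) - 1) ≤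
      -(t * l i ^ 2) + 2 * t * c₀ * l i := by
    intro i
    have h1 : |2 * t * l i| ≤ 1 := by
      rw [abs_mul, abs_of_pos (by positivity : 0 < 2 * t)]
      nlinarith [hlabs i]
    have h2 := mul_le_mul_of_nonneg_left (exp_neg_sub_one_le h1) (hl0 i)
    have h3 : 4 * t * (l i - c₀) ≤ 1 := by
      nlinarith [hl1 i, abs_nonneg c₀]
    nlinarith [mul_nonneg (mul_nonneg ht0.le (sq_nonneg (l i))) (sub_nonneg.mpr h3)]
  have hfin : ∑ k, c k * (P k * (C - 1)).trace ≤ -(t * (G * G).trace) := by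
    rw [hsum2, htrGG]
    refine (Finset.sum_le_sum fun i _ => hterm i).trans_eq ?_
    rw [Finset.sum_add_distrib, ← Finset.mul_sum, hsum, Finset.sum_neg_distrib, ← Finset.mul_sum]
    ring
  rw [hgE, energy, energy, hdet2]
  have h := Finset.sum_le_sum fun k (_ : k ∈ Finset.univ) =>
    mul_le_mul_of_nonneg_left (hstep k) (hc k)
  simp only [mul_add, Finset.sum_add_distrib] at h
  linarith

theorem exists_almost_critical {B : ∀ k, Matrix (Fin n) (Fin (d k)) ℝ}
    (hB : ∀ k, Function.Injective (B k).mulVec) {c : s → ℝ} (hc : ∀ k, 0 ≤ c k) {c₀ : ℝ}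
    (hdeg : ∀ V, degree (fun k => LinearMap.range (B k).mulVecLin) c c₀ V ≤ 0)
    (htop : degree (fun k => LinearMap.range (B k).mulVecLin) c c₀ ⊤ = 0) {ε : ℝ} (hε : 0 < ε) :
    ∃ g : Matrix (Fin n) (Fin n) ℝ, IsUnit g.det ∧ ∀ P : s → Matrix (Fin n) (Fin n) ℝ,
      (∀ k, IsOrthProj (P k) ((LinearMap.range (B k).mulVecLin).map g.mulVecLin)) →
      ((∑ k, c k • P k + c₀ • 1) * (∑ k, c k • P k + c₀ • 1)).trace ≤ ε := by
  by_contra! hcon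
  obtain ⟨K, hK⟩ := exists_energy_lower_bound hB hc hdeg htop
  set t := (4 * (∑ k, c k + |c₀| + 1))⁻¹ with ht
  have ht0 : 0 < t := by
    have hM0 : 0 ≤ ∑ k, c k := Finset.sum_nonneg fun k _ => hc k
    positivity
  have hdesc : ∀ m : ℕ, ∃ g : Matrix (Fin n) (Fin n) ℝ, IsUnit g.det ∧
      energy B c c₀ (gᴴ * g) ≤ energy B c c₀ 1 - m * (t * ε) := by
    intro m
    induction m with
    | zero => exact ⟨1, by simp, by simp⟩
    | succ m ih =>
      obtain ⟨g, hg, hgE⟩ := ih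
      obtain ⟨P, hP, hPε⟩ := hcon g hg
      obtain ⟨g', hg', h⟩ := exists_energy_decrease hB hc htop ht hg hP rfl
      refine ⟨g', hg', ?_⟩
      have h2 := mul_le_mul_of_nonneg_left hPε.le ht0.le
      push_cast
      linarith
  obtain ⟨m, hm⟩ := exists_nat_gt ((energy B c c₀ 1 - K) / (t * ε))
  obtain ⟨g, hg, h⟩ := hdesc m
  have h1 := hK _ (Matrix.PosDef.conjTranspose_mul_self g (mulVec_injective_of_isUnit_det hg))
  rw [div_lt_iff₀ (mul_pos ht0 hε)] at hm
  linarith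

end Descent

section Limit

open scoped ComplexOrder

variable {n : ℕ} {κ : Type*} [Fintype κ]

theorem flagDegree_top {K ι : Type*} [Field K] [Fintype ι] [DecidableEq ι] (pos : κ → ι → ℕ)
    (w : κ → ℕ → ℝ) {N : ℕ} (hpos : ∀ f i, pos f i < N) {A : κ → Matrix ι ι K}
    (hA : ∀ f, IsUnit (A f).det) :
    flagDegree pos w N A ⊤ = ∑ f, ∑ i, w f (pos f i) := by
  rw [flagDegree, degree, Fintype.sum_prod_type, Finset.sum_mul, ← Finset.sum_add_distrib]
  refine Finset.sum_congr rfl fun f _ => ?_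
  rw [← sum_drop_mul_card (pos f) (w f) (hpos f) Finset.univ, finrank_top,
    finrank_fintype_fun_eq_card, Finset.card_univ]
  congr 1
  refine Finset.sum_congr rfl fun j _ => ?_
  rw [top_inf_eq, finrank_stp (hA f)]
  rfl

theorem exists_orthogonal_weight_sum_small {A : κ → Matrix (Fin n) (Fin n) ℝ}
    (hA : ∀ f, IsUnit (A f).det) {w : κ → ℕ → ℝ} (hw : ∀ f, Antitone (w f))
    (hV : ∀ V, flagDegree (fun (_ : κ) (i : Fin n) => (i : ℕ)) w n A V ≤ 0)
    (htop : ∑ f, ∑ i : Fin n, w f i = 0) {ε : ℝ} (hε : 0 < ε) :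
    ∃ O : κ → Matrix (Fin n) (Fin n) ℝ, (∀ f, (O f)ᴴ * O f = 1) ∧
      ((∑ f, O f * diagonal (fun i : Fin n => w f i) * (O f)ᴴ) *
        (∑ f, O f * diagonal (fun i : Fin n => w f i) * (O f)ᴴ)).trace ≤ ε := by
  choose B hB hrange using fun k : κ × Fin n =>
    exists_basis_matrix (stp (A k.1) (lower (fun i : Fin n => (i : ℕ)) k.2))
  have hrange' : (fun k => LinearMap.range (B k).mulVecLin) =
      fun k : κ × Fin n => stp (A k.1) (lower (fun i : Fin n => (i : ℕ)) k.2) := funext hrange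
  have htop' : degree (fun k => LinearMap.range (B k).mulVecLin)
      (fun k => w k.1 k.2 - w k.1 (k.2 + 1)) (∑ f, w f n) ⊤ = 0 := by
    rw [hrange', ← htop]
    exact flagDegree_top (fun (_ : κ) (i : Fin n) => (i : ℕ)) w (fun _ i => i.2) hA
  have hV' : ∀ V, degree (fun k => LinearMap.range (B k).mulVecLin)
      (fun k => w k.1 k.2 - w k.1 (k.2 + 1)) (∑ f, w f n) V ≤ 0 := by
    rw [hrange']
    exact hV
  obtain ⟨g, hg, hP⟩ := exists_almost_critical hB
    (fun k => sub_nonneg.mpr (hw k.1 (Nat.le_succ _))) hV' htop' hε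
  choose R hRt hR hO using fun f => exists_triangular_mul_orthogonal (M := g * A f) (by
    rw [Matrix.det_mul]
    exact hg.mul (hA f))
  refine ⟨fun f => g * A f * R f, hO, ?_⟩
  have h := hP (fun k => g * A k.1 * R k.1 *
    diagonal (fun i => if i ∈ lower (fun i : Fin n => (i : ℕ)) k.2 then 1 else 0) *
    (g * A k.1 * R k.1)ᴴ) (fun k => by
      have h1 := isOrthProj_stp (hO k.1) (lower (fun i : Fin n => (i : ℕ)) k.2)
      rwa [stp_mul (hR k.1) (fun r hr i hi => hRt k.1 r i (by
        rw [mem_lower] at hr hi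
        exact Fin.lt_def.mpr (by omega))), ← stp_map, ← hrange k] at h1)
  convert h using 3
  all_goals
    rw [Fintype.sum_prod_type, Finset.sum_smul, ← Finset.sum_add_distrib]
    refine Finset.sum_congr rfl fun f _ => ?_
    have h2 := diagonal_weight_eq (𝕜 := ℝ) (fun i : Fin n => (i : ℕ)) (w f) fun i => i.2
    simp only [RCLike.ofReal_real_eq_id, id_eq] at h2
    rw [h2, Matrix.mul_add, Matrix.add_mul, Matrix.mul_smul, Matrix.mul_one, Matrix.smul_mul,
      mul_eq_one_comm.mp (hO f), Matrix.mul_sum, Matrix.sum_mul]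
    simp only [Matrix.mul_smul, Matrix.smul_mul]

theorem exists_orthogonal_weight_sum {A : κ → Matrix (Fin n) (Fin n) ℝ}
    (hA : ∀ f, IsUnit (A f).det) {w : κ → ℕ → ℝ} (hw : ∀ f, Antitone (w f))
    (hV : ∀ V, flagDegree (fun (_ : κ) (i : Fin n) => (i : ℕ)) w n A V ≤ 0)
    (htop : ∑ f, ∑ i : Fin n, w f i = 0) :
    ∃ O : κ → Matrix (Fin n) (Fin n) ℝ, (∀ f, (O f)ᴴ * O f = 1) ∧
      ∑ f, O f * diagonal (fun i : Fin n => w f i) * (O f)ᴴ = 0 := by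
  set F : (κ → Matrix (Fin n) (Fin n) ℝ) → Matrix (Fin n) (Fin n) ℝ :=
    fun O => ∑ f, O f * diagonal (fun i : Fin n => w f i) * (O f)ᴴ with hF
  have hFc : Continuous F := by fun_prop
  have hcomp : IsCompact (Set.univ.pi fun _ : κ => {O : Matrix (Fin n) (Fin n) ℝ | Oᴴ * O = 1}) :=
    isCompact_univ_pi fun _ => isCompact_orthogonal n
  have hne : (Set.univ.pi fun _ : κ => {O : Matrix (Fin n) (Fin n) ℝ | Oᴴ * O = 1}).Nonempty :=
    ⟨fun _ => 1, fun _ _ => by simp⟩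
  obtain ⟨O, hO, hmin⟩ := hcomp.exists_isMinOn hne
    (f := fun O => (F O * F O).trace) (by fun_prop)
  refine ⟨O, fun f => hO f trivial, ?_⟩
  have hle : (F O * F O).trace ≤ 0 := by
    refine le_of_forall_pos_le_add fun ε hε => ?_
    obtain ⟨O', hO', h⟩ := exists_orthogonal_weight_sum_small hA hw hV htop hε
    rw [zero_add]
    exact (hmin fun f _ => hO' f).trans h
  have hH : (F O)ᴴ = F O := by
    rw [hF, Matrix.conjTranspose_sum]
    refine Finset.sum_congr rfl fun f _ => ?_
    rw [Matrix.conjTranspose_mul, Matrix.conjTranspose_mul, Matrix.conjTranspose_conjTranspose,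
      Matrix.diagonal_conjTranspose, star_trivial, Matrix.mul_assoc]
  have h0 : 0 ≤ ((F O)ᴴ * F O).trace := (Matrix.posSemidef_conjTranspose_mul_self (F O)).trace_nonneg
  refine Matrix.trace_conjTranspose_mul_self_eq_zero_iff.mp (le_antisymm ?_ h0)
  rwa [hH]

end Limit

theorem trace_eq_sum_of_charpoly {ι : Type*} [Fintype ι] [DecidableEq ι] {A : Matrix ι ι ℝ}
    (hA : A.IsHermitian) {d : ι → ℝ}
    (h : A.charpoly = ∏ i, (Polynomial.X - Polynomial.C (d i))) : A.trace = ∑ i, d i := by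
  obtain ⟨U, hU, h1⟩ := exists_unitary_diagonal hA d h
  rw [h1, Matrix.trace_mul_comm, ← Matrix.mul_assoc, hU, Matrix.one_mul, Matrix.trace_diagonal]
  rfl

theorem charpoly_orthogonal_diagonal {ι : Type*} [Fintype ι] [DecidableEq ι] {O : Matrix ι ι ℝ}
    (hO : Oᴴ * O = 1) (d : ι → ℝ) :
    (O * diagonal d * Oᴴ).charpoly = ∏ i, (Polynomial.X - Polynomial.C (d i)) := by
  rw [charpoly_conj_of_mul_eq_one (mul_eq_one_comm.mp hO), Matrix.charpoly_diagonal]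

theorem isSymm_orthogonal_diagonal {ι : Type*} [Fintype ι] [DecidableEq ι] (O : Matrix ι ι ℝ)
    (d : ι → ℝ) : (O * diagonal d * Oᴴ).IsSymm := by
  rw [Matrix.IsSymm, Matrix.conjTranspose_eq_transpose_of_trivial, Matrix.transpose_mul,
    Matrix.transpose_mul, Matrix.transpose_transpose, Matrix.diagonal_transpose, Matrix.mul_assoc]

theorem exists_sum_of_double {n : ℕ} {S J : Matrix (Fin n ⊕ Fin n) (Fin n ⊕ Fin n) ℝ}
    (hS : S.IsSymm) (hJ : Jᵀ = -J) (hJ2 : J * J = -1) {σ γ : ℕ → ℝ} (hσ : Antitone σ)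
    (hγ : Antitone γ)
    (hSσ : S.charpoly = ∏ i, (Polynomial.X - Polynomial.C (σ (posY n true i))))
    (hSγ : (S - J * S * J).charpoly =
      ∏ i : Fin n, (Polynomial.X - Polynomial.C (-γ i)) ^ 2) :
    ∃ a b : Matrix (Fin n) (Fin n) ℝ, a.IsSymm ∧ b.IsSymm ∧
      a.charpoly = ∏ i : Fin n, (Polynomial.X - Polynomial.C (σ (2 * i))) ∧
      b.charpoly = ∏ i : Fin n, (Polynomial.X - Polynomial.C (σ (2 * i + 1))) ∧
      (a + b).charpoly = ∏ i : Fin n, (Polynomial.X - Polynomial.C (-γ i)) := by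
  obtain ⟨A, hA, hV⟩ := exists_semistable_flags hS hJ hJ2 hσ hγ hSσ hSγ
  have hw : ∀ f, Antitone (wX σ γ f) := by
    intro f
    fin_cases f
    · exact fun i j hij => hσ (by omega)
    · exact fun i j hij => hσ (by omega)
    · exact hγ
  have htop : ∑ f, ∑ i : Fin n, wX σ γ f i = 0 := by
    have hSh : S.IsHermitian := by
      rw [Matrix.IsHermitian, Matrix.conjTranspose_eq_transpose_of_trivial]
      exact hS
    have hSJ : (S - J * S * J).IsHermitian := by
      rw [Matrix.IsHermitian, Matrix.conjTranspose_eq_transpose_of_trivial, Matrix.transpose_sub,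
        Matrix.transpose_mul, Matrix.transpose_mul, hJ, hS.eq]
      simp [Matrix.mul_assoc]
    have h1 := trace_eq_sum_of_charpoly hSh hSσ
    have h2 := trace_eq_sum_of_charpoly hSJ
      (d := Sum.elim (fun i : Fin n => -γ i) (fun i : Fin n => -γ i)) (by
        rw [hSγ, Fintype.prod_sum_type, ← Finset.prod_mul_distrib]
        exact Finset.prod_congr rfl fun i _ => sq _)
    rw [Matrix.trace_sub, Matrix.mul_assoc, Matrix.trace_mul_comm, Matrix.mul_assoc, hJ2,
      Matrix.mul_neg, Matrix.mul_one, Matrix.trace_neg, Fintype.sum_sum_type] at h2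
    rw [Fintype.sum_sum_type] at h1
    simp only [Sum.elim_inl, Sum.elim_inr, Finset.sum_neg_distrib] at h2
    rw [Fin.sum_univ_three]
    change S.trace = ∑ i : Fin n, σ (2 * i) + ∑ i : Fin n, σ (2 * i + 1) at h1
    change ∑ i : Fin n, σ (2 * i) + ∑ i : Fin n, σ (2 * i + 1) + ∑ i : Fin n, γ i = 0
    linarith
  obtain ⟨O, hO, hsum⟩ := exists_orthogonal_weight_sum hA hw hV htop
  refine ⟨_, _, isSymm_orthogonal_diagonal (O 0) _, isSymm_orthogonal_diagonal (O 1) _,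
    charpoly_orthogonal_diagonal (hO 0) _, charpoly_orthogonal_diagonal (hO 1) _, ?_⟩
  rw [Fin.sum_univ_three] at hsum
  have h : O 0 * diagonal (fun i : Fin n => σ (2 * i)) * (O 0)ᴴ +
      O 1 * diagonal (fun i : Fin n => σ (2 * i + 1)) * (O 1)ᴴ =
      O 2 * diagonal (fun i : Fin n => -γ i) * (O 2)ᴴ := by
    refine (eq_neg_of_add_eq_zero_left hsum).trans ?_
    rw [← Matrix.diagonal_neg, Matrix.mul_neg, Matrix.neg_mul]
    rfl
  rw [h, charpoly_orthogonal_diagonal (hO 2)]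

/-- The pairing of the doubled index set with `Fin (2 * n)` that interleaves the two halves. -/
noncomputable def interleave (n : ℕ) : Fin n ⊕ Fin n ≃ Fin (2 * n) :=
  Equiv.ofBijective (fun i => ⟨posY n true i, by
    rcases i with i | i
    · change 2 * (i : ℕ) < 2 * n
      omega
    · change 2 * (i : ℕ) + 1 < 2 * n
      omega⟩) (by
    refine (Fintype.bijective_iff_injective_and_card _).mpr ⟨?_, by simp [two_mul]⟩
    rintro (i | i) (j | j) h
    all_goals
      have h1 := congrArg Fin.val h
    · change 2 * (i : ℕ) = 2 * j at h1
      exact congrArg Sum.inl (Fin.ext (by omega))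
    · change 2 * (i : ℕ) = 2 * j + 1 at h1
      omega
    · change 2 * (i : ℕ) + 1 = 2 * j at h1
      omega
    · change 2 * (i : ℕ) + 1 = 2 * j + 1 at h1
      exact congrArg Sum.inr (Fin.ext (by omega)))

theorem interleave_val (n : ℕ) (i : Fin n ⊕ Fin n) :
    (interleave n i : ℕ) = posY n true i := rfl

theorem exists_double_of_sum {n : ℕ} {S : Matrix (Fin n ⊕ Fin n) (Fin n ⊕ Fin n) ℝ}
    (hS : S.IsSymm) {a b : Matrix (Fin n) (Fin n) ℝ} (ha : a.IsSymm) (hb : b.IsSymm)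
    {d : Fin n ⊕ Fin n → ℝ} (hSd : S.charpoly = ∏ i, (Polynomial.X - Polynomial.C (d i)))
    (hab : S.charpoly = a.charpoly * b.charpoly) :
    ∃ J : Matrix (Fin n ⊕ Fin n) (Fin n ⊕ Fin n) ℝ, Jᵀ * J = 1 ∧ J * J = -1 ∧
      (S - J * S * J).charpoly = (a + b).charpoly ^ 2 := by
  set D : Matrix (Fin n ⊕ Fin n) (Fin n ⊕ Fin n) ℝ := fromBlocks a 0 0 b with hD
  set J₀ : Matrix (Fin n ⊕ Fin n) (Fin n ⊕ Fin n) ℝ := fromBlocks 0 (-1) 1 0 with hJ₀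
  have hSh : S.IsHermitian := by
    rw [Matrix.IsHermitian, Matrix.conjTranspose_eq_transpose_of_trivial]
    exact hS
  have hDh : D.IsHermitian := by
    rw [Matrix.IsHermitian, Matrix.conjTranspose_eq_transpose_of_trivial, hD,
      Matrix.fromBlocks_transpose, ha.eq, hb.eq, Matrix.transpose_zero]
  have hDd : D.charpoly = ∏ i, (Polynomial.X - Polynomial.C (d i)) := by
    rw [← hSd, hab, hD, Matrix.charpoly_fromBlocks_zero₁₂]
  obtain ⟨U, hU, hSU⟩ := exists_unitary_diagonal hSh d hSd
  obtain ⟨V, hV, hDV⟩ := exists_unitary_diagonal hDh d hDd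
  have hU' := mul_eq_one_comm.mp hU
  have hV' := mul_eq_one_comm.mp hV
  set Q := U * Vᴴ with hQ
  have hQQ : Qᴴ * Q = 1 := by
    rw [hQ, Matrix.conjTranspose_mul, Matrix.conjTranspose_conjTranspose,
      show V * Uᴴ * (U * Vᴴ) = V * (Uᴴ * U) * Vᴴ by simp only [Matrix.mul_assoc], hU,
      Matrix.mul_one, hV']
  have hQQ' := mul_eq_one_comm.mp hQQ
  have hSQ : S = Q * D * Qᴴ := by
    rw [hDV, hQ, Matrix.conjTranspose_mul, Matrix.conjTranspose_conjTranspose,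
      show ∀ E, U * Vᴴ * (V * E * Vᴴ) * (V * Uᴴ) = U * (Vᴴ * V) * E * (Vᴴ * V) * Uᴴ by
        intro E
        simp only [Matrix.mul_assoc], hV, Matrix.mul_one, Matrix.mul_one]
    exact hSU
  clear_value Q
  have hJJ : J₀ * J₀ = -1 := by
    rw [hJ₀, Matrix.fromBlocks_multiply, ← Matrix.fromBlocks_one, Matrix.fromBlocks_neg]
    simp
  have hJt : J₀ᵀ = -J₀ := by
    rw [hJ₀, Matrix.fromBlocks_transpose, Matrix.fromBlocks_neg]
    simp
  have hsq : Q * J₀ * Qᴴ * (Q * J₀ * Qᴴ) = -1 := by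
    rw [show Q * J₀ * Qᴴ * (Q * J₀ * Qᴴ) = Q * J₀ * (Qᴴ * Q) * J₀ * Qᴴ by
      simp only [Matrix.mul_assoc], hQQ, Matrix.mul_one, Matrix.mul_assoc Q, hJJ, Matrix.mul_neg,
      Matrix.neg_mul, Matrix.mul_one, hQQ']
  refine ⟨Q * J₀ * Qᴴ, ?_, hsq, ?_⟩
  · have h : (Q * J₀ * Qᴴ)ᵀ = -(Q * J₀ * Qᴴ) := by
      rw [Matrix.conjTranspose_eq_transpose_of_trivial, Matrix.transpose_mul,
        Matrix.transpose_mul, Matrix.transpose_transpose, hJt]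
      simp [Matrix.mul_assoc]
    rw [h, Matrix.neg_mul, hsq, neg_neg]
  · have hDJ : D - J₀ * D * J₀ = fromBlocks (a + b) 0 0 (a + b) := by
      rw [hD, hJ₀, Matrix.fromBlocks_multiply, Matrix.fromBlocks_multiply, sub_eq_add_neg,
        Matrix.fromBlocks_neg, Matrix.fromBlocks_add]
      simp [add_comm]
    have hconj : S - Q * J₀ * Qᴴ * S * (Q * J₀ * Qᴴ) = Q * (D - J₀ * D * J₀) * Qᴴ := by
      rw [hSQ, show Q * J₀ * Qᴴ * (Q * D * Qᴴ) * (Q * J₀ * Qᴴ) =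
        Q * J₀ * (Qᴴ * Q) * D * (Qᴴ * Q) * J₀ * Qᴴ by simp only [Matrix.mul_assoc], hQQ,
        Matrix.mul_one, Matrix.mul_one, Matrix.mul_sub, Matrix.sub_mul]
      simp only [Matrix.mul_assoc]
    rw [hconj, charpoly_conj_of_mul_eq_one hQQ', hDJ, Matrix.charpoly_fromBlocks_zero₁₂, sq]

theorem inv_eq_neg_of_mul_self {ι : Type*} [Fintype ι] [DecidableEq ι] {J : Matrix ι ι ℝ}
    (hJ : J * J = -1) : J⁻¹ = -J :=
  Matrix.inv_eq_left_inv (by rw [Matrix.neg_mul, hJ, neg_neg])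

theorem transpose_eq_neg {ι : Type*} [Fintype ι] [DecidableEq ι] {J : Matrix ι ι ℝ}
    (hJt : Jᵀ * J = 1) (hJ : J * J = -1) : Jᵀ = -J := by
  rw [← inv_eq_neg_of_mul_self hJ, Matrix.inv_eq_left_inv hJt]

end FrequencyMap

open FrequencyMap

/-- `Im ℱ = 𝒫₁`. Let `S₀` be a real symmetric `2p × 2p` matrix
with ordered spectrum `σ₁ ≥ ⋯ ≥ σ_{2p}`.  A decreasing `p`-tuple `ν` is the ordered
spectrum of a sum `a + b` of real symmetric `p × p` matrices with ordered spectra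
`(σ₁, σ₃, …, σ_{2p-1})` and `(σ₂, σ₄, …, σ_{2p})` respectively if and only if there is
a hermitian structure `J` on `ℝ^{2p}` such that the ordered spectrum of
`S₀ + J⁻¹ S₀ J` is the doubled list `(ν₁, ν₁, …, ν_p, ν_p)`. -/
theorem image_frequency_map_eq_P1
    (p : ℕ) (hp : 1 ≤ p)
    (σ : Fin (2 * p) → ℝ) (hσ : Antitone σ)
    (S₀ : Matrix (Fin (2 * p)) (Fin (2 * p)) ℝ) (hS₀ : S₀.IsSymm)
    (hS₀spec : S₀.charpoly = ∏ i : Fin (2 * p), (Polynomial.X - Polynomial.C (σ i)))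
    (ν : Fin p → ℝ) (hν : Antitone ν) :
    (∃ a b : Matrix (Fin p) (Fin p) ℝ, a.IsSymm ∧ b.IsSymm ∧
        a.charpoly = ∏ i : Fin p,
          (Polynomial.X - Polynomial.C (σ ⟨2 * i.val, by have := i.isLt; omega⟩)) ∧
        b.charpoly = ∏ i : Fin p,
          (Polynomial.X - Polynomial.C (σ ⟨2 * i.val + 1, by have := i.isLt; omega⟩)) ∧
        (a + b).charpoly = ∏ i : Fin p, (Polynomial.X - Polynomial.C (ν i))) ↔
    (∃ J : Matrix (Fin (2 * p)) (Fin (2 * p)) ℝ,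
        Jᵀ * J = 1 ∧ J * J = -1 ∧
        (S₀ + J⁻¹ * S₀ * J).charpoly =
          ∏ i : Fin p, (Polynomial.X - Polynomial.C (ν i)) ^ 2) := by
  set φ := Matrix.reindexAlgEquiv ℝ ℝ (interleave p).symm with hφ
  have hchar : ∀ M, (φ M).charpoly = M.charpoly :=
    fun M => Matrix.charpoly_reindex (interleave p).symm M
  have htr : ∀ M, φ Mᵀ = (φ M)ᵀ := fun _ => rfl
  have hSsymm : (φ S₀).IsSymm := by rw [Matrix.IsSymm, ← htr, hS₀.eq]
  have hSspec : (φ S₀).charpoly =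
      ∏ i, (Polynomial.X - Polynomial.C (σ (interleave p i))) := by
    rw [hchar, hS₀spec]
    exact (Equiv.prod_comp (interleave p) fun i => Polynomial.X - Polynomial.C (σ i)).symm
  have hinv : ∀ {J : Matrix (Fin (2 * p)) (Fin (2 * p)) ℝ}, J * J = -1 →
      (S₀ + J⁻¹ * S₀ * J).charpoly = (φ S₀ - φ J * φ S₀ * φ J).charpoly := by
    intro J hJ
    rw [← map_mul, ← map_mul, ← map_sub, hchar, inv_eq_neg_of_mul_self hJ, Matrix.neg_mul,
      Matrix.neg_mul, sub_eq_add_neg]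
  constructor
  · rintro ⟨a, b, ha, hb, haσ, hbσ, hab⟩
    obtain ⟨J, hJt, hJ, h⟩ := exists_double_of_sum hSsymm ha hb hSspec (by
      rw [hSspec, Fintype.prod_sum_type, haσ, hbσ]
      rfl)
    have hJ' : φ.symm J * φ.symm J = -1 := by rw [← map_mul, hJ, map_neg, map_one]
    refine ⟨φ.symm J, φ.injective ?_, hJ', ?_⟩
    · rw [map_mul, htr, φ.apply_symm_apply, hJt, map_one]
    · rw [hinv hJ', φ.apply_symm_apply, h, hab, Finset.prod_pow]
  · rintro ⟨J, hJt, hJ, h⟩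
    have hlt : ∀ k, min k (2 * p - 1) < 2 * p := fun k => by omega
    have hlt' : ∀ k, p - 1 - k < p := fun k => by omega
    have hmin : ∀ k (hk : k < 2 * p), (⟨min k (2 * p - 1), hlt k⟩ : Fin (2 * p)) = ⟨k, hk⟩ :=
      fun k hk => Fin.ext (by simp only; omega)
    have hrev : ∀ i : Fin p, (⟨p - 1 - i, hlt' i⟩ : Fin p) = i.rev :=
      fun i => Fin.ext (by rw [Fin.val_rev]; simp only; omega)
    have hJt' : (φ J)ᵀ = -φ J := by rw [← htr, transpose_eq_neg hJt hJ, map_neg]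
    have hJ' : φ J * φ J = -1 := by rw [← map_mul, hJ, map_neg, map_one]
    obtain ⟨a, b, ha, hb, haσ, hbσ, hab⟩ := exists_sum_of_double hSsymm hJt' hJ'
      (σ := fun k => σ ⟨min k (2 * p - 1), hlt k⟩) (γ := fun k => -ν ⟨p - 1 - k, hlt' k⟩)
      (fun i j hij => hσ (Fin.mk_le_mk.mpr (min_le_min_right _ hij)))
      (fun i j hij => neg_le_neg (hν (Fin.mk_le_mk.mpr (Nat.sub_le_sub_left hij _))))
      (by
        rw [hSspec]
        refine Finset.prod_congr rfl fun i _ => ?_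
        rw [← interleave_val, hmin _ (interleave p i).2])
      (by
        rw [← hinv hJ, h]
        simp only [neg_neg, hrev]
        exact (Equiv.prod_comp Fin.revPerm
          fun i => (Polynomial.X - Polynomial.C (ν i)) ^ 2).symm)
    refine ⟨a, b, ha, hb, ?_, ?_, ?_⟩
    · rw [haσ]
      exact Finset.prod_congr rfl fun i _ => by rw [hmin]
    · rw [hbσ]
      exact Finset.prod_congr rfl fun i _ => by rw [hmin]
    · rw [hab]
      simp only [neg_neg, hrev]
      exact Equiv.prod_comp Fin.revPerm fun i => Polynomial.X - Polynomial.C (ν i)
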